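/- arXiv:2601.05571 — 6 statements merged into one kernel-verified Lean document; each statement's English description precedes it below -/
import Mathlib

section
/- For every cubic form F ∈ 𝒰, the set of quadratic forms Q ∈ S_2 satisfying simultaneously (i) the pair (F,Q) defines a smooth complete intersection surface in ℙ⁴, (ii) the subspace (J_{F,5}:Q)^⊥ of S_3 is one-dimensional and spanned by a smooth cubic, and (iii) (J_{F,3}:Q) = 0, contains a nonempty Zariski open subset of S_2. (Corollary to Theorems 1.3 and 1.4.) -/
open MvPolynomial

/-- `F` is smooth: the only common zero of its partial derivatives is the origin. -/
def SmoothForm {N : ℕ} (F : MvPolynomial (Fin N) ℂ) : Prop :=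
  ∀ x : Fin N → ℂ, (∀ i, eval x (pderiv i F) = 0) → x = 0

/-- The Jacobian ideal of `F`. -/
noncomputable def jacobianIdeal {N : ℕ} (F : MvPolynomial (Fin N) ℂ) :
    Ideal (MvPolynomial (Fin N) ℂ) :=
  Ideal.span (Set.range fun i => pderiv i F)

/-- `J_{F,k} = J_F ∩ S_k`. -/
def Jpart {N : ℕ} (F : MvPolynomial (Fin N) ℂ) (k : ℕ) : Set (MvPolynomial (Fin N) ℂ) :=
  {b | b ∈ jacobianIdeal F ∧ b ∈ homogeneousSubmodule (Fin N) ℂ k}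

/-- The polar pairing `⟨P, G⟩ = G(∂/∂x₀,…)P`, as a constant. -/
noncomputable def polarPair {N : ℕ} (P G : MvPolynomial (Fin N) ℂ) : ℂ :=
  constantCoeff (∑ m ∈ G.support, G.coeff m •
    ((List.ofFn fun i : Fin N =>
      ((pderiv i).toLinearMap : Module.End ℂ (MvPolynomial (Fin N) ℂ)) ^ (m i)).prod P))

/-- `E^⊥ = {G ∈ S₃ : ⟨b, G⟩ = 0 for all b ∈ E}`. -/
def perp {N : ℕ} (E : Set (MvPolynomial (Fin N) ℂ)) : Set (MvPolynomial (Fin N) ℂ) :=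
  {G | G ∈ homogeneousSubmodule (Fin N) ℂ 3 ∧ ∀ b ∈ E, polarPair b G = 0}

/-- The set `𝒰` of smooth cubic forms `F` such that `(J_{F,3})^⊥` contains a smooth cubic. -/
def calU : Set (MvPolynomial (Fin 5) ℂ) :=
  {F | F ∈ homogeneousSubmodule (Fin 5) ℂ 3 ∧ SmoothForm F ∧
    ∃ G, G ∈ perp (Jpart F 3) ∧ SmoothForm G}

/-- `(F, Q)` defines a smooth complete intersection: at every nonzero common zero `p` of
`F` and `Q` the gradients `∇F(p)` and `∇Q(p)` are linearly independent. -/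
def SmoothCI (F Q : MvPolynomial (Fin 5) ℂ) : Prop :=
  ∀ p : Fin 5 → ℂ, p ≠ 0 → eval p F = 0 → eval p Q = 0 →
    LinearIndependent ℂ ![fun i => eval p (pderiv i F), fun i => eval p (pderiv i Q)]

/-- The colon space `(J_{F,5} : Q) = {b ∈ S₃ : bQ ∈ J_{F,5}}`. -/
def colonFive (F Q : MvPolynomial (Fin 5) ℂ) : Set (MvPolynomial (Fin 5) ℂ) :=
  {b | b ∈ homogeneousSubmodule (Fin 5) ℂ 3 ∧ b * Q ∈ Jpart F 5}

/-- The desired properties of `Q` for a fixed `F ∈ 𝒰`: `(F,Q)` is a smooth complete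
intersection, `(J_{F,5}:Q)^⊥` is one-dimensional spanned by a smooth cubic, and
`(J_{F,3}:Q) = 0`. -/
def GoodQ (F Q : MvPolynomial (Fin 5) ℂ) : Prop :=
  SmoothCI F Q ∧
    (∃ G : MvPolynomial (Fin 5) ℂ, SmoothForm G ∧ G ≠ 0 ∧
      perp (colonFive F Q) = Set.range (fun c : ℂ => c • G)) ∧
    (∀ a ∈ homogeneousSubmodule (Fin 5) ℂ 1, a * Q ∈ Jpart F 3 → a = 0)

/-! ### Part 1: socles of complete intersections -/

attribute [local instance] MvPolynomial.gradedAlgebra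

/-- Every element is a nonzerodivisor modulo any subset of the others. -/
def StrongReg (h : Fin 5 → MvPolynomial (Fin 5) ℂ) : Prop :=
  ∀ T : Finset (Fin 5), ∀ i ∉ T, ∀ a, h i * a ∈ Ideal.span (h '' (T : Set (Fin 5))) →
    a ∈ Ideal.span (h '' (T : Set (Fin 5)))

/-- The socle modulo `I` is generated by one form of degree `d`. -/
def SocGen (I : Ideal (MvPolynomial (Fin 5) ℂ)) (d : ℕ) : Prop :=
  ∃ s : MvPolynomial (Fin 5) ℂ, s.IsHomogeneous d ∧ (∀ j, X j * s ∈ I) ∧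
    ∀ a, (∀ j, X j * a ∈ I) → ∃ k : ℂ, a - C k * s ∈ I

theorem strongReg_X : StrongReg (fun i => X i) := by
  intro T i hi a ha
  rw [mem_ideal_span_X_image] at ha ⊢
  intro m hm
  have := ha (Finsupp.single i 1 + m) (by
    rw [mem_support_iff] at hm ⊢
    rwa [coeff_X_mul])
  obtain ⟨j, hj, hjm⟩ := this
  refine ⟨j, hj, ?_⟩
  have hne : i ≠ j := by rintro rfl; exact hi hj
  simpa [Finsupp.single_apply, hne] using hjm

theorem socGen_X : SocGen (Ideal.span (Set.range fun i : Fin 5 => (X i : MvPolynomial (Fin 5) ℂ))) 0 := by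
  refine ⟨1, isHomogeneous_one _ _, fun j => ?_, fun a _ => ⟨coeff 0 a, ?_⟩⟩
  · exact Ideal.mul_mem_right _ _ (Ideal.subset_span ⟨j, rfl⟩)
  · have := (mem_pow_idealOfVars_iff' (σ := Fin 5) (R := ℂ) 1 (a - C (coeff 0 a) * 1)).2 ?_
    · simpa [idealOfVars] using this
    · intro x hx
      have : x = 0 := by
        rw [← Finsupp.degree_eq_zero_iff]; omega
      subst this
      simp

theorem image_update_of_notMem {h : Fin 5 → MvPolynomial (Fin 5) ℂ} {i₀ : Fin 5}
    {f : MvPolynomial (Fin 5) ℂ} {T : Finset (Fin 5)} (hT : i₀ ∉ T) :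
    Function.update h i₀ f '' (T : Set (Fin 5)) = h '' (T : Set (Fin 5)) := by
  apply Set.image_congr
  intro j hj
  rw [Function.update_of_ne]
  rintro rfl
  exact hT hj

theorem strongReg_exchange {h : Fin 5 → MvPolynomial (Fin 5) ℂ} (hh : StrongReg h) (i₀ : Fin 5)
    (f : MvPolynomial (Fin 5) ℂ)
    (hf : ∀ T : Finset (Fin 5), i₀ ∉ T → ∀ a, f * a ∈ Ideal.span (h '' (T : Set (Fin 5))) →
      a ∈ Ideal.span (h '' (T : Set (Fin 5)))) :
    StrongReg (Function.update h i₀ f) := by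
  intro T i hi a ha
  by_cases hT : i₀ ∈ T
  · obtain ⟨T', hT', rfl⟩ : ∃ T', i₀ ∉ T' ∧ T = insert i₀ T' :=
      ⟨T.erase i₀, by simp, by simp [Finset.insert_erase hT]⟩
    have hne : i ≠ i₀ := by rintro rfl; exact hi hT
    have hiT' : i ∉ T' := fun h => hi (by simp [h])
    rw [Finset.coe_insert, Set.image_insert_eq, image_update_of_notMem hT', Function.update_self]
      at ha ⊢
    rw [Function.update_of_ne hne] at ha
    obtain ⟨b, z, hz, e⟩ := Ideal.mem_span_insert.1 ha
    have h1 : b ∈ Ideal.span (h '' ((insert i T' : Finset (Fin 5)) : Set (Fin 5))) := by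
      apply hf
      · simp [hT', hne.symm]
      · rw [Finset.coe_insert, Set.image_insert_eq]
        refine Ideal.mem_span_insert.2 ⟨a, -z, neg_mem hz, ?_⟩
        linear_combination -e
    rw [Finset.coe_insert, Set.image_insert_eq] at h1
    obtain ⟨c, w, hw, e2⟩ := Ideal.mem_span_insert.1 h1
    have h2 : a - f * c ∈ Ideal.span (h '' (T' : Set (Fin 5))) := by
      apply hh T' i hiT'
      have : h i * (a - f * c) = w * f + z := by
        rw [mul_sub, e, e2]; ring
      rw [this]
      exact add_mem (Ideal.mul_mem_right _ _ hw) hz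
    exact Ideal.mem_span_insert.2 ⟨c, _, h2, by ring⟩
  · rw [image_update_of_notMem hT] at ha ⊢
    by_cases hi0 : i = i₀
    · subst hi0
      rw [Function.update_self] at ha
      exact hf T hT a ha
    · rw [Function.update_of_ne hi0] at ha
      exact hh T i hi a ha

theorem homogeneousComponent_mul_left {q b : MvPolynomial (Fin 5) ℂ} {d : ℕ}
    (hq : q.IsHomogeneous d) (e : ℕ) :
    homogeneousComponent (d + e) (q * b) = q * homogeneousComponent e b := by
  have := DirectSum.coe_decompose_mul_add_of_left_mem (homogeneousSubmodule (Fin 5) ℂ)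
    (i := d) (j := e) (a := q) (b := b) hq
  have h1 : ∀ (p : MvPolynomial (Fin 5) ℂ) (n : ℕ),
      ((DirectSum.decompose (homogeneousSubmodule (Fin 5) ℂ) p n : homogeneousSubmodule (Fin 5) ℂ n) :
        MvPolynomial (Fin 5) ℂ) = homogeneousComponent n p :=
    fun p n => MvPolynomial.decomposition.decompose'_apply p n
  rwa [h1, h1] at this

theorem mul_mem_of_pos {I : Ideal (MvPolynomial (Fin 5) ℂ)} {a q : MvPolynomial (Fin 5) ℂ}
    (ha : ∀ j, X j * a ∈ I) {d : ℕ} (hq : q.IsHomogeneous d) (hd : 1 ≤ d) : q * a ∈ I := by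
  have hq' : q ∈ idealOfVars (Fin 5) ℂ := by
    have := (mem_pow_idealOfVars_iff (σ := Fin 5) (R := ℂ) 1 q).2 ?_
    · simpa using this
    · intro x hx
      have := hq.degree_eq_sum_deg_support hx
      rw [Finsupp.degree_apply]
      omega
  refine Submodule.span_induction (p := fun q _ => q * a ∈ I) ?_ ?_ ?_ ?_ hq'
  · rintro _ ⟨j, rfl⟩; exact ha j
  · simp
  · intro x y _ _ hx hy; rw [add_mul]; exact add_mem hx hy
  · intro c x _ hx; rw [smul_eq_mul, mul_assoc]; exact Ideal.mul_mem_left _ _ hx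

theorem socGen_exchange {I : Set (MvPolynomial (Fin 5) ℂ)} {l f : MvPolynomial (Fin 5) ℂ} {d : ℕ}
    (hI : ∀ x ∈ I, SetLike.IsHomogeneousElem (homogeneousSubmodule (Fin 5) ℂ) x)
    (hl : l.IsHomogeneous 1) (hf : f.IsHomogeneous 2)
    (rl : ∀ a, l * a ∈ Ideal.span I → a ∈ Ideal.span I)
    (rf : ∀ a, f * a ∈ Ideal.span I → a ∈ Ideal.span I)
    (hs : SocGen (Ideal.span (insert l I)) d) : SocGen (Ideal.span (insert f I)) (d + 1) := by
  obtain ⟨s, hsd, hs1, hs2⟩ := hs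
  obtain ⟨s', hs'd, hs'⟩ : ∃ s' : MvPolynomial (Fin 5) ℂ, s'.IsHomogeneous (d + 1) ∧
      f * s - l * s' ∈ Ideal.span I := by
    obtain ⟨b, z, hz, e⟩ := Ideal.mem_span_insert.1 (mul_mem_of_pos hs1 hf (by norm_num))
    refine ⟨homogeneousComponent (d + 1) b, homogeneousComponent_isHomogeneous _ _, ?_⟩
    have h1 : homogeneousComponent (1 + (d + 1)) (f * s) = f * s :=
      homogeneousComponent_eq_self (by have := hf.mul hsd; convert this using 1; ring)
    have h2 : homogeneousComponent (1 + (d + 1)) (f * s) =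
        l * homogeneousComponent (d + 1) b + homogeneousComponent (1 + (d + 1)) z := by
      rw [e, map_add, mul_comm b l, homogeneousComponent_mul_left hl]
    have h3 : f * s - l * homogeneousComponent (d + 1) b = homogeneousComponent (1 + (d + 1)) z := by
      rw [← h1, h2]; ring
    rw [h3]
    exact homogeneousComponent_mem_of_mem (Ideal.homogeneous_span _ _ hI) hz _
  refine ⟨s', hs'd, ?_, ?_⟩
  · intro j
    obtain ⟨t, z, hz, e⟩ := Ideal.mem_span_insert.1 (hs1 j)
    have : X j * s' - t * f ∈ Ideal.span I := by
      apply rl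
      have : l * (X j * s' - t * f) = -(X j) * (f * s - l * s') + f * z := by
        linear_combination f * e
      rw [this]
      exact add_mem (Ideal.mul_mem_left _ _ hs') (Ideal.mul_mem_left _ _ hz)
    exact Ideal.mem_span_insert.2 ⟨t, _, this, by ring⟩
  · intro a ha
    obtain ⟨a', z, hz, e⟩ := Ideal.mem_span_insert.1 (mul_mem_of_pos ha hl le_rfl)
    have ha' : ∀ j, X j * a' ∈ Ideal.span (insert l I) := by
      intro j
      obtain ⟨m, w, hw, e2⟩ := Ideal.mem_span_insert.1 (ha j)
      have : X j * a' - m * l ∈ Ideal.span I := by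
        apply rf
        have : f * (X j * a' - m * l) = l * w - X j * z := by
          linear_combination l * e2 - X j * e
        rw [this]
        exact sub_mem (Ideal.mul_mem_left _ _ hw) (Ideal.mul_mem_left _ _ hz)
      exact Ideal.mem_span_insert.2 ⟨m, _, this, by ring⟩
    obtain ⟨k, hk⟩ := hs2 a' ha'
    obtain ⟨c, w, hw, e3⟩ := Ideal.mem_span_insert.1 hk
    refine ⟨k, ?_⟩
    have : a - C k * s' - c * f ∈ Ideal.span I := by
      apply rl
      have : l * (a - C k * s' - c * f) = z + f * w + C k * (f * s - l * s') := by
        linear_combination e + f * e3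
      rw [this]
      exact add_mem (add_mem hz (Ideal.mul_mem_left _ _ hw)) (Ideal.mul_mem_left _ _ hs')
    exact Ideal.mem_span_insert.2 ⟨c, _, this, by ring⟩

/-- Prime avoidance: a subspace contains a common nonzerodivisor. -/
theorem exists_common_nzd (V : Submodule ℂ (MvPolynomial (Fin 5) ℂ))
    (𝒯 : Finset (Ideal (MvPolynomial (Fin 5) ℂ)))
    (h𝒯 : ∀ I ∈ 𝒯, ∀ a, (∀ v ∈ V, v * a ∈ I) → a ∈ I) :
    ∃ f ∈ V, ∀ I ∈ 𝒯, ∀ a, f * a ∈ I → a ∈ I := by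
  classical
  let A : Ideal (MvPolynomial (Fin 5) ℂ) → Set (Ideal (MvPolynomial (Fin 5) ℂ)) := fun I =>
    associatedPrimes (MvPolynomial (Fin 5) ℂ) (MvPolynomial (Fin 5) ℂ ⧸ I)
  have hA : ∀ I, (A I).Finite := fun I => associatedPrimes.finite _ _
  let P : Finset (Ideal (MvPolynomial (Fin 5) ℂ)) := 𝒯.biUnion fun I => (hA I).toFinset
  let W : Ideal (MvPolynomial (Fin 5) ℂ) → Subspace ℂ V := fun p =>
    (p.restrictScalars ℂ).comap V.subtype
  have hW : ⊤ ∉ P.image W := by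
    intro hmem
    obtain ⟨p, hp, hpW⟩ := Finset.mem_image.1 hmem
    obtain ⟨I, hI, hpI⟩ := Finset.mem_biUnion.1 hp
    have hpI' : IsAssociatedPrime p (MvPolynomial (Fin 5) ℂ ⧸ I) := by
      rw [← AssociatedPrimes.mem_iff]
      simpa [A] using hpI
    obtain ⟨hpp, x, hx⟩ := isAssociatedPrime_iff.1 hpI'
    obtain ⟨a, rfl⟩ := Ideal.Quotient.mk_surjective x
    have ha : a ∈ I := by
      apply h𝒯 I hI
      intro v hv
      have : (⟨v, hv⟩ : V) ∈ W p := by rw [hpW]; trivial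
      have hvp : v ∈ p := this
      rw [hx, Submodule.mem_colon_singleton, Submodule.mem_bot] at hvp
      rw [← Ideal.Quotient.eq_zero_iff_mem, map_mul]
      exact hvp
    apply hpp.ne_top
    rw [hx, Ideal.Quotient.eq_zero_iff_mem.2 ha]
    ext r
    simp [Submodule.mem_colon_singleton]
  have := Subspace.biUnion_ne_univ_of_top_notMem hW
  obtain ⟨f, hf⟩ := (Set.ne_univ_iff_exists_notMem _).1 this
  refine ⟨f, f.2, fun I hI a ha => ?_⟩
  by_contra hna
  apply hf
  have h1 : (f : MvPolynomial (Fin 5) ℂ) ∈ ⋃ p ∈ A I, (p : Set (MvPolynomial (Fin 5) ℂ)) := by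
    rw [biUnion_associatedPrimes_eq_zero_divisors]
    refine ⟨Ideal.Quotient.mk I a, fun h => hna (Ideal.Quotient.eq_zero_iff_mem.1 h), ?_⟩
    exact (map_mul (Ideal.Quotient.mk I) (f : MvPolynomial (Fin 5) ℂ) a).symm.trans
      (Ideal.Quotient.eq_zero_iff_mem.2 ha)
  obtain ⟨p, hp, hfp⟩ := Set.mem_iUnion₂.1 h1
  refine Set.mem_iUnion₂.2 ⟨W p, ?_, hfp⟩
  exact Finset.mem_image_of_mem _ (Finset.mem_biUnion.2 ⟨I, hI, by simpa using hp⟩)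

theorem chain_step (f : Fin 5 → MvPolynomial (Fin 5) ℂ) (hf : ∀ i, (f i).IsHomogeneous 2)
    (N : ℕ) (hN : idealOfVars (Fin 5) ℂ ^ N ≤ Ideal.span (Set.range f)) (k : ℕ) (hk : k ≤ 5) :
    ∃ h : Fin 5 → MvPolynomial (Fin 5) ℂ, StrongReg h ∧
      (∀ i : Fin 5, (i : ℕ) < k → h i ∈ Submodule.span ℂ (Set.range f)) ∧
      (∀ i : Fin 5, k ≤ (i : ℕ) → h i = X i) ∧ SocGen (Ideal.span (Set.range h)) k := by
  classical
  have hV : ∀ v ∈ Submodule.span ℂ (Set.range f), v.IsHomogeneous 2 := by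
    intro v hv
    have : Submodule.span ℂ (Set.range f) ≤ homogeneousSubmodule (Fin 5) ℂ 2 := by
      rw [Submodule.span_le]
      rintro _ ⟨i, rfl⟩
      exact hf i
    exact this hv
  induction k with
  | zero => exact ⟨fun i => X i, strongReg_X, by simp, by simp, socGen_X⟩
  | succ k ih =>
    obtain ⟨h, hreg, h1, h2, h3⟩ := ih (by omega)
    let i₀ : Fin 5 := ⟨k, by omega⟩
    have hX : h i₀ = X i₀ := h2 _ le_rfl
    obtain ⟨g, hgV, hg⟩ := exists_common_nzd (Submodule.span ℂ (Set.range f))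
      ((Finset.univ.filter fun T : Finset (Fin 5) => i₀ ∉ T).image
        fun T : Finset (Fin 5) => Ideal.span (h '' (T : Set (Fin 5)))) (by
      intro I hI a ha
      obtain ⟨T, hT, rfl⟩ := Finset.mem_image.1 hI
      have hT' : i₀ ∉ T := (Finset.mem_filter.1 hT).2
      have key : ∀ q ∈ Ideal.span (Set.range f), q * a ∈ Ideal.span (h '' (T : Set (Fin 5))) := by
        intro q hq
        refine Submodule.span_induction (p := fun q _ => q * a ∈ Ideal.span (h '' (T : Set (Fin 5))))
          ?_ ?_ ?_ ?_ hq
        · intro x hx; exact ha x (Submodule.subset_span hx)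
        · simp
        · intro x y _ _ hx hy; rw [add_mul]; exact add_mem hx hy
        · intro c x _ hx; rw [smul_eq_mul, mul_assoc]; exact Ideal.mul_mem_left _ _ hx
      have hpow : ∀ n : ℕ, ∀ b, h i₀ ^ n * b ∈ Ideal.span (h '' (T : Set (Fin 5))) →
          b ∈ Ideal.span (h '' (T : Set (Fin 5))) := by
        intro n
        induction n with
        | zero => intro b hb; simpa using hb
        | succ n ihn =>
          intro b hb
          exact hreg T i₀ hT' b (ihn _ (by rwa [pow_succ, mul_assoc] at hb))
      apply hpow N
      apply key
      apply hN
      rw [hX]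
      exact Ideal.pow_mem_pow (show X i₀ ∈ idealOfVars (Fin 5) ℂ from
        Ideal.subset_span ⟨i₀, rfl⟩) _)
    have hg' : ∀ T : Finset (Fin 5), i₀ ∉ T → ∀ a, g * a ∈ Ideal.span (h '' (T : Set (Fin 5))) →
      a ∈ Ideal.span (h '' (T : Set (Fin 5))) := fun T hT =>
        hg _ (Finset.mem_image_of_mem _ (by simpa using hT))
    refine ⟨Function.update h i₀ g, strongReg_exchange hreg i₀ g hg', ?_, ?_, ?_⟩
    · intro i hi
      by_cases hi0 : i = i₀
      · subst hi0; simpa using hgV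
      · rw [Function.update_of_ne hi0]
        apply h1
        have : (i : ℕ) ≠ k := fun h => hi0 (Fin.ext h)
        omega
    · intro i hi
      have hi0 : i ≠ i₀ := by
        rintro rfl
        have : k + 1 ≤ k := hi
        omega
      rw [Function.update_of_ne hi0]
      exact h2 i (by omega)
    · let T : Finset (Fin 5) := Finset.univ.erase i₀
      have hT : i₀ ∉ T := by simp [T]
      have hcov : Set.range h = insert (h i₀) (h '' (T : Set (Fin 5))) := by
        rw [← Set.image_insert_eq, ← Finset.coe_insert, Finset.insert_erase (Finset.mem_univ _)]
        simp
      have hcov' : Set.range (Function.update h i₀ g) = insert g (h '' (T : Set (Fin 5))) := by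
        have : insert g (h '' (T : Set (Fin 5))) = insert (Function.update h i₀ g i₀)
          (Function.update h i₀ g '' (T : Set (Fin 5))) := by
            rw [image_update_of_notMem hT, Function.update_self]
        rw [this, ← Set.image_insert_eq, ← Finset.coe_insert,
          Finset.insert_erase (Finset.mem_univ _)]
        simp
      rw [hcov'] 
      rw [hcov] at h3
      refine socGen_exchange (l := h i₀) ?_ ?_ (hV g hgV) (hreg T i₀ hT) (hg' T hT) h3
      · rintro _ ⟨j, hj, rfl⟩
        by_cases hjk : (j : ℕ) < k
        · exact ⟨2, hV _ (h1 j hjk)⟩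
        · rw [h2 j (by omega)]
          exact ⟨1, isHomogeneous_X _ _⟩
      · rw [hX]; exact isHomogeneous_X _ _

theorem socGen_of_quadrics (f : Fin 5 → MvPolynomial (Fin 5) ℂ) (hf : ∀ i, (f i).IsHomogeneous 2)
    (N : ℕ) (hN : idealOfVars (Fin 5) ℂ ^ N ≤ Ideal.span (Set.range f)) :
    SocGen (Ideal.span (Set.range f)) 5 := by
  classical
  obtain ⟨h, hreg, h1, -, h3⟩ := chain_step f hf N hN 5 le_rfl
  have h1' : ∀ i, h i ∈ Submodule.span ℂ (Set.range f) := fun i => h1 i i.2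
  have hV : ∀ v ∈ Submodule.span ℂ (Set.range f), v.IsHomogeneous 2 := by
    intro v hv
    have : Submodule.span ℂ (Set.range f) ≤ homogeneousSubmodule (Fin 5) ℂ 2 := by
      rw [Submodule.span_le]
      rintro _ ⟨i, rfl⟩
      exact hf i
    exact this hv
  have hli : LinearIndependent ℂ h := by
    rw [Fintype.linearIndependent_iff]
    intro c hc i
    by_contra hci
    have hmem : h i * 1 ∈ Ideal.span (h '' ((Finset.univ.erase i : Finset (Fin 5)) : Set (Fin 5))) := by
      have e : h i * 1 = C (c i)⁻¹ * -(∑ j ∈ Finset.univ.erase i, c j • h j) := by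
        have e1 : c i • h i + ∑ j ∈ Finset.univ.erase i, c j • h j = 0 := by
          rw [Finset.add_sum_erase _ (fun j => c j • h j) (Finset.mem_univ i), hc]
        have e2 : -(∑ j ∈ Finset.univ.erase i, c j • h j) = C (c i) * h i := by
          rw [← smul_eq_C_mul]; linear_combination -e1
        rw [e2, ← mul_assoc, ← C_mul, inv_mul_cancel₀ hci]; simp
      rw [e]
      refine Ideal.mul_mem_left _ _ (neg_mem (sum_mem fun j hj => ?_))
      rw [smul_eq_C_mul]
      exact Ideal.mul_mem_left _ _ (Ideal.subset_span ⟨j, by simpa using hj, rfl⟩)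
    have h1mem := hreg _ i (by simp) 1 hmem
    have hle : Ideal.span (h '' ((Finset.univ.erase i : Finset (Fin 5)) : Set (Fin 5))) ≤
        RingHom.ker (constantCoeff (σ := Fin 5) (R := ℂ)) := by
      rw [Ideal.span_le]
      rintro _ ⟨j, -, rfl⟩
      have := (hV _ (h1' j)).coeff_eq_zero (d := 0) (by simp)
      simpa [RingHom.mem_ker, constantCoeff_eq] using this
    have := hle h1mem
    simp [RingHom.mem_ker] at this
  have hspan : Submodule.span ℂ (Set.range h) = Submodule.span ℂ (Set.range f) := by
    have : FiniteDimensional ℂ (Submodule.span ℂ (Set.range f)) :=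
      FiniteDimensional.span_of_finite ℂ (Set.finite_range f)
    apply Submodule.eq_of_le_of_finrank_le
    · rw [Submodule.span_le]; rintro _ ⟨i, rfl⟩; exact h1' i
    · rw [finrank_span_eq_card hli]
      exact finrank_range_le_card f
  have hI : Ideal.span (Set.range h) = Ideal.span (Set.range f) := by
    have aux : ∀ u v : Fin 5 → MvPolynomial (Fin 5) ℂ,
        (∀ i, u i ∈ Submodule.span ℂ (Set.range v)) →
        Ideal.span (Set.range u) ≤ Ideal.span (Set.range v) := by
      intro u v huv
      rw [Ideal.span_le]
      rintro _ ⟨i, rfl⟩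
      exact Submodule.span_le_restrictScalars ℂ (MvPolynomial (Fin 5) ℂ) _ (huv i)
    apply le_antisymm
    · exact aux h f h1'
    · refine aux f h fun i => ?_
      rw [hspan]; exact Submodule.subset_span ⟨i, rfl⟩
  rwa [hI] at h3
/-! ### Part 2: a Bertini theorem for quadrics -/

/-- The image of a hypersurface under a polynomial self-map of affine space is contained in a
hypersurface. -/
theorem exists_image_hypersurface {σ : Type} [Finite σ] (f : σ → MvPolynomial σ ℂ)
    (D : MvPolynomial σ ℂ) (hD : D ≠ 0) :
    ∃ H : MvPolynomial σ ℂ, H ≠ 0 ∧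
      ∀ x : σ → ℂ, eval x D = 0 → eval (fun s => eval x (f s)) H = 0 := by
  classical
  have hcard : ¬ AlgebraicIndependent ℂ (fun o : Option σ => o.elim D f) := by
    intro hai
    have h1 := hai.cardinalMk_le_trdeg
    rw [MvPolynomial.trdeg_of_isDomain] at h1
    have := Fintype.ofFinite σ
    simp only [Cardinal.mk_fintype, Fintype.card_option, Cardinal.lift_natCast] at h1
    have : Fintype.card σ + 1 ≤ Fintype.card σ := by exact_mod_cast h1
    omega
  rw [algebraicIndependent_iff] at hcard
  push Not at hcard
  obtain ⟨G, hG0, hGne⟩ := hcard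
  -- as a univariate polynomial over `MvPolynomial σ ℂ`
  let φ : Polynomial (MvPolynomial σ ℂ) →+* MvPolynomial σ ℂ :=
    Polynomial.eval₂RingHom (aeval f).toRingHom D
  have hφ : φ (optionEquivLeft ℂ σ G) = 0 := by
    rw [← hG0]
    have : (φ.comp (optionEquivLeft ℂ σ).toAlgHom.toRingHom) =
        (aeval fun o : Option σ => o.elim D f : MvPolynomial (Option σ) ℂ →ₐ[ℂ] _).toRingHom := by
      apply MvPolynomial.ringHom_ext
      · intro r
        simp [φ, optionEquivLeft_C]
      · intro o
        cases o <;> simp [φ, optionEquivLeft_X_none, optionEquivLeft_X_some]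
    exact congrArg (fun g => g G) this
  have key : ∀ n : ℕ, ∀ p : Polynomial (MvPolynomial σ ℂ), p.natDegree ≤ n → p ≠ 0 → φ p = 0 →
      ∃ H : MvPolynomial σ ℂ, H ≠ 0 ∧ D ∣ aeval f H := by
    intro n
    induction n with
    | zero =>
      intro p hp hp0 hφp
      rw [Polynomial.eq_C_of_natDegree_le_zero hp] at hφp hp0
      refine ⟨p.coeff 0, by simpa using hp0, ?_⟩
      have : aeval f (p.coeff 0) = 0 := by simpa [φ] using hφp
      rw [this]; exact dvd_zero _
    | succ n ih =>
      intro p hp hp0 hφp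
      have e : φ p = D * φ p.divX + aeval f (p.coeff 0) := by
        have e1 : φ (Polynomial.X * p.divX + Polynomial.C (p.coeff 0)) =
            D * φ p.divX + aeval f (p.coeff 0) := by
          rw [map_add, map_mul]
          congr 1
          · congr 1
            simp [φ]
          · simp [φ]
        rwa [Polynomial.X_mul_divX_add] at e1
      by_cases h0 : p.coeff 0 = 0
      · refine ih p.divX (by rw [Polynomial.natDegree_divX_eq_natDegree_tsub_one]; omega) ?_ ?_
        · intro hd
          apply hp0
          rw [← Polynomial.X_mul_divX_add p, hd, h0]; simp
        · rw [h0, map_zero, add_zero, hφp] at e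
          exact (mul_eq_zero.1 e.symm).resolve_left hD
      · refine ⟨p.coeff 0, h0, ⟨- φ p.divX, ?_⟩⟩
        rw [hφp] at e
        linear_combination -e
  obtain ⟨H, hH, q, hq⟩ := key _ (optionEquivLeft ℂ σ G) le_rfl (by simpa using hGne) hφ
  refine ⟨H, hH, fun x hx => ?_⟩
  have := congrArg (eval x) hq
  rw [map_mul, hx, zero_mul] at this
  rw [← this]
  have h2 : ((eval x).comp ((aeval f : MvPolynomial σ ℂ →ₐ[ℂ] _) : _ →+* _)) =
      eval (fun s => eval x (f s)) := by
    apply MvPolynomial.ringHom_ext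
    · intro r; simp
    · intro i; simp
  exact (congrArg (fun g => g H) h2).symm

/-- Entries of the Hessian of a quadratic form. -/
noncomputable def hessEntry (Q : MvPolynomial (Fin 5) ℂ) (s : Sym2 (Fin 5)) : ℂ :=
  Sym2.lift ⟨fun i j => (if i = j then 2 else 1) *
    coeff (Finsupp.single i 1 + Finsupp.single j 1) Q, fun i j => by
      show _ * coeff _ Q = _ * coeff _ Q
      rw [add_comm (Finsupp.single i 1)]; simp only [eq_comm]⟩ s

/-- The quadratic form with given Hessian. -/
noncomputable def quadOf (A : Sym2 (Fin 5) → ℂ) : MvPolynomial (Fin 5) ℂ :=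
  ∑ i, ∑ j, C (A s(i, j) / 2) * (X i * X j)

theorem quadOf_homog (A : Sym2 (Fin 5) → ℂ) : (quadOf A).IsHomogeneous 2 := by
  refine IsHomogeneous.sum _ _ _ fun i _ => IsHomogeneous.sum _ _ _ fun j _ => ?_
  exact ((isHomogeneous_X ℂ i).mul (isHomogeneous_X ℂ j)).C_mul _

theorem pderiv_pderiv_eq {Q : MvPolynomial (Fin 5) ℂ} (hQ : Q.IsHomogeneous 2) (i j : Fin 5) :
    pderiv j (pderiv i Q) = C (hessEntry Q s(i, j)) := by
  have h0 : (pderiv j (pderiv i Q)).IsHomogeneous 0 := hQ.pderiv.pderiv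
  rw [← totalDegree_zero_iff_isHomogeneous, totalDegree_eq_zero_iff_eq_C] at h0
  rw [h0]
  congr 1
  simp only [hessEntry, Sym2.lift_mk, coeff_pderiv, zero_add]
  rw [add_comm (Finsupp.single i 1)]
  by_cases h : i = j
  · subst h; simp; ring
  · simp [h]

theorem pderiv_eq_sum {Q : MvPolynomial (Fin 5) ℂ} (hQ : Q.IsHomogeneous 2) (i : Fin 5) :
    pderiv i Q = ∑ j, C (hessEntry Q s(i, j)) * X j := by
  have h1 : (pderiv i Q).IsHomogeneous 1 := hQ.pderiv
  have := h1.sum_X_mul_pderiv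
  rw [one_smul] at this
  rw [← this]
  refine Finset.sum_congr rfl fun j _ => ?_
  rw [pderiv_pderiv_eq hQ, mul_comm]

theorem quadOf_hessEntry {Q : MvPolynomial (Fin 5) ℂ} (hQ : Q.IsHomogeneous 2) :
    quadOf (hessEntry Q) = Q := by
  have h := hQ.sum_X_mul_pderiv
  have h2 : (C 2 : MvPolynomial (Fin 5) ℂ) * quadOf (hessEntry Q) = C 2 * Q := by
    have : (C 2 : MvPolynomial (Fin 5) ℂ) * Q = 2 • Q := by
      rw [two_smul, show (2 : ℂ) = 1 + 1 by norm_num, C_add, C_1]; ring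
    rw [this, ← h, quadOf, Finset.mul_sum]
    refine Finset.sum_congr rfl fun i _ => ?_
    rw [pderiv_eq_sum hQ, Finset.mul_sum, Finset.mul_sum]
    refine Finset.sum_congr rfl fun j _ => ?_
    have e : (C (hessEntry Q s(i, j)) : MvPolynomial (Fin 5) ℂ) =
        C 2 * C (hessEntry Q s(i, j) / 2) := by
      rw [← C_mul]; congr 1; ring
    rw [e]; ring
  exact mul_left_cancel₀ (by simp) h2

theorem hessEntry_quadOf (A : Sym2 (Fin 5) → ℂ) : hessEntry (quadOf A) = A := by
  classical
  funext s
  induction s using Sym2.ind with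
  | _ a b =>
    have h := pderiv_pderiv_eq (quadOf_homog A) a b
    apply C_injective (Fin 5) ℂ
    rw [← h, quadOf]
    have e : ∀ i j : Fin 5, pderiv b (pderiv a ((C (A s(i, j) / 2) : MvPolynomial (Fin 5) ℂ) *
        (X i * X j))) =
        (if i = a then (if j = b then C (A s(i, j) / 2) else 0) else 0) +
        (if j = a then (if i = b then C (A s(i, j) / 2) else 0) else 0) := by
      intro i j
      rw [pderiv_C_mul, pderiv_C_mul, pderiv_mul, pderiv_X, pderiv_X, map_add, pderiv_mul,
        pderiv_mul]
      simp only [Pi.single_apply]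
      split_ifs <;> simp_all [pderiv_X, Pi.single_apply]
      all_goals try ring
    simp only [map_sum, e]
    simp only [Finset.sum_add_distrib, Finset.sum_ite_eq', Finset.mem_univ, if_true,
      Finset.sum_ite_irrel, Finset.sum_const_zero]
    rw [Sym2.eq_swap (a := b) (b := a), ← C_add]
    congr 1; ring
theorem eval_smul_homog {P : MvPolynomial (Fin 5) ℂ} {n : ℕ} (hP : P.IsHomogeneous n) (t : ℂ)
    (p : Fin 5 → ℂ) : eval (fun i => t * p i) P = t ^ n * eval p P := by
  rw [eval_eq, eval_eq, Finset.mul_sum]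
  refine Finset.sum_congr rfl fun d hd => ?_
  have h := hP.degree_eq_sum_deg_support hd
  simp only [mul_pow, Finset.prod_mul_distrib]
  rw [Finset.prod_pow_eq_pow_sum]
  have : ∑ i ∈ d.support, d i = n := by rw [← h]
  rw [this]; ring

/-- Quadrics with Hessian `A` tangent to `F` at a point in the chart `p c = 1` lie on a
hypersurface. -/
theorem bertini_chart {F : MvPolynomial (Fin 5) ℂ} (hF : F.IsHomogeneous 3) (hF0 : F ≠ 0)
    (c : Fin 5) :
    ∃ H : MvPolynomial (Sym2 (Fin 5)) ℂ, H ≠ 0 ∧ ∀ (A : Sym2 (Fin 5) → ℂ) (p : Fin 5 → ℂ) (l : ℂ),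
      p c = 1 → eval p F = 0 → (∀ i, ∑ j, A s(i, j) * p j = l * eval p (pderiv i F)) →
      eval A H = 0 := by
  classical
  let pp : Fin 5 → MvPolynomial (Sym2 (Fin 5)) ℂ := fun j => if j = c then 1 else X s(j, c)
  let hh : Fin 5 → MvPolynomial (Sym2 (Fin 5)) ℂ := fun i =>
    X s(c, c) * aeval pp (pderiv i F) - ∑ j ∈ Finset.univ.erase c, X s(i, j) * pp j
  let hc : MvPolynomial (Sym2 (Fin 5)) ℂ :=
    X s(c, c) * aeval pp (pderiv c F) - ∑ j ∈ Finset.univ.erase c, hh j * pp j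
  let f : Sym2 (Fin 5) → MvPolynomial (Sym2 (Fin 5)) ℂ := Sym2.lift
    ⟨fun i j => if i = c then (if j = c then hc else hh j) else (if j = c then hh i else X s(i, j)),
      fun i j => by
        by_cases hi : i = c <;> by_cases hj : j = c <;> simp [hi, hj, Sym2.eq_swap]⟩
  let pt : (Sym2 (Fin 5) → ℂ) → (Fin 5 → ℂ) → ℂ → Sym2 (Fin 5) → ℂ := fun A p l => Sym2.lift
    ⟨fun i j => if i = c then (if j = c then l else p j) else (if j = c then p i else A s(i, j)),
      fun i j => by
        by_cases hi : i = c <;> by_cases hj : j = c <;> simp [hi, hj, Sym2.eq_swap]⟩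
  have hpp : ∀ A p l, p c = 1 → ∀ j, eval (pt A p l) (pp j) = p j := by
    intro A p l hp j
    by_cases hj : j = c
    · simp [pp, hj, hp]
    · simp [pp, hj, pt]
  have hev : ∀ A p l, p c = 1 → ∀ q : MvPolynomial (Fin 5) ℂ,
      eval (pt A p l) (aeval pp q) = eval p q := by
    intro A p l hp q
    have h2 : ((eval (pt A p l)).comp (aeval pp : MvPolynomial (Fin 5) ℂ →ₐ[ℂ] _).toRingHom) =
        eval p := by
      apply MvPolynomial.ringHom_ext
      · intro r; simp
      · intro i; simpa using hpp A p l hp i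
    exact congrArg (fun g => g q) h2
  have hD : aeval pp F ≠ 0 := by
    intro h0
    have hne : F * X c ≠ 0 := mul_ne_zero hF0 (X_ne_zero c)
    obtain ⟨q, hq⟩ : ∃ q : Fin 5 → ℂ, eval q (F * X c) ≠ 0 := by
      by_contra hcon
      push Not at hcon
      exact hne (MvPolynomial.funext fun x => by rw [hcon x, map_zero])
    rw [map_mul, eval_X] at hq
    have hqc : q c ≠ 0 := right_ne_zero_of_mul hq
    have h1 := hev 0 (fun i => (q c)⁻¹ * q i) 0 (inv_mul_cancel₀ hqc) F
    rw [h0, map_zero, eval_smul_homog hF] at h1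
    exact mul_ne_zero (pow_ne_zero _ (inv_ne_zero hqc)) (left_ne_zero_of_mul hq) h1.symm
  obtain ⟨H, hH, hH'⟩ := exists_image_hypersurface f _ hD
  refine ⟨H, hH, fun A p l hp hFp hA => ?_⟩
  have := hH' (pt A p l) (by rw [hev A p l hp]; exact hFp)
  have hfA : (fun s => eval (pt A p l) (f s)) = A := by
    have hsum : ∀ i, A s(i, c) = l * eval p (pderiv i F) -
        ∑ j ∈ Finset.univ.erase c, A s(i, j) * p j := by
      intro i
      rw [← hA i, ← Finset.add_sum_erase _ _ (Finset.mem_univ c), hp]; ring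
    have hl : pt A p l s(c, c) = l := by simp [pt]
    have hhA : ∀ i, i ≠ c → eval (pt A p l) (hh i) = A s(i, c) := by
      intro i hi
      rw [hsum i]
      simp only [hh, map_sub, map_mul, map_sum, eval_X, hev A p l hp, hpp A p l hp, hl]
      congr 1
      refine Finset.sum_congr rfl fun j hj => ?_
      have hj : j ≠ c := Finset.ne_of_mem_erase hj
      simp [pt, hi, hj]
    have hcA : eval (pt A p l) hc = A s(c, c) := by
      rw [hsum c]
      simp only [hc, map_sub, map_mul, map_sum, eval_X, hev A p l hp, hpp A p l hp, hl]
      congr 1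
      refine Finset.sum_congr rfl fun j hj => ?_
      rw [hhA j (Finset.ne_of_mem_erase hj), Sym2.eq_swap]
    funext s
    induction s using Sym2.ind with
    | _ i j =>
      by_cases hi : i = c
      · subst hi
        by_cases hj : j = i
        · subst hj; simp [f, hcA]
        · simp [f, hj, hhA j hj, Sym2.eq_swap]
      · by_cases hj : j = c
        · subst hj; simp [f, hi, hhA i hi]
        · simp [f, hi, hj, pt]
  rwa [hfA] at this

theorem bertini {F : MvPolynomial (Fin 5) ℂ} (hF : F.IsHomogeneous 3) (hF0 : F ≠ 0)
    (hsm : SmoothForm F) :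
    ∃ H : MvPolynomial (Sym2 (Fin 5)) ℂ, H ≠ 0 ∧ ∀ Q : MvPolynomial (Fin 5) ℂ,
      Q.IsHomogeneous 2 → eval (hessEntry Q) H ≠ 0 → SmoothCI F Q := by
  choose H hH hH' using bertini_chart hF hF0
  refine ⟨∏ c, H c, Finset.prod_ne_zero_iff.2 fun c _ => hH c, fun Q hQ hev p hp hFp hQp => ?_⟩
  rw [LinearIndependent.pair_iff]
  intro s t hst
  have hst' : ∀ i, s * eval p (pderiv i F) + t * eval p (pderiv i Q) = 0 := fun i => by
    simpa using congrFun hst i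
  have ht : t = 0 := by
    by_contra ht
    apply hev
    obtain ⟨c, hc⟩ : ∃ c, p c ≠ 0 := by
      by_contra hcon; push Not at hcon; exact hp (funext hcon)
    rw [map_prod]
    apply Finset.prod_eq_zero (Finset.mem_univ c)
    refine hH' c (hessEntry Q) (fun i => (p c)⁻¹ * p i) (-(s / t) * p c) (inv_mul_cancel₀ hc) ?_ ?_
    · rw [eval_smul_homog hF, hFp, mul_zero]
    · intro i
      have h1 : ∑ j, hessEntry Q s(i, j) * ((p c)⁻¹ * p j) = (p c)⁻¹ * eval p (pderiv i Q) := by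
        rw [pderiv_eq_sum hQ, map_sum, Finset.mul_sum]
        refine Finset.sum_congr rfl fun j _ => ?_
        simp; ring
      rw [h1, eval_smul_homog hF.pderiv]
      have := hst' i
      have h3 : eval p (pderiv i Q) = -(s / t) * eval p (pderiv i F) := by
        field_simp; linear_combination this
      rw [h3, show 3 - 1 = 2 from rfl]
      field_simp
  subst ht
  refine ⟨?_, rfl⟩
  by_contra hs
  apply hp
  apply hsm
  intro i
  have := hst' i
  simpa [hs] using this

theorem smooth_pow_le {G : MvPolynomial (Fin 5) ℂ} (hG : SmoothForm G) :
    ∃ N, idealOfVars (Fin 5) ℂ ^ N ≤ jacobianIdeal G := by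
  apply Ideal.exists_pow_le_of_le_radical_of_fg _ (idealOfVars_fg _ _)
  rw [← vanishingIdeal_zeroLocus_eq_radical (K := ℂ), jacobianIdeal, zeroLocus_span]
  rw [idealOfVars, Ideal.span_le]
  rintro _ ⟨j, rfl⟩
  rw [SetLike.mem_coe, mem_vanishingIdeal_iff]
  intro x hx
  have : x = 0 := by
    apply hG
    intro i
    have := hx _ ⟨i, rfl⟩
    simpa [aeval_eq_eval] using this
  simp [this]

theorem jac_homog {F : MvPolynomial (Fin 5) ℂ} (hF : F.IsHomogeneous 3) :
    (jacobianIdeal F).IsHomogeneous (homogeneousSubmodule (Fin 5) ℂ) := by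
  apply Ideal.homogeneous_span
  rintro _ ⟨i, rfl⟩
  exact ⟨2, hF.pderiv⟩

theorem homog_mem_pow {w : MvPolynomial (Fin 5) ℂ} {k : ℕ} (hw : w.IsHomogeneous k) :
    w ∈ idealOfVars (Fin 5) ℂ ^ k := by
  rw [mem_pow_idealOfVars_iff]
  intro x hx
  rw [mem_support_iff] at hx
  by_contra hcon
  exact hx (hw.coeff_eq_zero (by omega))

theorem soc_ne {F s : MvPolynomial (Fin 5) ℂ} (hF : F.IsHomogeneous 3)
    (hs : s.IsHomogeneous 5)
    (h : ∀ a, (∀ j, X j * a ∈ jacobianIdeal F) → ∃ k : ℂ, a - C k * s ∈ jacobianIdeal F)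
    {a : MvPolynomial (Fin 5) ℂ} {k : ℕ} (ha : a.IsHomogeneous k) (hk : k ≠ 5)
    (haj : ∀ j, X j * a ∈ jacobianIdeal F) : a ∈ jacobianIdeal F := by
  obtain ⟨c, hc⟩ := h a haj
  have := homogeneousComponent_mem_of_mem (jac_homog hF) hc k
  rw [map_sub, homogeneousComponent_of_mem (n := k) ha,
    homogeneousComponent_of_mem (m := k) (hs.C_mul c)] at this
  simpa [hk] using this

theorem exists_functional {F : MvPolynomial (Fin 5) ℂ} (hF : F.IsHomogeneous 3)
    (hsm : SmoothForm F) :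
    ∃ l : MvPolynomial (Fin 5) ℂ →ₗ[ℂ] ℂ,
      (∀ w : MvPolynomial (Fin 5) ℂ, w.IsHomogeneous 5 → (w ∈ jacobianIdeal F ↔ l w = 0)) ∧
      (∀ b : MvPolynomial (Fin 5) ℂ, b.IsHomogeneous 3 →
        (∀ Q : MvPolynomial (Fin 5) ℂ, Q.IsHomogeneous 2 → l (Q * b) = 0) →
        b ∈ jacobianIdeal F) := by
  obtain ⟨N, hN⟩ := smooth_pow_le hsm
  obtain ⟨s, hs, hs1, hs2⟩ := socGen_of_quadrics (fun i => pderiv i F) (fun i => hF.pderiv) N hN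
  change ∀ j, X j * s ∈ jacobianIdeal F at hs1
  change ∀ a, (∀ j, X j * a ∈ jacobianIdeal F) → ∃ k : ℂ, a - C k * s ∈ jacobianIdeal F at hs2
  have key := fun {a : MvPolynomial (Fin 5) ℂ} {k : ℕ} => soc_ne (a := a) (k := k) hF hs hs2
  have h6 : ∀ n : ℕ, ∀ w : MvPolynomial (Fin 5) ℂ, ∀ k, N ≤ k + n → 6 ≤ k → w.IsHomogeneous k →
      w ∈ jacobianIdeal F := by
    intro n
    induction n with
    | zero =>
      intro w k hk _ hw
      exact hN (Ideal.pow_le_pow_right hk (homog_mem_pow hw))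
    | succ n ih =>
      intro w k hk hk6 hw
      refine key hw (by omega) fun j => ih _ (1 + k) (by omega) (by omega)
        ((isHomogeneous_X ℂ j).mul hw)
  have h5 : ∀ w : MvPolynomial (Fin 5) ℂ, w.IsHomogeneous 5 → ∃ k : ℂ,
      w - C k * s ∈ jacobianIdeal F := fun w hw =>
    hs2 w fun j => h6 N _ 6 (by omega) le_rfl ((isHomogeneous_X ℂ j).mul hw)
  have hl : ∃ l : MvPolynomial (Fin 5) ℂ →ₗ[ℂ] ℂ,
      (∀ w : MvPolynomial (Fin 5) ℂ, w.IsHomogeneous 5 → (w ∈ jacobianIdeal F ↔ l w = 0)) := by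
    by_cases hsJ : s ∈ jacobianIdeal F
    · refine ⟨0, fun w hw => ⟨fun _ => rfl, fun _ => ?_⟩⟩
      obtain ⟨k, hk⟩ := h5 w hw
      have := (jacobianIdeal F).add_mem hk ((jacobianIdeal F).mul_mem_left (C k) hsJ)
      simpa using this
    · obtain ⟨l, hl1, hl2⟩ := Submodule.exists_le_ker_of_notMem
        (p := (jacobianIdeal F).restrictScalars ℂ) (v := s) hsJ
      refine ⟨l, fun w hw => ⟨fun h => hl2 h, fun h => ?_⟩⟩
      obtain ⟨k, hk⟩ := h5 w hw
      have h1 : l (w - C k * s) = 0 := hl2 hk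
      rw [map_sub, h, C_mul', map_smul, smul_eq_mul, zero_sub, neg_eq_zero, mul_eq_zero] at h1
      have : k = 0 := h1.resolve_right hl1
      simpa [this] using hk
  obtain ⟨l, hl⟩ := hl
  refine ⟨l, hl, fun b hb h => ?_⟩
  refine key hb (by norm_num) fun i => key ((isHomogeneous_X ℂ i).mul hb) (by norm_num) fun j => ?_
  have h2 : (X j * X i : MvPolynomial (Fin 5) ℂ).IsHomogeneous 2 :=
    (isHomogeneous_X ℂ j).mul (isHomogeneous_X ℂ i)
  rw [← mul_assoc, hl _ (h2.mul hb)]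
  exact h _ h2

/-- Exponents of degree `k`. -/
def expo (k : ℕ) : Finset (Fin 5 →₀ ℕ) := Finset.univ.finsuppAntidiag k

theorem mem_expo {k : ℕ} {m : Fin 5 →₀ ℕ} : m ∈ expo k ↔ m.degree = k := by
  simp [expo, Finset.mem_finsuppAntidiag, Finsupp.degree_eq_sum]

/-- Product of factorials of the exponents. -/
def fac (m : Fin 5 →₀ ℕ) : ℂ := ∏ i, ((m i).factorial : ℂ)

theorem fac_ne (m : Fin 5 →₀ ℕ) : fac m ≠ 0 :=
  Finset.prod_ne_zero_iff.2 fun i _ => by exact_mod_cast (m i).factorial_ne_zero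

theorem fac_add (m : Fin 5 →₀ ℕ) (i : Fin 5) :
    fac (m + Finsupp.single i 1) = fac m * ((m i : ℂ) + 1) := by
  unfold fac
  rw [← Finset.mul_prod_erase _ _ (Finset.mem_univ i),
    ← Finset.mul_prod_erase _ (fun i => ((m i).factorial : ℂ)) (Finset.mem_univ i)]
  have : ∏ x ∈ Finset.univ.erase i, (((m + Finsupp.single i 1 : Fin 5 →₀ ℕ) x).factorial : ℂ) =
      ∏ x ∈ Finset.univ.erase i, ((m x).factorial : ℂ) := by
    refine Finset.prod_congr rfl fun j hj => ?_
    simp [Finsupp.single_apply, (Finset.ne_of_mem_erase hj).symm]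
  rw [this]
  simp [Nat.factorial_succ]
  ring

theorem coeff_pderiv_pow (i : Fin 5) (n : ℕ) (P : MvPolynomial (Fin 5) ℂ) (m : Fin 5 →₀ ℕ)
    (hm : m i = 0) :
    coeff m ((((pderiv i).toLinearMap : Module.End ℂ (MvPolynomial (Fin 5) ℂ)) ^ n) P) =
      (n.factorial : ℂ) * coeff (m + Finsupp.single i n) P := by
  induction n generalizing P with
  | zero => simp
  | succ n ih =>
    rw [pow_succ, Module.End.mul_apply, ih]
    rw [show ((pderiv i).toLinearMap : Module.End ℂ (MvPolynomial (Fin 5) ℂ)) P = pderiv i P from rfl,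
      coeff_pderiv, add_assoc, ← Finsupp.single_add, Nat.factorial_succ]
    simp [hm]
    ring

theorem polar_monomial (P : MvPolynomial (Fin 5) ℂ) (m : Fin 5 →₀ ℕ) :
    constantCoeff ((List.ofFn fun i : Fin 5 =>
      ((pderiv i).toLinearMap : Module.End ℂ (MvPolynomial (Fin 5) ℂ)) ^ (m i)).prod P) =
    fac m * coeff m P := by
  simp only [List.ofFn_succ, List.ofFn_zero, List.prod_cons, List.prod_nil, mul_one,
    Module.End.mul_apply]
  rw [constantCoeff_eq, coeff_pderiv_pow _ _ _ _ (by simp), coeff_pderiv_pow _ _ _ _ (by simp),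
    coeff_pderiv_pow _ _ _ _ (by simp), coeff_pderiv_pow _ _ _ _ (by simp),
    coeff_pderiv_pow _ _ _ _ (by simp)]
  have hm : m = 0 + Finsupp.single 0 (m 0) + Finsupp.single (Fin.succ 0) (m (Fin.succ 0)) +
      Finsupp.single (Fin.succ (Fin.succ 0)) (m (Fin.succ (Fin.succ 0))) +
      Finsupp.single (Fin.succ (Fin.succ (Fin.succ 0))) (m (Fin.succ (Fin.succ (Fin.succ 0)))) +
      Finsupp.single (Fin.succ (Fin.succ (Fin.succ (Fin.succ 0))))
        (m (Fin.succ (Fin.succ (Fin.succ (Fin.succ 0))))) := by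
    ext i
    fin_cases i <;> simp [Finsupp.single_apply]
  rw [← hm, fac]
  simp only [Fin.prod_univ_succ, Finset.univ_unique, Finset.prod_singleton, Finset.univ_eq_empty,
    Finset.prod_empty]
  simp
  ring

/-- The explicit form of the polar pairing on cubics. -/
def pp (P G : MvPolynomial (Fin 5) ℂ) : ℂ :=
  ∑ m ∈ expo 3, coeff m G * (fac m * coeff m P)

theorem polarPair_eq {P G : MvPolynomial (Fin 5) ℂ} (hG : G.IsHomogeneous 3) :
    polarPair P G = pp P G := by
  rw [polarPair, map_sum]
  have : ∀ m, constantCoeff (G.coeff m •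
    ((List.ofFn fun i : Fin 5 =>
      ((pderiv i).toLinearMap : Module.End ℂ (MvPolynomial (Fin 5) ℂ)) ^ (m i)).prod P)) =
      coeff m G * (fac m * coeff m P) := by
    intro m
    rw [← polar_monomial, constantCoeff_smul, smul_eq_mul]
  simp only [this, pp]
  refine Finset.sum_subset ?_ ?_
  · intro m hm
    rw [mem_expo]
    rw [mem_support_iff] at hm
    by_contra h
    exact hm (hG.coeff_eq_zero h)
  · intro m _ hm
    simp [notMem_support_iff.1 hm]

theorem pp_monomial (G : MvPolynomial (Fin 5) ℂ) {m : Fin 5 →₀ ℕ} (hm : m.degree = 3) (c : ℂ) :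
    pp (monomial m c) G = coeff m G * (fac m * c) := by
  rw [pp, Finset.sum_eq_single m]
  · rw [coeff_monomial, if_pos rfl]
  · intro n _ hn
    rw [coeff_monomial, if_neg hn.symm]; simp
  · intro h; exact absurd (mem_expo.2 hm) h

theorem pp_sub (P P' G : MvPolynomial (Fin 5) ℂ) : pp (P - P') G = pp P G - pp P' G := by
  simp only [pp, coeff_sub, ← Finset.sum_sub_distrib]
  exact Finset.sum_congr rfl fun _ _ => by ring

theorem homog_expand {b : MvPolynomial (Fin 5) ℂ} {k : ℕ} (hb : b.IsHomogeneous k) :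
    b = ∑ m ∈ expo k, monomial m (coeff m b) := by
  conv_lhs => rw [b.as_sum]
  refine Finset.sum_subset ?_ ?_
  · intro m hm
    rw [mem_expo]
    rw [mem_support_iff] at hm
    by_contra h
    exact hm (hb.coeff_eq_zero h)
  · intro m _ hm
    simp [notMem_support_iff.1 hm]

theorem ext_homog {a b : MvPolynomial (Fin 5) ℂ} {k : ℕ} (ha : a.IsHomogeneous k)
    (hb : b.IsHomogeneous k) (h : ∀ m, m.degree = k → coeff m a = coeff m b) : a = b := by
  ext m
  by_cases hm : m.degree = k
  · exact h m hm
  · rw [ha.coeff_eq_zero hm, hb.coeff_eq_zero hm]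

/-- The cubic representing the functional `b ↦ l (Q b)` under the polar pairing. -/
noncomputable def dualCubic (l : MvPolynomial (Fin 5) ℂ →ₗ[ℂ] ℂ) :
    MvPolynomial (Fin 5) ℂ →ₗ[ℂ] MvPolynomial (Fin 5) ℂ :=
  ∑ m ∈ expo 3, (monomial m).comp
    ((fac m)⁻¹ • (l.comp (LinearMap.mulRight ℂ (monomial m (1 : ℂ)))))

theorem dualCubic_apply (l : MvPolynomial (Fin 5) ℂ →ₗ[ℂ] ℂ) (Q : MvPolynomial (Fin 5) ℂ) :
    dualCubic l Q = ∑ m ∈ expo 3, monomial m ((fac m)⁻¹ * l (Q * monomial m 1)) := by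
  simp [dualCubic]

theorem dualCubic_homog (l : MvPolynomial (Fin 5) ℂ →ₗ[ℂ] ℂ) (Q : MvPolynomial (Fin 5) ℂ) :
    (dualCubic l Q).IsHomogeneous 3 := by
  rw [dualCubic_apply]
  exact IsHomogeneous.sum _ _ _ fun m hm => isHomogeneous_monomial _ (mem_expo.1 hm)

theorem coeff_dualCubic (l : MvPolynomial (Fin 5) ℂ →ₗ[ℂ] ℂ) (Q : MvPolynomial (Fin 5) ℂ)
    {m : Fin 5 →₀ ℕ} (hm : m.degree = 3) :
    coeff m (dualCubic l Q) = (fac m)⁻¹ * l (Q * monomial m 1) := by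
  rw [dualCubic_apply, coeff_sum, Finset.sum_eq_single m]
  · rw [coeff_monomial, if_pos rfl]
  · intro n _ hn
    rw [coeff_monomial, if_neg hn]
  · intro h; exact absurd (mem_expo.2 hm) h

theorem pp_dualCubic (l : MvPolynomial (Fin 5) ℂ →ₗ[ℂ] ℂ) (Q : MvPolynomial (Fin 5) ℂ)
    {b : MvPolynomial (Fin 5) ℂ} (hb : b.IsHomogeneous 3) :
    pp b (dualCubic l Q) = l (Q * b) := by
  conv_rhs => rw [homog_expand hb, Finset.mul_sum, map_sum]
  refine Finset.sum_congr rfl fun m hm => ?_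
  rw [coeff_dualCubic l Q (mem_expo.1 hm)]
  have : (monomial m (coeff m b) : MvPolynomial (Fin 5) ℂ) = (coeff m b) • monomial m 1 := by
    rw [smul_monomial, smul_eq_mul, mul_one]
  rw [this, mul_smul_comm, map_smul, smul_eq_mul]
  field_simp [fac_ne m]

/-- `quadOf` as a linear map. -/
noncomputable def quadL : (Sym2 (Fin 5) → ℂ) →ₗ[ℂ] MvPolynomial (Fin 5) ℂ where
  toFun := quadOf
  map_add' A B := by
    simp only [quadOf, ← Finset.sum_add_distrib]
    refine Finset.sum_congr rfl fun i _ => Finset.sum_congr rfl fun j _ => ?_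
    rw [Pi.add_apply, add_div, C_add, add_mul]
  map_smul' c A := by
    simp only [quadOf, Finset.smul_sum, RingHom.id_apply]
    refine Finset.sum_congr rfl fun i _ => Finset.sum_congr rfl fun j _ => ?_
    rw [Pi.smul_apply, smul_eq_mul, mul_div_assoc, C_mul, mul_assoc, C_mul']

theorem quadL_apply (A : Sym2 (Fin 5) → ℂ) : quadL A = quadOf A := rfl

theorem linear_poly (l : (Sym2 (Fin 5) → ℂ) →ₗ[ℂ] ℂ) :
    ∃ p : MvPolynomial (Sym2 (Fin 5)) ℂ, ∀ A, eval A p = l A := by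
  classical
  refine ⟨∑ s, C (l (Pi.single s 1)) * X s, fun A => ?_⟩
  conv_rhs => rw [← LinearMap.sum_single_apply (fun _ => ℂ) A, map_sum]
  rw [map_sum]
  refine Finset.sum_congr rfl fun s _ => ?_
  have : (Pi.single s (A s) : Sym2 (Fin 5) → ℂ) = A s • Pi.single s (1 : ℂ) := by
    rw [← Pi.single_smul, smul_eq_mul, mul_one]
  rw [this, map_smul]
  simp [mul_comm]

/-- Every cubic orthogonal to `J_{F,3}` is a `dualCubic`. -/
theorem exists_dualCubic {F : MvPolynomial (Fin 5) ℂ} (l : MvPolynomial (Fin 5) ℂ →ₗ[ℂ] ℂ)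
    (hl : ∀ b : MvPolynomial (Fin 5) ℂ, b.IsHomogeneous 3 →
        (∀ Q : MvPolynomial (Fin 5) ℂ, Q.IsHomogeneous 2 → l (Q * b) = 0) →
        b ∈ jacobianIdeal F)
    {G : MvPolynomial (Fin 5) ℂ} (hG : G.IsHomogeneous 3)
    (hGF : ∀ b : MvPolynomial (Fin 5) ℂ, b.IsHomogeneous 3 → b ∈ jacobianIdeal F → pp b G = 0) :
    ∃ A, dualCubic l (quadL A) = G := by
  let φ : (Sym2 (Fin 5) → ℂ) →ₗ[ℂ] Module.Dual ℂ (MvPolynomial (Fin 5) ℂ) :=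
    ((LinearMap.mul ℂ (MvPolynomial (Fin 5) ℂ)).compr₂ l).compl₁₂ quadL (homogeneousComponent 3)
  have hφ : ∀ A b, φ A b = l (quadL A * homogeneousComponent 3 b) := fun A b => rfl
  let μ : Module.Dual ℂ (MvPolynomial (Fin 5) ℂ) :=
    ∑ m ∈ expo 3, (coeff m G * fac m) • (lcoeff ℂ m)
  have hμ : ∀ b, μ b = pp b G := by
    intro b
    simp only [μ, pp, LinearMap.sum_apply, LinearMap.smul_apply, smul_eq_mul, lcoeff_apply]
    exact Finset.sum_congr rfl fun _ _ => by ring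
  have hW := Subspace.dualCoannihilator_dualAnnihilator_eq (W := LinearMap.range φ)
  have hmem : μ ∈ LinearMap.range φ := by
    rw [← hW, Submodule.mem_dualAnnihilator]
    intro b hb
    rw [Submodule.mem_dualCoannihilator] at hb
    have h3 : (homogeneousComponent 3 b).IsHomogeneous 3 := homogeneousComponent_isHomogeneous 3 b
    have : homogeneousComponent 3 b ∈ jacobianIdeal F := by
      refine hl _ h3 fun Q hQ => ?_
      have := hb (φ (hessEntry Q)) ⟨_, rfl⟩
      rwa [hφ, quadL_apply, quadOf_hessEntry hQ] at this
    rw [hμ, ← hGF _ h3 this]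
    refine Finset.sum_congr rfl fun m hm => ?_
    rw [coeff_homogeneousComponent, if_pos (mem_expo.1 hm)]
  obtain ⟨A, hA⟩ := hmem
  refine ⟨A, ext_homog (dualCubic_homog _ _) hG fun m hm => ?_⟩
  have h := LinearMap.congr_fun hA (monomial m 1)
  rw [hμ, hφ, pp_monomial G hm, homogeneousComponent_of_mem (n := 3)
    (isHomogeneous_monomial (1 : ℂ) hm), if_pos rfl] at h
  rw [coeff_dualCubic _ _ hm, h, mul_one]
  field_simp [fac_ne m]

theorem good_ii {F Q : MvPolynomial (Fin 5) ℂ} {l : MvPolynomial (Fin 5) ℂ →ₗ[ℂ] ℂ}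
    (hl : ∀ w : MvPolynomial (Fin 5) ℂ, w.IsHomogeneous 5 → (w ∈ jacobianIdeal F ↔ l w = 0))
    (hQ : Q.IsHomogeneous 2) (hne : dualCubic l Q ≠ 0) :
    perp (colonFive F Q) = Set.range (fun c : ℂ => c • dualCubic l Q) := by
  have hcol : ∀ b : MvPolynomial (Fin 5) ℂ, b ∈ colonFive F Q ↔
      b.IsHomogeneous 3 ∧ pp b (dualCubic l Q) = 0 := by
    intro b
    constructor
    · rintro ⟨hb, hJ, h5⟩
      refine ⟨hb, ?_⟩
      rw [pp_dualCubic l Q hb, mul_comm]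
      exact (hl _ h5).1 hJ
    · rintro ⟨hb, h⟩
      have h5 : (b * Q).IsHomogeneous 5 := IsHomogeneous.mul hb hQ
      rw [pp_dualCubic l Q hb, mul_comm] at h
      exact ⟨hb, (hl _ h5).2 h, h5⟩
  have hG3 := dualCubic_homog l Q
  set Γ := dualCubic l Q with hΓ
  have hsmul : ∀ c : ℂ, (c • Γ).IsHomogeneous 3 := fun c => by
    rw [← C_mul']; exact hG3.C_mul c
  ext G
  constructor
  · rintro ⟨hG, h⟩
    have hG : G.IsHomogeneous 3 := hG
    obtain ⟨m₀, hm₀⟩ := ne_zero_iff.1 hne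
    have hd₀ : m₀.degree = 3 := by
      by_contra hcon
      exact hm₀ (hG3.coeff_eq_zero hcon)
    refine ⟨coeff m₀ G / coeff m₀ Γ, ext_homog (hsmul _) hG fun m hm => ?_⟩
    have hb : (monomial m (fac m₀ * coeff m₀ Γ) - monomial m₀ (fac m * coeff m Γ) :
        MvPolynomial (Fin 5) ℂ).IsHomogeneous 3 :=
      (isHomogeneous_monomial _ hm).sub (isHomogeneous_monomial _ hd₀)
    have h2 := h (monomial m (fac m₀ * coeff m₀ Γ) - monomial m₀ (fac m * coeff m Γ))
      ((hcol _).2 ⟨hb, by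
        rw [pp_sub, pp_monomial _ hm, pp_monomial _ hd₀]; ring⟩)
    rw [polarPair_eq hG, pp_sub, pp_monomial _ hm, pp_monomial _ hd₀] at h2
    have h3 : fac m * fac m₀ * (coeff m G * coeff m₀ Γ - coeff m₀ G * coeff m Γ) = 0 := by
      linear_combination h2
    have h4 := (mul_eq_zero.1 h3).resolve_left (mul_ne_zero (fac_ne m) (fac_ne m₀))
    rw [coeff_smul, smul_eq_mul]
    field_simp
    linear_combination -h4
  · rintro ⟨c, rfl⟩
    refine ⟨hsmul _, fun b hb => ?_⟩
    rw [polarPair_eq (hsmul _)]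
    have := ((hcol b).1 hb).2
    rw [pp] at this ⊢
    have h2 : ∑ m ∈ expo 3, coeff m (c • Γ) * (fac m * coeff m b) =
        c * ∑ m ∈ expo 3, coeff m Γ * (fac m * coeff m b) := by
      rw [Finset.mul_sum]
      exact Finset.sum_congr rfl fun m _ => by rw [coeff_smul, smul_eq_mul]; ring
    rw [h2, this, mul_zero]

theorem good_iii {F Q : MvPolynomial (Fin 5) ℂ} {l : MvPolynomial (Fin 5) ℂ →ₗ[ℂ] ℂ}
    (hl : ∀ w : MvPolynomial (Fin 5) ℂ, w.IsHomogeneous 5 → (w ∈ jacobianIdeal F ↔ l w = 0))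
    (hQ : Q.IsHomogeneous 2) (hsm : SmoothForm (dualCubic l Q))
    {a : MvPolynomial (Fin 5) ℂ} (ha : a.IsHomogeneous 1) (haQ : a * Q ∈ jacobianIdeal F) :
    a = 0 := by
  have hG3 := dualCubic_homog l Q
  have hpp : ∀ c : MvPolynomial (Fin 5) ℂ, c.IsHomogeneous 2 → pp (a * c) (dualCubic l Q) = 0 := by
    intro c hc
    have h3 : (a * c).IsHomogeneous 3 := ha.mul hc
    rw [pp_dualCubic l Q h3]
    refine (hl _ (hQ.mul h3)).1 ?_
    have : Q * (a * c) = c * (a * Q) := by ring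
    rw [this]
    exact Ideal.mul_mem_left _ _ haQ
  set Γ := dualCubic l Q with hΓ
  let p : Fin 5 → ℂ := fun i => coeff (Finsupp.single i 1) a
  have haX : a = ∑ i, C (p i) * X i := by
    have h := ha.sum_X_mul_pderiv
    rw [one_smul] at h
    rw [← h]
    refine Finset.sum_congr rfl fun i _ => ?_
    have h0 : (pderiv i a).IsHomogeneous 0 := ha.pderiv
    rw [← totalDegree_zero_iff_isHomogeneous, totalDegree_eq_zero_iff_eq_C] at h0
    rw [mul_comm, h0, coeff_pderiv]
    simp [p]
  have hzero : ∑ i, C (p i) * pderiv i Γ = 0 := by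
    have hh : (∑ i, C (p i) * pderiv i Γ).IsHomogeneous 2 :=
      IsHomogeneous.sum _ _ _ fun i _ => (hG3.pderiv (i := i)).C_mul (p i)
    refine ext_homog hh (isHomogeneous_zero _ _ _) fun n hn => ?_
    have h := hpp (monomial n 1) (isHomogeneous_monomial _ hn)
    have e : a * monomial n 1 = ∑ i, monomial (n + Finsupp.single i 1) (p i) := by
      rw [haX, Finset.sum_mul]
      refine Finset.sum_congr rfl fun i _ => ?_
      rw [X, C_mul_monomial, monomial_mul, mul_one, mul_one, add_comm]
    have hsum : ∀ f : Fin 5 → MvPolynomial (Fin 5) ℂ, pp (∑ i, f i) Γ = ∑ i, pp (f i) Γ := by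
      intro f
      simp only [pp, coeff_sum, Finset.mul_sum]
      rw [Finset.sum_comm]
    rw [e, hsum] at h
    have h2 : fac n * coeff n (∑ i, C (p i) * pderiv i Γ) = 0 := by
      rw [← h, coeff_sum, Finset.mul_sum]
      refine Finset.sum_congr rfl fun i _ => ?_
      rw [pp_monomial _ (by simp [hn]), fac_add, coeff_C_mul, coeff_pderiv]
      ring
    rw [(mul_eq_zero.1 h2).resolve_left (fac_ne n), coeff_zero]
  have hp : p = 0 := by
    apply hsm
    intro j
    have h2 : (pderiv j Γ).IsHomogeneous 2 := hG3.pderiv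
    have he := congrArg (eval p) h2.sum_X_mul_pderiv
    have hz := congrArg (fun q => eval p (pderiv j q)) hzero
    simp only [map_sum, pderiv_C_mul, map_mul, eval_C, eval_X, map_zero, smul_eq_mul] at hz he
    have hcomm : ∀ i, pderiv i (pderiv j Γ) = pderiv j (pderiv i Γ) := by
      intro i
      ext m
      simp only [coeff_pderiv]
      by_cases hij : i = j
      · subst hij; rfl
      · rw [add_right_comm]
        simp [Finsupp.single_apply, hij, Ne.symm hij]
        ring
    simp only [hcomm] at he
    rw [hz, map_nsmul, eq_comm] at he
    simpa using he
  rw [haX]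
  simp [hp]

/-- Smoothness of `dualCubic l Q` is a nonempty open condition in `Q`. -/
theorem smooth_open (Γ : MvPolynomial (Fin 5) ℂ →ₗ[ℂ] MvPolynomial (Fin 5) ℂ)
    (hΓ : ∀ Q, (Γ Q).IsHomogeneous 3) (A₀ : Sym2 (Fin 5) → ℂ) (h₀ : SmoothForm (Γ (quadL A₀))) :
    ∃ H : MvPolynomial (Sym2 (Fin 5)) ℂ, H ≠ 0 ∧ ∀ A, eval A H ≠ 0 → SmoothForm (Γ (quadL A)) := by
  classical
  obtain ⟨N, hN⟩ := smooth_pow_le h₀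
  have hr : ∀ w : {w // w ∈ expo (2 + N)}, ∃ r : Fin 5 → MvPolynomial (Fin 5) ℂ,
      (∀ i, (r i).IsHomogeneous N) ∧
      ∑ i, pderiv i (Γ (quadL A₀)) * r i = monomial w.1 1 := by
    intro w
    have hw : (monomial w.1 (1 : ℂ)).IsHomogeneous (2 + N) :=
      isHomogeneous_monomial _ (mem_expo.1 w.2)
    have hmem : monomial w.1 (1 : ℂ) ∈ jacobianIdeal (Γ (quadL A₀)) :=
      hN (Ideal.pow_le_pow_right (by omega) (homog_mem_pow hw))
    obtain ⟨c, hc⟩ := Ideal.mem_span_range_iff_exists_fun.1 hmem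
    refine ⟨fun i => homogeneousComponent N (c i), fun i => homogeneousComponent_isHomogeneous _ _, ?_⟩
    have h := congrArg (homogeneousComponent (2 + N)) hc
    rw [homogeneousComponent_of_mem (n := 2 + N) hw, if_pos rfl, map_sum] at h
    rw [← h]
    refine Finset.sum_congr rfl fun i _ => ?_
    rw [mul_comm (c i), homogeneousComponent_mul_left (hΓ _).pderiv]
  choose r hrh hr using hr
  let row : {w // w ∈ expo (2 + N)} → (Sym2 (Fin 5) → ℂ) →ₗ[ℂ] MvPolynomial (Fin 5) ℂ := fun w =>
    ∑ i, (LinearMap.mulRight ℂ (r w i)).comp ((pderiv i).toLinearMap.comp (Γ.comp quadL))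
  have hrow : ∀ w A, row w A = ∑ i, pderiv i (Γ (quadL A)) * r w i := by
    intro w A
    simp [row]
  have hp := fun w v : {w // w ∈ expo (2 + N)} => linear_poly ((lcoeff ℂ v.1).comp (row w))
  choose p hp using hp
  have hdet : ∀ A, eval A (Matrix.of p).det = (Matrix.of fun w v => coeff v.1 (row w A)).det := by
    intro A
    rw [RingHom.map_det]
    congr 1
    ext w v
    simp [hp]
  refine ⟨(Matrix.of p).det, ?_, fun A hA => ?_⟩
  · intro h
    have h1 := hdet A₀
    rw [h, map_zero] at h1
    have : (Matrix.of fun w v : {w // w ∈ expo (2 + N)} => coeff v.1 (row w A₀)) = 1 := by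
      ext w v
      rw [Matrix.of_apply, hrow, hr, coeff_monomial, Matrix.one_apply]
      exact if_congr Subtype.ext_iff.symm rfl rfl
    rw [this, Matrix.det_one] at h1
    exact zero_ne_one h1
  · rw [hdet] at hA
    set M : Matrix {w // w ∈ expo (2 + N)} {w // w ∈ expo (2 + N)} ℂ :=
      Matrix.of fun w v => coeff v.1 (row w A) with hM
    have hinv : M⁻¹ * M = 1 := Matrix.nonsing_inv_mul _ (isUnit_iff_ne_zero.2 hA)
    have hrowh : ∀ w, (row w A).IsHomogeneous (2 + N) := by
      intro w
      rw [hrow]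
      exact IsHomogeneous.sum _ _ _ fun i _ => (hΓ _).pderiv.mul (hrh w i)
    intro x hx
    have hx0 : ∀ w, eval x (row w A) = 0 := by
      intro w
      rw [hrow, map_sum]
      exact Finset.sum_eq_zero fun i _ => by rw [map_mul, hx i, zero_mul]
    have hmono : ∀ v : {w // w ∈ expo (2 + N)}, monomial v.1 (1 : ℂ) =
        ∑ w, C (M⁻¹ v w) * row w A := by
      intro v
      refine ext_homog (isHomogeneous_monomial _ (mem_expo.1 v.2))
        (IsHomogeneous.sum _ _ _ fun w _ => (hrowh w).C_mul _) fun m hm => ?_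
      have h := congrFun (congrFun hinv v) ⟨m, mem_expo.2 hm⟩
      rw [Matrix.mul_apply] at h
      simp only [hM, Matrix.of_apply] at h
      simp only [coeff_sum, coeff_C_mul, coeff_monomial]
      rw [hM, h, Matrix.one_apply]
      simp [Subtype.ext_iff]
    funext i
    have h := congrArg (eval x) (hmono ⟨Finsupp.single i (2 + N), mem_expo.2 (by simp)⟩)
    rw [map_sum, Finset.sum_eq_zero fun w _ => by rw [map_mul, hx0 w, mul_zero]] at h
    rw [← X_pow_eq_monomial, map_pow, eval_X] at h
    exact eq_zero_of_pow_eq_zero h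

theorem smooth_ne_zero {G : MvPolynomial (Fin 5) ℂ} (h : SmoothForm G) : G ≠ 0 := by
  rintro rfl
  have := congrFun (h (fun _ => 1) (by simp)) 0
  simp at this

theorem hess_bind (H : MvPolynomial (Sym2 (Fin 5)) ℂ) :
    ∃ P : MvPolynomial ((Fin 5) →₀ ℕ) ℂ, ∀ Q : MvPolynomial (Fin 5) ℂ,
      eval (fun m => coeff m Q) P = eval (hessEntry Q) H := by
  have h : ∀ s : Sym2 (Fin 5), ∃ p : MvPolynomial ((Fin 5) →₀ ℕ) ℂ,
      ∀ Q : MvPolynomial (Fin 5) ℂ, eval (fun m => coeff m Q) p = hessEntry Q s := by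
    intro s
    induction s using Sym2.ind with
    | _ i j =>
      refine ⟨C (if i = j then 2 else 1) * X (Finsupp.single i 1 + Finsupp.single j 1),
        fun Q => ?_⟩
      rw [map_mul, eval_C, eval_X]
      rfl
  choose p hp using h
  refine ⟨bind₁ p H, fun Q => ?_⟩
  rw [← aeval_eq_eval, ← aeval_eq_eval, aeval_bind₁]
  congr 2
  funext s
  rw [← hp s Q, ← aeval_eq_eval]

/-- For every `F ∈ 𝒰`, the set of good `Q` contains a nonempty Zariski open subset of `S₂`:
there is a family of polynomial functions in the coefficient coordinates such that the locus
in `S₂` where not all of them vanish is nonempty and consists of good `Q`. -/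
theorem goodQ_contains_nonempty_zariski_open :
    ∀ F ∈ calU, ∃ (ι : Type) (P : ι → MvPolynomial ((Fin 5) →₀ ℕ) ℂ),
      (∃ Q₀ ∈ homogeneousSubmodule (Fin 5) ℂ 2,
        ¬ ∀ i, eval (fun m => coeff m Q₀) (P i) = 0) ∧
      (∀ Q ∈ homogeneousSubmodule (Fin 5) ℂ 2,
        (¬ ∀ i, eval (fun m => coeff m Q) (P i) = 0) → GoodQ F Q) := by
  intro F hF
  obtain ⟨hF3, hsm, G, ⟨hG3, hGF⟩, hGsm⟩ := hF
  have hF3 : F.IsHomogeneous 3 := hF3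
  have hG3 : G.IsHomogeneous 3 := hG3
  obtain ⟨l, hl, hl'⟩ := exists_functional hF3 hsm
  obtain ⟨A₀, hA₀⟩ := exists_dualCubic l hl' hG3 fun b hb hbJ => by
    rw [← polarPair_eq hG3]; exact hGF b ⟨hbJ, hb⟩
  obtain ⟨H₁, hH₁, hH₁s⟩ := smooth_open (dualCubic l) (dualCubic_homog l) A₀ (hA₀ ▸ hGsm)
  obtain ⟨H₂, hH₂, hH₂s⟩ := bertini hF3 (smooth_ne_zero hsm) hsm
  obtain ⟨P, hP⟩ := hess_bind (H₁ * H₂)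
  refine ⟨Unit, fun _ => P, ?_, ?_⟩
  · have hne : ∃ A, eval A (H₁ * H₂) ≠ 0 := by
      by_contra hcon
      push Not at hcon
      exact mul_ne_zero hH₁ hH₂ (MvPolynomial.funext fun A => by rw [hcon A, map_zero])
    obtain ⟨A, hA⟩ := hne
    refine ⟨quadOf A, quadOf_homog A, fun h => hA ?_⟩
    have := h ()
    rwa [hP, hessEntry_quadOf] at this
  · intro Q hQ h
    have hQ : Q.IsHomogeneous 2 := hQ
    have hev : eval (hessEntry Q) (H₁ * H₂) ≠ 0 := fun h0 => h fun _ => by rw [hP, h0]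
    rw [map_mul] at hev
    have hs := hH₁s _ (left_ne_zero_of_mul hev)
    rw [quadL_apply, quadOf_hessEntry hQ] at hs
    refine ⟨hH₂s Q hQ (right_ne_zero_of_mul hev),
      ⟨dualCubic l Q, hs, smooth_ne_zero hs, good_ii hl hQ (smooth_ne_zero hs)⟩, ?_⟩
    intro a ha haQ
    exact good_iii hl hQ hs ha haQ.1
end

section
/- For every smooth cubic form F ∈ ℂ[x₀,…,x₄], the set of quadratic forms Q ∈ S_2 such that the multiplication map S_1 → S_3/J_{F,3}, a ↦ aQ mod J_{F,3}, is injective (equivalently (J_{F,3}:Q) = 0) is a nonempty Zariski open subset of S_2. -/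
open MvPolynomial

namespace ColonThree

abbrev S5 := MvPolynomial (Fin 5) ℂ

section grading
attribute [local instance] MvPolynomial.gradedAlgebra

lemma dec_eq (q : S5) (n : ℕ) :
    ((DirectSum.decompose (homogeneousSubmodule (Fin 5) ℂ) q) n : S5) = homogeneousComponent n q :=
  decomposition.decompose'_apply q n

lemma hc_mul {g : S5} {e : ℕ} (hg : g.IsHomogeneous e) (p : S5) (n : ℕ) :
    homogeneousComponent (n + e) (p * g) = homogeneousComponent n p * g := by
  have h := DirectSum.coe_decompose_mul_add_of_right_mem (homogeneousSubmodule (Fin 5) ℂ)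
    (i := n) (a := p) (b := g) (j := e) hg
  simpa only [dec_eq] using h

lemma hc_mul_lt {g : S5} {e : ℕ} (hg : g.IsHomogeneous e) (p : S5) (n : ℕ) (hn : n < e) :
    homogeneousComponent n (p * g) = 0 := by
  have h := DirectSum.coe_decompose_mul_of_right_mem_of_not_le (homogeneousSubmodule (Fin 5) ℂ)
    (n := n) (a := p) (b := g) (i := e) hg (by omega)
  simpa only [dec_eq] using h
end grading

/-- homogeneous ideals -/
def HI (I : Ideal S5) : Prop := ∀ p ∈ I, ∀ n, homogeneousComponent n p ∈ I

/-- `g` is a nonzerodivisor modulo `I` -/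
def Reg (g : S5) (I : Ideal S5) : Prop := ∀ p, p * g ∈ I → p ∈ I

/-- the ideal obtained by adjoining one element -/
noncomputable abbrev adj (I : Ideal S5) (g : S5) : Ideal S5 := I ⊔ Ideal.span {g}

lemma mem_adj {I : Ideal S5} {g p : S5} : p ∈ adj I g ↔ ∃ s, p - s * g ∈ I := by
  rw [adj, Submodule.mem_sup]
  constructor
  · rintro ⟨y, hy, z, hz, rfl⟩
    obtain ⟨s, rfl⟩ := Ideal.mem_span_singleton'.1 hz
    exact ⟨s, by simpa using hy⟩
  · rintro ⟨s, hs⟩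
    exact ⟨_, hs, s * g, Ideal.mem_span_singleton'.2 ⟨s, rfl⟩, by ring⟩

lemma HI.adj {I : Ideal S5} (hI : HI I) {g : S5} {e : ℕ} (hg : g.IsHomogeneous e) :
    HI (adj I g) := by
  intro p hp n
  obtain ⟨s, hs⟩ := mem_adj.1 hp
  have h1 := hI _ hs n
  rw [map_sub] at h1
  by_cases hn : n < e
  · rw [hc_mul_lt hg _ _ hn, sub_zero] at h1
    exact Ideal.mem_sup_left h1
  · obtain ⟨k, rfl⟩ : ∃ k, n = k + e := ⟨n - e, by omega⟩
    rw [hc_mul hg] at h1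
    exact mem_adj.2 ⟨_, h1⟩

/-- degree `< e` part is not changed by adjoining a form of degree `e` -/
lemma mem_of_mem_adj_lt {I : Ideal S5} (hI : HI I) {g : S5} {e d : ℕ} (hg : g.IsHomogeneous e)
    {c : S5} (hc : c.IsHomogeneous d) (hd : d < e) (h : c ∈ adj I g) : c ∈ I := by
  obtain ⟨s, hs⟩ := mem_adj.1 h
  have h1 := hI _ hs d
  rw [map_sub, hc_mul_lt hg _ _ hd, sub_zero, homogeneousComponent_eq_self hc] at h1
  exact h1

/-- the swap step -/
lemma Reg.swap {I : Ideal S5} {l g : S5} (hl : Reg l I) (hg' : Reg g (adj I l)) :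
    Reg l (adj I g) := by
  intro p hp
  obtain ⟨s, hs⟩ := mem_adj.1 hp
  have : s * g ∈ adj I l := mem_adj.2 ⟨p, by
    have := I.neg_mem hs
    simpa using this⟩
  obtain ⟨s', hs'⟩ := mem_adj.1 (hg' _ this)
  refine mem_adj.2 ⟨s', hl _ ?_⟩
  have := I.add_mem hs (I.mul_mem_right g hs')
  convert this using 1
  ring

/-- the socle of the quotient by `I` is concentrated in degree `d0` -/
def Soc (I : Ideal S5) (d0 : ℕ) : Prop :=
  ∀ d, d ≠ d0 → ∀ p : S5, p.IsHomogeneous d → (∀ i, X i * p ∈ I) → p ∈ I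

lemma Soc.exchange {I : Ideal S5} (hI : HI I) {l g : S5} (hlh : l.IsHomogeneous 1)
    (hgh : g.IsHomogeneous 2) (hlm : l ∈ Ideal.span (Set.range (X : Fin 5 → S5)))
    (hl : Reg l I) (hg : Reg g I) {d0 : ℕ} (hs : Soc (adj I l) d0) : Soc (adj I g) (d0 + 1) := by
  intro d hd p hp hX
  have hlp : l * p ∈ adj I g := by
    have : Ideal.span (Set.range (X : Fin 5 → S5)) ≤ (adj I g).colon {p} := by
      rw [Ideal.span_le]
      rintro _ ⟨i, rfl⟩
      simpa [Submodule.mem_colon_singleton] using hX i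
    simpa [Submodule.mem_colon_singleton] using this hlm
  rcases Nat.eq_zero_or_pos d with rfl | hd0
  · have h1 : l * p ∈ I := mem_of_mem_adj_lt hI hgh (hlh.mul hp) (by norm_num) hlp
    exact Ideal.mem_sup_left (hl _ (by rwa [mul_comm]))
  obtain ⟨k, rfl⟩ : ∃ k, d = k + 1 := ⟨d - 1, by omega⟩
  obtain ⟨s0, hs0⟩ := mem_adj.1 hlp
  have h1 := hI _ hs0 (k + 2)
  rw [map_sub, hc_mul hgh, homogeneousComponent_eq_self
    (by have := hlh.mul hp; rw [show k + 2 = 1 + (k+1) by ring]; exact this)] at h1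
  set s := homogeneousComponent k s0 with hsdef
  have hsh : s.IsHomogeneous k := homogeneousComponent_isHomogeneous _ _
  have hsm : s ∈ adj I l := by
    refine hs k (by omega) s hsh fun i => ?_
    obtain ⟨t, ht⟩ := mem_adj.1 (hX i)
    refine mem_adj.2 ⟨t, hg _ ?_⟩
    have := I.sub_mem (I.mul_mem_left l ht) (I.mul_mem_left (X i) h1)
    convert this using 1
    ring
  obtain ⟨s', hs'⟩ := mem_adj.1 hsm
  refine mem_adj.2 ⟨s', hl _ ?_⟩
  have := I.add_mem h1 (I.mul_mem_right g hs')
  convert this using 1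
  ring

/-- avoidance: pick a general element of `V` -/
lemma exists_reg (V : Submodule ℂ S5) (E : ℕ → Ideal S5) (l : ℕ → S5) (n : ℕ)
    (hlm : ∀ j, l j ∈ Ideal.span (Set.range (X : Fin 5 → S5)))
    (hl : ∀ j < n, Reg (l j) (E j))
    (hV : ∀ P : Ideal S5, P.IsPrime → (∀ v ∈ V, v ∈ P) → ∀ i, X i ∈ P) :
    ∃ g ∈ V, ∀ j < n, Reg g (E j) := by
  classical
  have key : ∀ j (f : S5), (∃ P ∈ associatedPrimes S5 (S5 ⧸ E j), f ∈ P) ↔ ¬ Reg f (E j) := by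
    intro j f
    have h := biUnion_associatedPrimes_eq_zero_divisors S5 (S5 ⧸ E j)
    have h2 := Set.ext_iff.1 h f
    simp only [Set.mem_iUnion, SetLike.mem_coe, exists_prop, Set.mem_ofPred_eq] at h2
    rw [h2, Reg]
    push Not
    constructor
    · rintro ⟨x, hx, hfx⟩
      obtain ⟨p, rfl⟩ := Ideal.Quotient.mk_surjective x
      refine ⟨p, ?_, fun h => hx (Ideal.Quotient.eq_zero_iff_mem.2 h)⟩
      rw [← Ideal.Quotient.eq_zero_iff_mem, mul_comm, map_mul]
      exact hfx
    · rintro ⟨p, hp, hp'⟩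
      refine ⟨Ideal.Quotient.mk _ p, fun h => hp' (Ideal.Quotient.eq_zero_iff_mem.1 h), ?_⟩
      rw [← Ideal.Quotient.eq_zero_iff_mem, mul_comm, map_mul] at hp
      exact hp
  let A : Set (Ideal S5) := ⋃ j ∈ Finset.range n, associatedPrimes S5 (S5 ⧸ E j)
  have hA : A.Finite := Set.Finite.biUnion (Finset.finite_toSet _)
    fun j _ => associatedPrimes.finite S5 _
  let B : Set (Submodule ℂ V) :=
    (fun P : Ideal S5 => (P.restrictScalars ℂ).comap V.subtype) '' A
  have hB : B.Finite := hA.image _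
  have hAl : ∀ P ∈ A, ∃ j < n, P ∈ associatedPrimes S5 (S5 ⧸ E j) := by
    intro P hP
    simpa [A] using hP
  have htop : ⊤ ∉ B := by
    rintro ⟨P, hP, hPt⟩
    obtain ⟨j, hj, hPj⟩ := hAl P hP
    have hXP := hV P hPj.isPrime (fun v hv => by
      have : (⟨v, hv⟩ : V) ∈ (P.restrictScalars ℂ).comap V.subtype := by
        rw [show (P.restrictScalars ℂ).comap V.subtype = ⊤ from hPt]; trivial
      simpa using this)
    have hle : Ideal.span (Set.range (X : Fin 5 → S5)) ≤ P := by
      rw [Ideal.span_le]; rintro _ ⟨i, rfl⟩; exact hXP i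
    exact (key j (l j)).1 ⟨P, hPj, hle (hlm j)⟩ (hl j hj)
  have hne := Subspace.biUnion_ne_univ_of_top_notMem (s := hB.toFinset) (by simpa using htop)
  rw [Set.ne_univ_iff_exists_notMem] at hne
  obtain ⟨v, hv⟩ := hne
  refine ⟨v, v.2, fun j hj => ?_⟩
  by_contra hcon
  obtain ⟨P, hP, hvP⟩ := (key j v).2 hcon
  apply hv
  simp only [Set.mem_iUnion]
  refine ⟨(P.restrictScalars ℂ).comap V.subtype, ?_, ?_⟩
  · simp only [Set.Finite.mem_toFinset]
    refine ⟨P, ?_, rfl⟩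
    simp only [A, Set.mem_iUnion]
    exact ⟨j, by simpa using hj, hP⟩
  · simpa using hvP

/-- regular sequences modulo `I` -/
def RegSeq : (n : ℕ) → Ideal S5 → (Fin n → S5) → Prop
  | 0, _, _ => True
  | n + 1, I, g => Reg (g 0) I ∧ RegSeq n (adj I (g 0)) (Fin.tail g)

lemma main_seq (V : Submodule ℂ S5) (hV2 : ∀ v ∈ V, v.IsHomogeneous 2)
    (hV : ∀ P : Ideal S5, P.IsPrime → (∀ v ∈ V, v ∈ P) → ∀ i, X i ∈ P)
    (l : ℕ → S5) (hlh : ∀ j, (l j).IsHomogeneous 1)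
    (hlm : ∀ j, l j ∈ Ideal.span (Set.range (X : Fin 5 → S5))) (n : ℕ) :
    ∀ (E : ℕ → Ideal S5), (∀ j, HI (E j)) → (∀ j, E (j + 1) = adj (E j) (l j)) →
      (∀ j < n, Reg (l j) (E j)) →
      ∃ g : Fin n → S5, (∀ i, g i ∈ V) ∧ RegSeq n (E 0) g ∧
        ∀ d0, Soc (E n) d0 → Soc (E 0 ⊔ Ideal.span (Set.range g)) (d0 + n) := by
  induction n with
  | zero =>
    intro E hE _ _
    refine ⟨Fin.elim0, fun i => i.elim0, trivial, fun d0 h => ?_⟩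
    simpa using h
  | succ n ih =>
    intro E hE hadj hreg
    obtain ⟨g0, hg0V, hg0⟩ := exists_reg V E l (n + 1) hlm hreg hV
    obtain ⟨g, hgV, hgr, hgs⟩ := ih (fun j => adj (E j) g0) (fun j => (hE j).adj (hV2 _ hg0V))
      (fun j => by simp only [hadj, adj]; rw [sup_right_comm])
      (fun j hj => (hreg j (by omega)).swap (by rw [← hadj]; exact hg0 _ (by omega)))
    refine ⟨Fin.cons g0 g, ?_, ⟨hg0 0 (by omega), hgr⟩, ?_⟩
    · intro i
      refine Fin.cases hg0V hgV i
    · intro d0 hd0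
      rw [hadj] at hd0
      have := hgs _ (hd0.exchange (hE n) (hlh n) (hV2 _ hg0V) (hlm n) (hreg n (by omega))
        (hg0 n (by omega)))
      rw [Fin.range_cons, Set.insert_eq, Ideal.span_union, ← sup_assoc]
      convert this using 1
      omega

lemma syz (n : ℕ) : ∀ (I : Ideal S5) (g : Fin n → S5), HI I → (∀ i, (g i).IsHomogeneous 2) →
    RegSeq n I g → ∀ (e : ℕ), e < 2 → ∀ c : Fin n → S5, (∀ i, (c i).IsHomogeneous e) →
      ∑ i, c i * g i ∈ I → ∀ i, c i ∈ I := by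
  induction n with
  | zero => intro I g _ _ _ e _ c _ _ i; exact i.elim0
  | succ n ih =>
    intro I g hI hg hr e he c hc hsum
    rw [Fin.sum_univ_succ] at hsum
    have h1 : ∀ i : Fin n, c i.succ ∈ I := fun i =>
      mem_of_mem_adj_lt hI (hg 0) (hc _) he
        (ih _ (Fin.tail g) (hI.adj (hg 0)) (fun i => hg _) hr.2 e he (Fin.tail c) (fun i => hc _)
          (mem_adj.2 ⟨-c 0, by simpa [Fin.tail, add_comm] using hsum⟩) i)
    have h2 : c 0 ∈ I := hr.1 _ (by
      have := I.sub_mem hsum (I.sum_mem (t := Finset.univ) fun (i : Fin n) _ =>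
        I.mul_mem_right (g i.succ) (h1 i))
      simpa using this)
    exact fun i => Fin.cases h2 h1 i

end ColonThree

namespace ColonThree

section linalg
variable {W : Type*} [AddCommGroup W] [Module ℂ W]

lemma exists_dual {m : ℕ} {v : Fin m → W} (hv : LinearIndependent ℂ v) :
    ∃ L : W →ₗ[ℂ] (Fin m → ℂ), ∀ i, L (v i) = Pi.single i 1 := by
  classical
  have hinj := linearIndependent_iff_injective_fintypeLinearCombination.1 hv
  obtain ⟨L, hL⟩ := LinearMap.exists_leftInverse_of_injective (Fintype.linearCombination ℂ v)
    (LinearMap.ker_eq_bot.2 hinj)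
  refine ⟨L, fun i => ?_⟩
  have := LinearMap.congr_fun hL (Pi.single i 1)
  simpa using this

lemma indep_of_det {m : ℕ} {v : Fin m → W} (L : W →ₗ[ℂ] (Fin m → ℂ))
    (h : (Matrix.of fun i j => L (v j) i).det ≠ 0) : LinearIndependent ℂ v := by
  have h1 := Matrix.linearIndependent_cols_of_det_ne_zero h
  exact LinearIndependent.of_comp L h1

lemma indep_perturb {m : ℕ} {v : Fin m → W} (hv : LinearIndependent ℂ v) (w : Fin m → W) :
    ∃ t : ℂ, t ≠ 0 ∧ LinearIndependent ℂ (fun i => v i + t • w i) := by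
  classical
  obtain ⟨L, hL⟩ := exists_dual hv
  let N : ℂ → Matrix (Fin m) (Fin m) ℂ := fun t => Matrix.of fun i j => L (v j + t • w j) i
  have hc : Continuous fun t => (N t).det := by
    apply Continuous.matrix_det
    refine continuous_pi fun i => continuous_pi fun j => ?_
    simp only [N, Matrix.of_apply, map_add, map_smul, Pi.add_apply, Pi.smul_apply, smul_eq_mul]
    fun_prop
  have h0 : (N 0).det ≠ 0 := by
    have : N 0 = 1 := by
      ext i j
      simp [N, hL, Matrix.one_apply, Pi.single_apply]
    rw [this]; simp
  have hev : ∀ᶠ t in nhdsWithin (0 : ℂ) {0}ᶜ, (N t).det ≠ 0 :=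
    (hc.continuousAt.eventually_ne h0).filter_mono nhdsWithin_le_nhds
  obtain ⟨t, ht, ht0⟩ := (hev.and self_mem_nhdsWithin).exists
  exact ⟨t, ht0, indep_of_det L ht⟩

lemma exists_max_rank {W₁ W₂ : Type*} [AddCommGroup W₁] [Module ℂ W₁] [AddCommGroup W₂]
    [Module ℂ W₂] [FiniteDimensional ℂ W₁] (φ : W₂ →ₗ[ℂ] W₁ →ₗ[ℂ] W) :
    ∃ Q, ∀ a, φ Q a = 0 → ∀ Q', φ Q' a ∈ LinearMap.range (φ Q) := by
  obtain ⟨Q, hQ⟩ : ∃ Q, ∀ Q', Module.finrank ℂ (LinearMap.range (φ Q')) ≤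
      Module.finrank ℂ (LinearMap.range (φ Q)) := by
    have hb : BddAbove (Set.range fun Q => Module.finrank ℂ (LinearMap.range (φ Q))) :=
      ⟨Module.finrank ℂ W₁, by rintro _ ⟨Q, rfl⟩; exact LinearMap.finrank_range_le _⟩
    obtain ⟨Q, hQ⟩ := Nat.sSup_mem (Set.range_nonempty _) hb
    refine ⟨Q, fun Q' => ?_⟩
    rw [show Module.finrank ℂ (LinearMap.range (φ Q)) = _ from hQ]
    exact le_csSup hb ⟨Q', rfl⟩
  refine ⟨Q, fun a ha Q' => ?_⟩
  by_contra hcon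
  set r := Module.finrank ℂ (LinearMap.range (φ Q)) with hr
  let b := Module.finBasis ℂ (LinearMap.range (φ Q))
  choose u hu using fun i => (b i).2
  have hb : LinearIndependent ℂ (fun i => ((b i : LinearMap.range (φ Q)) : W)) :=
    b.linearIndependent.map' (Submodule.subtype _) (Submodule.ker_subtype _)
  have hv : LinearIndependent ℂ
      (Fin.cons (φ Q' a) (fun i => ((b i : LinearMap.range (φ Q)) : W)) : Fin (r + 1) → W) := by
    refine linearIndependent_finCons.2 ⟨hb, fun hmem => hcon ?_⟩
    refine Submodule.span_le.2 ?_ hmem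
    rintro _ ⟨i, rfl⟩
    exact (b i).2
  obtain ⟨t, ht, hind⟩ := indep_perturb hv (Fin.cons 0 (fun i => φ Q' (u i)))
  have hle := hQ (Q + t • Q')
  have hmem : ∀ i : Fin (r + 1), (Fin.cons (φ Q' a) (fun i => ((b i : LinearMap.range (φ Q)) : W)) :
      Fin (r + 1) → W) i + t • (Fin.cons 0 (fun i => φ Q' (u i)) : Fin (r + 1) → W) i ∈
      LinearMap.range (φ (Q + t • Q')) := by
    intro i
    refine Fin.cases ?_ (fun i => ?_) i
    · refine ⟨t⁻¹ • a, ?_⟩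
      simp [ha, ht]
    · refine ⟨u i, ?_⟩
      simp [hu]
  have h2 : LinearIndependent ℂ (fun i => (⟨_, hmem i⟩ : LinearMap.range (φ (Q + t • Q')))) :=
    LinearIndependent.of_comp (Submodule.subtype _) hind
  have := h2.fintype_card_le_finrank
  simp at this
  omega

end linalg
end ColonThree
namespace ColonThree

lemma span_X_reg (s : Set (Fin 5)) (c : S5) (i0 : Fin 5) (h0 : i0 ∉ s)
    (hc : coeff (Finsupp.single i0 1) c ≠ 0) :
    Reg c (Ideal.span (X '' s : Set S5)) := by
  classical
  set I := Ideal.span (X '' s : Set S5) with hI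
  let θ : S5 →ₐ[ℂ] S5 := aeval (fun i => if i ∈ s then 0 else X i)
  have h1 : ∀ p, Ideal.Quotient.mkₐ ℂ I (θ p) = Ideal.Quotient.mkₐ ℂ I p := by
    intro p
    have : (Ideal.Quotient.mkₐ ℂ I).comp θ = Ideal.Quotient.mkₐ ℂ I := by
      apply MvPolynomial.algHom_ext
      intro i
      by_cases hi : i ∈ s
      · have : (Ideal.Quotient.mk I (X i : S5)) = 0 :=
          Ideal.Quotient.eq_zero_iff_mem.2 (Ideal.subset_span ⟨i, hi, rfl⟩)
        simp [θ, hi, this]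
      · simp [θ, hi]
    exact AlgHom.congr_fun this p
  have h2 : ∀ p, p ∈ I ↔ θ p = 0 := by
    intro p
    constructor
    · intro hp
      have hle : I ≤ RingHom.ker (θ : S5 →+* S5) := by
        rw [hI, Ideal.span_le]
        rintro _ ⟨i, hi, rfl⟩
        simp [θ, hi]
      simpa using hle hp
    · intro hp
      have := h1 p
      rw [hp, map_zero] at this
      exact Ideal.Quotient.eq_zero_iff_mem.1 this.symm
  intro p hp
  rw [h2, map_mul] at hp
  rcases mul_eq_zero.1 hp with h | h
  · exact (h2 p).2 h
  · exfalso
    have hcI := (h2 c).2 h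
    rw [hI, mem_ideal_span_X_image] at hcI
    obtain ⟨i, hi, hne⟩ := hcI _ (mem_support_iff.2 hc)
    rw [Finsupp.single_apply] at hne
    split_ifs at hne with h
    · exact h0 (h ▸ hi)
    · exact hne rfl

/-- flag of linear ideals -/
noncomputable def Efl (τ : ℕ → Fin 5) (j : ℕ) : Ideal S5 := Ideal.span (X '' (τ '' Set.Iio j))

lemma Efl_zero (τ) : Efl τ 0 = ⊥ := by simp [Efl]

lemma Efl_succ (τ) (j : ℕ) : Efl τ (j + 1) = adj (Efl τ j) (X (τ j)) := by
  have : Set.Iio (j + 1) = insert j (Set.Iio j) := by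
    ext i; simp
  rw [Efl, Efl, this, Set.image_insert_eq, Set.image_insert_eq, Set.insert_eq, Ideal.span_union,
    sup_comm]

lemma HI_bot : HI (⊥ : Ideal S5) := by
  intro p hp n
  rw [Ideal.mem_bot] at hp
  simp [hp]

lemma HI_Efl (τ) (j : ℕ) : HI (Efl τ j) := by
  induction j with
  | zero => rw [Efl_zero]; exact HI_bot
  | succ j ih => rw [Efl_succ]; exact ih.adj (isHomogeneous_X _ _)

lemma exists_decomp (f : Fin 5 → S5) (hf : ∀ i, (f i).IsHomogeneous 2) (d : ℕ) (p : S5)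
    (hp : p.IsHomogeneous (d + 2)) (hpJ : p ∈ Ideal.span (Set.range f)) :
    ∃ c : Fin 5 → S5, (∀ i, (c i).IsHomogeneous d) ∧ ∑ i, c i * f i = p := by
  obtain ⟨c, hc⟩ := Ideal.mem_span_range_iff_exists_fun.1 hpJ
  refine ⟨fun i => homogeneousComponent d (c i), fun i => homogeneousComponent_isHomogeneous _ _, ?_⟩
  have := congrArg (homogeneousComponent (d + 2)) hc
  rw [homogeneousComponent_eq_self hp, map_sum] at this
  rw [← this]
  exact Finset.sum_congr rfl fun i _ => (hc_mul (hf i) _ _).symm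

section fixedV
variable (f : Fin 5 → S5)

/-- the span of the quadrics -/
noncomputable abbrev Vsp : Submodule ℂ S5 := Submodule.span ℂ (Set.range f)

lemma Vsp_hom
    (hf : ∀ i, (f i).IsHomogeneous 2) : ∀ v ∈ Vsp f, v.IsHomogeneous 2 := by
  intro v hv
  have : Vsp f ≤ homogeneousSubmodule (Fin 5) ℂ 2 := by
    rw [Submodule.span_le]; rintro _ ⟨i, rfl⟩; exact hf i
  exact this hv

lemma Vsp_prime
    (hz : ∀ x : Fin 5 → ℂ, (∀ i, eval x (f i) = 0) → x = 0) : ∀ P : Ideal S5, P.IsPrime → (∀ v ∈ Vsp f, v ∈ P) → ∀ i, X i ∈ P := by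
  intro P hP hV i
  have := MvPolynomial.IsPrime.vanishingIdeal_zeroLocus (K := ℂ) P
  rw [← this, mem_vanishingIdeal_iff]
  intro x hx
  have hx0 : x = 0 := hz x fun k => by
    have := (mem_zeroLocus_iff.1 hx) (f k) (hV _ (Submodule.subset_span ⟨k, rfl⟩))
    rwa [aeval_eq_eval] at this
  simp [hx0]

lemma span_eq_of_indep (g : Fin 5 → S5) (hg : ∀ i, g i ∈ Vsp f) (hi : LinearIndependent ℂ g) :
    Submodule.span ℂ (Set.range g) = Vsp f := by
  have : FiniteDimensional ℂ (Vsp f) := FiniteDimensional.span_of_finite ℂ (Set.finite_range f)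
  refine Submodule.eq_of_le_of_finrank_le ?_ ?_
  · rw [Submodule.span_le]; rintro _ ⟨i, rfl⟩; exact hg i
  · rw [finrank_span_eq_card hi]
    exact finrank_range_le_card f

lemma X_mem_m (i : Fin 5) : (X i : S5) ∈ Ideal.span (Set.range (X : Fin 5 → S5)) :=
  Ideal.subset_span ⟨i, rfl⟩

lemma coeff_lin (i : Fin 5) : coeff (Finsupp.single i 1) (X i : S5) ≠ 0 := by
  simp

lemma C_mem_of_lt {a : S5} {e : ℕ} (he : 0 < e) (ha : a.IsHomogeneous e) {c : ℂ}
    (hc : (C c : S5) ∈ adj ⊥ a) : c = 0 := by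
  have := mem_of_mem_adj_lt HI_bot ha (isHomogeneous_C (Fin 5) c) he hc
  simpa using this

lemma soc_J
    (hf : ∀ i, (f i).IsHomogeneous 2) (hz : ∀ x : Fin 5 → ℂ, (∀ i, eval x (f i) = 0) → x = 0) : Soc (Ideal.span (Set.range f)) 5 := by
  obtain ⟨g, hgV, hgr, hgs⟩ := main_seq (Vsp f) (Vsp_hom f hf) (Vsp_prime f hz)
    (fun j => X (Fin.ofNat 5 j)) (fun j => isHomogeneous_X _ _) (fun j => X_mem_m _) 5
    (Efl (Fin.ofNat 5)) (HI_Efl _) (Efl_succ _) (by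
      intro j hj
      refine span_X_reg _ _ (Fin.ofNat 5 j) ?_ (coeff_lin _)
      rintro ⟨i, hi, h⟩
      simp [Fin.ext_iff] at hi h
      omega)
  rw [Efl_zero] at hgr hgs
  have hind : LinearIndependent ℂ g := by
    rw [Fintype.linearIndependent_iff]
    intro c hc i
    have := syz 5 ⊥ g HI_bot (fun i => Vsp_hom f hf _ (hgV i)) hgr 0 (by norm_num)
      (fun i => C (c i)) (fun i => isHomogeneous_C _ _) (by simpa [smul_eq_C_mul] using hc) i
    simpa using this
  have hsp := span_eq_of_indep f g hgV hind
  have hJ : Ideal.span (Set.range g) = Ideal.span (Set.range f) := by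
    apply le_antisymm
    · rw [Ideal.span_le]
      rintro _ ⟨i, rfl⟩
      exact Submodule.span_le_restrictScalars ℂ S5 _ (hgV i)
    · rw [Ideal.span_le]
      rintro _ ⟨i, rfl⟩
      refine Submodule.span_le_restrictScalars ℂ S5 _ ?_
      rw [hsp]
      exact Submodule.subset_span ⟨i, rfl⟩
  have h5 := hgs 0 (by
    intro d hd p hp _
    rw [Efl, mem_ideal_span_X_image]
    intro m hm
    have hdeg := hp.degree_eq_sum_deg_support hm
    have : m ≠ 0 := by
      rintro rfl
      simp at hdeg
      omega
    obtain ⟨i, hi⟩ := Finsupp.ne_iff.1 this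
    refine ⟨i, ⟨i.val, by simp, by simp⟩, by simpa using hi⟩)
  rwa [bot_sup_eq, hJ] at h5

lemma exists_reg_mod
    (hf : ∀ i, (f i).IsHomogeneous 2) (hz : ∀ x : Fin 5 → ℂ, (∀ i, eval x (f i) = 0) → x = 0) (a : S5) (ha : a.IsHomogeneous 1) (ha0 : a ≠ 0) :
    ∃ g : Fin 4 → S5, (∀ i, g i ∈ Vsp f) ∧ RegSeq 4 (adj ⊥ a) g := by
  obtain ⟨i0, hi0⟩ : ∃ i0, coeff (Finsupp.single i0 1) a ≠ 0 := by
    obtain ⟨m, hm⟩ := ne_zero_iff.1 ha0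
    have hdeg : m.degree = 1 := by
      by_contra h
      exact hm (ha.coeff_eq_zero h)
    obtain ⟨i, hi⟩ := (Finsupp.range_single_one (σ := Fin 5)).symm ▸ (show m ∈ {d : Fin 5 →₀ ℕ | d.degree = 1} from hdeg)
    exact ⟨i, by subst hi; exact hm⟩
  let σ : Equiv.Perm (Fin 5) := Equiv.swap 4 i0
  let τ : ℕ → Fin 5 := fun j => σ (Fin.ofNat 5 j)
  have hτ4 : τ 4 = i0 := by
    simp [τ, σ]
  have hτ : ∀ j k, j ≤ k → k < 5 → τ k ∉ τ '' Set.Iio j := by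
    rintro j k hj hk ⟨i, hi, h⟩
    have := σ.injective h
    simp [Fin.ext_iff] at this hi
    omega
  obtain ⟨g, hgV, hgr, -⟩ := main_seq (Vsp f) (Vsp_hom f hf) (Vsp_prime f hz)
    (fun j => X (τ j)) (fun j => isHomogeneous_X _ _) (fun j => X_mem_m _) 4
    (fun j => adj (Efl τ j) a) (fun j => (HI_Efl _ j).adj ha)
    (fun j => by simp only [Efl_succ, adj]; rw [sup_right_comm]) (by
      intro j hj
      refine Reg.swap (span_X_reg _ _ (τ j) (hτ j j le_rfl (by omega)) (coeff_lin _)) ?_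
      rw [← Efl_succ]
      exact span_X_reg _ _ i0 (hτ4 ▸ hτ (j+1) 4 (by omega) (by omega)) hi0)
  simp only [Efl_zero] at hgr
  exact ⟨g, hgV, hgr⟩

/-- If `a² ∈ J`, then the quadrics `P` with `aP ∈ J` form a space of dimension at most 9. -/
lemma ker_dim
    (hf : ∀ i, (f i).IsHomogeneous 2) (hz : ∀ x : Fin 5 → ℂ, (∀ i, eval x (f i) = 0) → x = 0) (a : S5) (ha : a.IsHomogeneous 1) (ha0 : a ≠ 0)
    (haJ : a * a ∈ Ideal.span (Set.range f)) (K : Submodule ℂ S5)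
    (hK : ∀ P ∈ K, P.IsHomogeneous 2 ∧ a * P ∈ Ideal.span (Set.range f)) :
    Module.finrank ℂ K ≤ 9 := by
  obtain ⟨g, hgV, hgr⟩ := exists_reg_mod f hf hz a ha ha0
  have hg2 := fun i => Vsp_hom f hf _ (hgV i)
  have haV : a * a ∈ Vsp f := by
    obtain ⟨c, hc, hs⟩ := exists_decomp f hf 0 _ (ha.mul ha) haJ
    rw [← hs]
    refine Submodule.sum_mem _ fun i _ => ?_
    have : c i = C (coeff 0 (c i)) := totalDegree_eq_zero_iff_eq_C.1
      ((totalDegree_zero_iff_isHomogeneous _).2 (hc i))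
    rw [this, ← smul_eq_C_mul]
    exact Submodule.smul_mem _ _ (Submodule.subset_span ⟨i, rfl⟩)
  let G : Fin 5 → S5 := Fin.cons (a * a) g
  have hGV : ∀ i, G i ∈ Vsp f := fun i => Fin.cases haV hgV i
  have hind : LinearIndependent ℂ G := by
    rw [Fintype.linearIndependent_iff]
    intro c hc
    rw [Fin.sum_univ_succ] at hc
    simp only [G, Fin.cons_zero, Fin.cons_succ] at hc
    have h1 : ∀ i : Fin 4, c i.succ = 0 := fun i => by
      refine C_mem_of_lt one_pos ha (syz 4 _ g (HI_bot.adj ha) hg2 hgr 0 (by norm_num)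
        (fun i => C (c i.succ)) (fun i => isHomogeneous_C _ _) (mem_adj.2 ⟨-(C (c 0) * a), ?_⟩) i)
      rw [Ideal.mem_bot, ← hc]
      simp only [smul_eq_C_mul]
      ring
    have h2 : c 0 = 0 := by
      simp only [h1, zero_smul, Finset.sum_const_zero, add_zero] at hc
      rcases smul_eq_zero.1 hc with h | h
      · exact h
      · exact absurd (mul_self_eq_zero.1 h) ha0
    exact fun i => Fin.cases h2 h1 i
  have hsp := span_eq_of_indep f G hGV hind
  have hfG : ∀ i, ∃ b : Fin 5 → ℂ, ∑ k, b k • G k = f i := fun i => by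
    have : f i ∈ Submodule.span ℂ (Set.range G) := by
      rw [hsp]; exact Submodule.subset_span ⟨i, rfl⟩
    exact (Submodule.mem_span_range_iff_exists_fun ℂ).1 this
  choose b hb using hfG
  -- the 9-dimensional space
  let T : Submodule ℂ S5 := Submodule.span ℂ
    (Set.range (Sum.elim (fun i : Fin 5 => X i * a) g))
  have hT : Module.finrank ℂ T ≤ 9 := by
    refine (finrank_range_le_card _).trans ?_
    simp
  have : FiniteDimensional ℂ T := FiniteDimensional.span_of_finite ℂ (Set.finite_range _)
  refine (Submodule.finrank_mono (t := T) ?_).trans hT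
  intro P hP
  obtain ⟨hP2, hPJ⟩ := hK P hP
  obtain ⟨c, hc, hs⟩ := exists_decomp f hf 1 _ (ha.mul hP2) hPJ
  let e : Fin 5 → S5 := fun k => ∑ i, C (b i k) * c i
  have he : ∀ k, (e k).IsHomogeneous 1 := fun k =>
    IsHomogeneous.sum _ _ _ fun i _ => (hc i).C_mul _
  have hs2 : ∑ k, e k * G k = a * P := by
    rw [← hs]
    simp only [e, Finset.sum_mul]
    rw [Finset.sum_comm]
    refine Finset.sum_congr rfl fun i _ => ?_
    rw [← hb i, Finset.mul_sum]
    refine Finset.sum_congr rfl fun k _ => ?_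
    rw [smul_eq_C_mul]; ring
  rw [Fin.sum_univ_succ] at hs2
  simp only [G, Fin.cons_zero, Fin.cons_succ] at hs2
  have h1 : ∀ i : Fin 4, ∃ t : ℂ, e i.succ = C t * a := fun i => by
    have h := syz 4 _ g (HI_bot.adj ha) hg2 hgr 1 (by norm_num)
        (fun i => e i.succ) (fun i => he _) (mem_adj.2 ⟨P - e 0 * a, by
          rw [Ideal.mem_bot, sub_mul, mul_comm P, ← hs2]; ring⟩) i
    obtain ⟨s, hs⟩ := mem_adj.1 h
    rw [Ideal.mem_bot, sub_eq_zero] at hs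
    refine ⟨coeff 0 s, ?_⟩
    have h3 := congrArg (homogeneousComponent (0 + 1)) hs
    rw [hc_mul ha, homogeneousComponent_zero, homogeneousComponent_eq_self (he _)] at h3
    exact h3
  choose t ht using h1
  have hPe : P = e 0 * a + ∑ i, t i • g i := by
    apply mul_left_cancel₀ ha0
    have h4 : ∀ i : Fin 4, a * (t i • g i) = e i.succ * g i := fun i => by
      rw [ht, smul_eq_C_mul]; ring
    rw [← hs2, mul_add, Finset.mul_sum, Finset.sum_congr rfl fun i _ => h4 i]
    rw [show a * (e 0 * a) = e 0 * (a * a) by ring]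
  rw [hPe]
  refine Submodule.add_mem _ ?_ (Submodule.sum_mem _ fun i _ => Submodule.smul_mem _ _
    (Submodule.subset_span ⟨Sum.inr i, rfl⟩))
  have he0 : e 0 ∈ Submodule.span ℂ (Set.range (X : Fin 5 → S5)) := by
    rw [← homogeneousSubmodule_one_eq_span_X]; exact he 0
  obtain ⟨u, hu⟩ := (Submodule.mem_span_range_iff_exists_fun ℂ).1 he0
  rw [← hu, Finset.sum_mul]
  refine Submodule.sum_mem _ fun i _ => ?_
  rw [smul_mul_assoc]
  exact Submodule.smul_mem _ _ (Submodule.subset_span ⟨Sum.inl i, rfl⟩)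

end fixedV

end ColonThree
namespace ColonThree

lemma lin_indep_iff (J : Ideal S5) (Q : S5) :
    (∀ a ∈ homogeneousSubmodule (Fin 5) ℂ 1, a * Q ∈ J → a = 0) ↔
      LinearIndependent ℂ (fun j : Fin 5 => (J.restrictScalars ℂ).mkQ (X j * Q)) := by
  have hsum : ∀ c : Fin 5 → ℂ, ∑ j, c j • (J.restrictScalars ℂ).mkQ (X j * Q) =
      (J.restrictScalars ℂ).mkQ ((∑ j, c j • X j) * Q) := by
    intro c
    rw [Finset.sum_mul, map_sum]
    refine Finset.sum_congr rfl fun j _ => ?_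
    rw [smul_mul_assoc, map_smul]
  have hmk : ∀ p : S5, (J.restrictScalars ℂ).mkQ p = 0 ↔ p ∈ J := by
    intro p
    rw [Submodule.mkQ_apply, Submodule.Quotient.mk_eq_zero]; rfl
  rw [Fintype.linearIndependent_iff]
  constructor
  · intro h c hc j
    rw [hsum, hmk] at hc
    have h0 := h _ (Submodule.sum_mem _ fun j _ => Submodule.smul_mem _ _
      (isHomogeneous_X ℂ j)) hc
    have hX : LinearIndependent ℂ (X : Fin 5 → S5) := linearIndependent_X _ _
    exact Fintype.linearIndependent_iff.1 hX c h0 j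
  · intro h a ha haJ
    rw [homogeneousSubmodule_one_eq_span_X] at ha
    obtain ⟨c, rfl⟩ := (Submodule.mem_span_range_iff_exists_fun ℂ).1 ha
    have := h c (by rw [hsum, hmk]; exact haJ)
    simp [this]

/-- exponents of quadratic monomials -/
noncomputable abbrev mon2 : Finset (Fin 5 →₀ ℕ) := Finset.finsuppAntidiag Finset.univ 2

lemma mem_mon2 (m : Fin 5 →₀ ℕ) : m ∈ mon2 ↔ m.degree = 2 := by
  simp [mon2, Finset.mem_finsuppAntidiag, Finsupp.degree_eq_sum]

lemma sum_mon2 (Q : S5) (hQ : Q.IsHomogeneous 2) :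
    Q = ∑ m ∈ mon2, coeff m Q • monomial m (1 : ℂ) := by
  conv_lhs => rw [Q.as_sum]
  refine (Finset.sum_subset (fun m hm => ?_) fun m _ hm => ?_).trans
    (Finset.sum_congr rfl fun m _ => ?_)
  · rw [mem_mon2]
    by_contra h
    exact (mem_support_iff.1 hm) (hQ.coeff_eq_zero h)
  · rw [notMem_support_iff.1 hm]; simp
  · simp [smul_monomial]

lemma zariski (J : Ideal S5) :
    ∃ (ι : Type) (P : ι → MvPolynomial ((Fin 5) →₀ ℕ) ℂ),
      ∀ Q ∈ homogeneousSubmodule (Fin 5) ℂ 2,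
          ((∀ a ∈ homogeneousSubmodule (Fin 5) ℂ 1, a * Q ∈ J → a = 0) ↔
            ¬ ∀ i, eval (fun m => coeff m Q) (P i) = 0) := by
  classical
  let q := (J.restrictScalars ℂ).mkQ
  let M : ((S5 ⧸ J.restrictScalars ℂ) →ₗ[ℂ] (Fin 5 → ℂ)) →
      Matrix (Fin 5) (Fin 5) (MvPolynomial ((Fin 5) →₀ ℕ) ℂ) := fun L =>
    Matrix.of fun i j => ∑ m ∈ mon2, C (L (q (X j * monomial m 1)) i) * X m
  refine ⟨(S5 ⧸ J.restrictScalars ℂ) →ₗ[ℂ] (Fin 5 → ℂ), fun L => (M L).det, fun Q hQ => ?_⟩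
  have hM : ∀ L, eval (fun m => coeff m Q) (M L).det =
      (Matrix.of fun i j => L (q (X j * Q)) i).det := by
    intro L
    rw [RingHom.map_det]
    congr 1
    ext i j
    simp only [M, RingHom.mapMatrix_apply, Matrix.map_apply, Matrix.of_apply, map_sum, map_mul,
      eval_C, eval_X]
    conv_rhs => rw [sum_mon2 Q hQ]
    simp only [Finset.mul_sum, map_sum, Finset.sum_apply, mul_smul_comm, map_smul, Pi.smul_apply,
      smul_eq_mul]
    exact Finset.sum_congr rfl fun m _ => mul_comm _ _
  rw [lin_indep_iff]
  push Not
  constructor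
  · intro h
    obtain ⟨L, hL⟩ := exists_dual h
    refine ⟨L, ?_⟩
    rw [hM]
    have : (Matrix.of fun i j => L (q (X j * Q)) i) = 1 := by
      ext i j
      simp only [Matrix.of_apply, q]
      rw [hL]
      simp [Matrix.one_apply, Pi.single_apply]
    rw [this]
    simp
  · rintro ⟨L, hL⟩
    rw [hM] at hL
    exact indep_of_det L hL

lemma finrank_S2 : 15 ≤ Module.finrank ℂ (homogeneousSubmodule (Fin 5) ℂ 2) := by
  classical
  have : FiniteDimensional ℂ (homogeneousSubmodule (Fin 5) ℂ 2) :=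
    Module.Finite.iff_fg.2 (homogeneousSubmodule_fg _ _ _)
  have hli : LinearIndependent ℂ (fun m : mon2 => (monomial (m : Fin 5 →₀ ℕ) (1 : ℂ) : S5)) := by
    have h := (basisMonomials (Fin 5) ℂ).linearIndependent.comp
      (fun m : mon2 => (m : Fin 5 →₀ ℕ)) Subtype.val_injective
    simpa [Function.comp_def] using h
  have hli2 : LinearIndependent ℂ (fun m : mon2 =>
      (⟨monomial (m : Fin 5 →₀ ℕ) (1 : ℂ), isHomogeneous_monomial _ ((mem_mon2 _).1 m.2)⟩ :
        homogeneousSubmodule (Fin 5) ℂ 2)) :=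
    LinearIndependent.of_comp (Submodule.subtype _) hli
  have h := hli2.fintype_card_le_finrank
  rw [Fintype.card_coe, Finset.card_finsuppAntidiag_nat_eq_choose] at h
  simpa [Nat.choose] using h

lemma finrank_S1 : Module.finrank ℂ (homogeneousSubmodule (Fin 5) ℂ 1) ≤ 5 := by
  rw [homogeneousSubmodule_one_eq_span_X]
  exact finrank_range_le_card (R := ℂ) (X : Fin 5 → S5)

lemma exists_Q (f : Fin 5 → S5) (hf : ∀ i, (f i).IsHomogeneous 2)
    (hz : ∀ x : Fin 5 → ℂ, (∀ i, eval x (f i) = 0) → x = 0) :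
    ∃ Q ∈ homogeneousSubmodule (Fin 5) ℂ 2,
      ∀ a ∈ homogeneousSubmodule (Fin 5) ℂ 1, a * Q ∈ Ideal.span (Set.range f) → a = 0 := by
  set J := Ideal.span (Set.range f) with hJ
  have : FiniteDimensional ℂ (homogeneousSubmodule (Fin 5) ℂ 2) :=
    Module.Finite.iff_fg.2 (homogeneousSubmodule_fg _ _ _)
  have : FiniteDimensional ℂ (homogeneousSubmodule (Fin 5) ℂ 1) :=
    Module.Finite.iff_fg.2 (homogeneousSubmodule_fg _ _ _)
  let q := (J.restrictScalars ℂ).mkQ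
  have hmk : ∀ p : S5, q p = 0 ↔ p ∈ J := by
    intro p
    rw [Submodule.mkQ_apply, Submodule.Quotient.mk_eq_zero]; rfl
  let φ := ((LinearMap.mul ℂ S5).compr₂ q).domRestrict₁₂ (homogeneousSubmodule (Fin 5) ℂ 2)
    (homogeneousSubmodule (Fin 5) ℂ 1)
  have hφ : ∀ Q a, φ Q a = q ((Q : S5) * (a : S5)) := fun _ _ => rfl
  obtain ⟨Q, hQ⟩ := exists_max_rank φ
  refine ⟨Q, Q.2, fun a ha haQ => ?_⟩
  by_contra ha0
  have ha1 : a.IsHomogeneous 1 := ha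
  have hφa : φ Q ⟨a, ha⟩ = 0 := by
    rw [hφ, hmk, mul_comm]; exact haQ
  have hrange := hQ ⟨a, ha⟩ hφa
  -- `a² S₂ ⊆ J`
  have h2 : ∀ P : S5, P.IsHomogeneous 2 → a * a * P ∈ J := by
    intro P hP
    obtain ⟨b, hb⟩ := hrange ⟨P, hP⟩
    rw [hφ, hφ, ← sub_eq_zero, ← map_sub, hmk] at hb
    have h3 := J.sub_mem (J.mul_mem_left (b : S5) haQ) (J.mul_mem_left a hb)
    convert h3 using 1
    ring
  have hsoc := soc_J f hf hz
  have haa : a * a ∈ J := by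
    refine hsoc 2 (by norm_num) _ (ha1.mul ha1) fun i => ?_
    refine hsoc 3 (by norm_num) _ ((isHomogeneous_X ℂ i).mul (ha1.mul ha1)) fun j => ?_
    have := h2 (X j * X i) ((isHomogeneous_X ℂ j).mul (isHomogeneous_X ℂ i))
    convert this using 1
    ring
  let ψ : homogeneousSubmodule (Fin 5) ℂ 2 →ₗ[ℂ] _ := φ.flip ⟨a, ha⟩
  have hψ : LinearMap.range ψ ≤ LinearMap.range (φ Q) := by
    rintro _ ⟨P, rfl⟩
    exact hrange P
  have hr1 : Module.finrank ℂ (LinearMap.range ψ) ≤ Module.finrank ℂ (LinearMap.range (φ Q)) :=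
    Submodule.finrank_mono hψ
  have hr2 := (φ Q).finrank_range_add_finrank_ker
  have hr3 := ψ.finrank_range_add_finrank_ker
  have hk1 : 0 < Module.finrank ℂ (LinearMap.ker (φ Q)) := by
    have : Nontrivial (LinearMap.ker (φ Q)) :=
      ⟨⟨⟨⟨a, ha⟩, hφa⟩, 0, fun h => ha0 (by simpa using congrArg (fun z => ((z : homogeneousSubmodule (Fin 5) ℂ 1) : S5)) (congrArg Subtype.val h))⟩⟩
    exact Module.finrank_pos (R := ℂ) (M := LinearMap.ker (φ Q))
  have hk2 : Module.finrank ℂ (LinearMap.ker ψ) ≤ 9 := by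
    have := ker_dim f hf hz a ha1 ha0 haa ((LinearMap.ker ψ).map (Submodule.subtype _)) (by
      rintro _ ⟨P, hP, rfl⟩
      refine ⟨P.2, ?_⟩
      have hP' : q ((P : S5) * a) = 0 := hP
      rw [hmk, mul_comm] at hP'
      exact hP')
    rwa [Submodule.finrank_map_subtype_eq] at this
  have h5 := hr2.trans_le finrank_S1
  have h15 := finrank_S2.trans_eq hr3.symm
  omega

end ColonThree

/-- For every smooth cubic `F`, the set of quadrics `Q` with `(J_{F,3}:Q) = 0`
(equivalently, with `a ↦ aQ mod J_{F,3}` injective on `S₁`) is a nonempty Zariski open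
subset of `S₂`: its complement inside `S₂` is the common zero locus of a family of
polynomial functions in the coefficient coordinates of `Q`. -/
theorem colon_three_zero_nonempty_zariski_open :
    ∀ F ∈ homogeneousSubmodule (Fin 5) ℂ 3, SmoothForm F →
      ∃ (ι : Type) (P : ι → MvPolynomial ((Fin 5) →₀ ℕ) ℂ),
        (∀ Q ∈ homogeneousSubmodule (Fin 5) ℂ 2,
          ((∀ a ∈ homogeneousSubmodule (Fin 5) ℂ 1, a * Q ∈ Jpart F 3 → a = 0) ↔
            ¬ ∀ i, eval (fun m => coeff m Q) (P i) = 0)) ∧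
        (∃ Q₀ ∈ homogeneousSubmodule (Fin 5) ℂ 2,
          ∀ a ∈ homogeneousSubmodule (Fin 5) ℂ 1, a * Q₀ ∈ Jpart F 3 → a = 0) := by
  intro F hF hsm
  have hF3 : F.IsHomogeneous 3 := hF
  have hJ : ∀ Q ∈ homogeneousSubmodule (Fin 5) ℂ 2,
      ((∀ a ∈ homogeneousSubmodule (Fin 5) ℂ 1, a * Q ∈ Jpart F 3 → a = 0) ↔
        (∀ a ∈ homogeneousSubmodule (Fin 5) ℂ 1, a * Q ∈ jacobianIdeal F → a = 0)) := by
    intro Q hQ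
    refine forall₂_congr fun a ha => ?_
    have h3 : a * Q ∈ homogeneousSubmodule (Fin 5) ℂ 3 :=
      IsHomogeneous.mul (m := 1) (n := 2) ha hQ
    exact ⟨fun h h' => h ⟨h', h3⟩, fun h h' => h h'.1⟩
  obtain ⟨ι, P, hP⟩ := ColonThree.zariski (jacobianIdeal F)
  refine ⟨ι, P, fun Q hQ => (hJ Q hQ).trans (hP Q hQ), ?_⟩
  obtain ⟨Q, hQ, h⟩ := ColonThree.exists_Q (fun i => pderiv i F) (fun i => hF3.pderiv) hsm
  exact ⟨Q, hQ, (hJ Q hQ).2 h⟩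
end

section
/- For every smooth cubic form F ∈ ℂ[x₀,…,x₄], the quotient vector space S_3/J_{F,3} has dimension 10 over ℂ; equivalently, dim (J_{F,3})^⊥ = 10. -/
open MvPolynomial

/-- The degree-`k` graded piece `M(F)_k = S_k/J_{F,k}` of the Milnor algebra, realized as
the image of `S_k` in `S/J_F`. -/
noncomputable def milnorPiece {N : ℕ} (F : MvPolynomial (Fin N) ℂ) (k : ℕ) :
    Submodule ℂ
      (MvPolynomial (Fin N) ℂ ⧸ Submodule.restrictScalars ℂ (jacobianIdeal F)) :=
  Submodule.map (Submodule.mkQ _) (homogeneousSubmodule (Fin N) ℂ k)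

/-- Exactness of the Koszul complex (in terms of alternating maps) in degree `i + 1`. -/
def KoszulExact {R V : Type} [CommRing R] [AddCommGroup V] [Module R V] (q : V)
    (M : Type) [AddCommGroup M] [Module R M] (i : ℕ) : Prop :=
  ∀ c : V [⋀^Fin (i + 1)]→ₗ[R] M, c.curryLeft q = 0 →
    ∃ e : V [⋀^Fin (i + 2)]→ₗ[R] M, e.curryLeft q = c

lemma koszul_homotopy {R V M : Type} [CommRing R] [AddCommGroup V] [Module R V] (q : V)
    [AddCommGroup M] [Module R M] (a : V →ₗ[R] R) {n : ℕ} (c : V [⋀^Fin (n + 1)]→ₗ[R] M)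
    (hc : c.curryLeft q = 0) :
    (AlternatingMap.alternatizeUncurryFin (a.smulRight c)).curryLeft q = a q • c := by
  ext v
  rw [AlternatingMap.curryLeft_apply_apply, AlternatingMap.alternatizeUncurryFin_apply,
    Fin.sum_univ_succ, Finset.sum_eq_zero]
  · simp [Matrix.vecCons, Fin.removeNth_zero]
  · intro j _
    have : Fin.removeNth j.succ (Matrix.vecCons q v) = Matrix.vecCons q (Fin.removeNth j v) := by
      funext k
      refine Fin.cases ?_ (fun k => ?_) k
      · simp [Fin.removeNth]
      · simp [Fin.removeNth]
    have h2 := DFunLike.congr_fun hc (Fin.removeNth j v)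
    simp only [AlternatingMap.curryLeft_apply_apply, AlternatingMap.zero_apply] at h2
    simp only [LinearMap.smulRight_apply, AlternatingMap.smul_apply]
    rw [this]
    erw [h2]
    simp

lemma alternating_lift {R V M N : Type} [CommRing R] [AddCommGroup V] [Module R V]
    [Module.Free R V] [AddCommGroup M] [Module R M] [AddCommGroup N] [Module R N]
    (p : M →ₗ[R] N) (hp : Function.Surjective p) {n : ℕ} (c : V [⋀^Fin n]→ₗ[R] N) :
    ∃ c' : V [⋀^Fin n]→ₗ[R] M, p.compAlternatingMap c' = c := by
  obtain ⟨g, hg⟩ := Module.projective_lifting_property p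
    (exteriorPower.alternatingMapLinearEquiv c) hp
  refine ⟨exteriorPower.alternatingMapLinearEquiv.symm g, ?_⟩
  apply exteriorPower.alternatingMapLinearEquiv.injective
  rw [← hg]
  ext v
  simp

lemma koszul_step {R V M : Type} [CommRing R] [AddCommGroup V] [Module R V] [Module.Free R V]
    (q : V) [AddCommGroup M] [Module R M] (a : V →ₗ[R] R) (z : R) (ha : a q = z)
    (hz : IsSMulRegular M z) (i : ℕ) (h : KoszulExact (R := R) q (QuotSMulTop z M) (i + 1)) :
    KoszulExact (R := R) q M i := by
  intro c hc
  set b := AlternatingMap.alternatizeUncurryFin (a.smulRight c) with hb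
  have hdb : b.curryLeft q = z • c := by rw [hb, koszul_homotopy q a c hc, ha]
  let p : M →ₗ[R] QuotSMulTop z M := Submodule.mkQ _
  have hp : Function.Surjective p := Submodule.mkQ_surjective _
  have hpz : ∀ m, p m = 0 ↔ ∃ y, z • y = m := by
    intro m
    simp only [p, Submodule.mkQ_apply, Submodule.Quotient.mk_eq_zero,
      Submodule.mem_smul_pointwise_iff_exists]
    simp
  obtain ⟨e, he⟩ := h (p.compAlternatingMap b) (by
    rw [AlternatingMap.curryLeft_compAlternatingMap, hdb]
    ext v
    simpa using (hpz _).2 ⟨c v, rfl⟩)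
  obtain ⟨e', rfl⟩ := alternating_lift p hp e
  -- `b - d e'` takes values in `z M`
  let mz : M →ₗ[R] M := LinearMap.lsmul R M z
  have hg : ∀ v, (b - e'.curryLeft q) v ∈ LinearMap.range mz := by
    intro v
    obtain ⟨y, hy⟩ := (hpz ((b - e'.curryLeft q) v)).1 (by
      have := DFunLike.congr_fun he v
      simp only [AlternatingMap.curryLeft_compAlternatingMap,
        LinearMap.compAlternatingMap_apply] at this
      rw [AlternatingMap.sub_apply, map_sub, this, sub_self])
    exact ⟨y, hy⟩
  let g : V [⋀^Fin (i + 2)]→ₗ[R] LinearMap.range mz :=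
    (b - e'.curryLeft q).codRestrict _ hg
  obtain ⟨f, hf⟩ := alternating_lift mz.rangeRestrict mz.surjective_rangeRestrict g
  have hzf : z • f = b - e'.curryLeft q := by
    ext v
    have := congrArg Subtype.val (DFunLike.congr_fun hf v)
    exact this
  refine ⟨f, ?_⟩
  ext v
  apply hz
  have h1 : (z • f).curryLeft q = z • c := by
    rw [hzf, ← hdb]
    have := AlternatingMap.curryLeft_same e' q
    ext v
    have h3 := DFunLike.congr_fun this v
    simp only [AlternatingMap.curryLeft_apply_apply] at h3
    simp [h3]
  exact DFunLike.congr_fun h1 v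

lemma koszul_list {R V : Type} [CommRing R] [AddCommGroup V] [Module R V] [Module.Free R V]
    (q : V) (rs : List R) : ∀ (M : Type) [AddCommGroup M] [Module R M] (i : ℕ)
    (_ : RingTheory.Sequence.IsWeaklyRegular M rs)
    (_ : ∀ r ∈ rs, ∃ a : V →ₗ[R] R, a q = r)
    (_ : ∀ N : Type, ∀ [AddCommGroup N], ∀ [Module R N], KoszulExact (R := R) q N (i + rs.length)),
    KoszulExact (R := R) q M i := by
  induction rs with
  | nil => intro M _ _ i _ _ h; exact h M
  | cons r rs ih =>
    intro M _ _ i hr ha h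
    rw [RingTheory.Sequence.isWeaklyRegular_cons_iff] at hr
    obtain ⟨a, har⟩ := ha r (by simp)
    refine koszul_step q a r har hr.1 i (ih _ _ hr.2 (fun r hr => ha r (by simp [hr])) ?_)
    intro N _ _
    have := h N
    rwa [List.length_cons, ← add_assoc, add_right_comm] at this

lemma koszul_top {R : Type} [CommRing R] (n : ℕ) (q : Fin n → R)
    (N : Type) [AddCommGroup N] [Module R N] : KoszulExact (R := R) q N n := by
  intro c _
  refine ⟨0, ?_⟩
  refine (Pi.basisFun R (Fin n)).ext_alternating fun v hv => ?_
  have := Fintype.card_le_of_injective v hv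
  simp at this

lemma weaklyRegular_X_pow (n N : ℕ) :
    RingTheory.Sequence.IsWeaklyRegular (MvPolynomial (Fin n) ℂ)
      (List.ofFn fun i : Fin n => (X i ^ N : MvPolynomial (Fin n) ℂ)) := by
  refine ⟨fun i hi => ?_⟩
  have hi' : i < n := by simpa using hi
  rw [isSMulRegular_quotient_iff_mem_of_smul_mem]
  have hI : Ideal.ofList ((List.ofFn fun i : Fin n => (X i ^ N : MvPolynomial (Fin n) ℂ)).take i)
      = Ideal.span ((fun s => monomial s (1 : ℂ)) ''
          {s | ∃ j : Fin n, j.1 < i ∧ s = Finsupp.single j N}) := by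
    rw [Ideal.ofList]
    congr 1
    ext f
    simp only [Set.mem_ofPred_eq, Set.mem_image, List.mem_take_iff_getElem]
    constructor
    · rintro ⟨j, hj, rfl⟩
      have hj2 : j < i ∧ j < n := by simpa using hj
      exact ⟨_, ⟨⟨j, hj2.2⟩, hj2.1, rfl⟩, by simp [X_pow_eq_monomial]⟩
    · rintro ⟨s, ⟨j, hj, rfl⟩, rfl⟩
      exact ⟨j, by simp [hj], by simp [X_pow_eq_monomial]⟩
  intro f hf
  rw [smul_eq_mul, Ideal.mul_top, hI, mem_ideal_span_monomial_image] at *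
  intro xi hxi
  obtain ⟨s, ⟨j, hj, rfl⟩, hs⟩ := hf (xi + Finsupp.single ⟨i, hi'⟩ N) (by
    rw [mem_support_iff, smul_eq_mul, List.getElem_ofFn, X_pow_eq_monomial, add_comm,
      coeff_monomial_mul]
    simpa using hxi)
  refine ⟨_, ⟨j, hj, rfl⟩, ?_⟩
  rw [Finsupp.single_le_iff] at hs ⊢
  have : (⟨i, hi'⟩ : Fin n) ≠ j := by rintro rfl; simp at hj
  simpa [Finsupp.single_apply, this] using hs

/-- Syzygies of `n` polynomials in `n` variables with only trivial common zero lie in the ideal. -/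
lemma syzygy_mem (n : ℕ) (q l : Fin n → MvPolynomial (Fin n) ℂ)
    (hq : ∀ x : Fin n → ℂ, (∀ i, eval x (q i) = 0) → x = 0)
    (hl : ∑ j, l j * q j = 0) (j : Fin n) : l j ∈ Ideal.span (Set.range q) := by
  have hrad : ∀ i : Fin n, X i ∈ (Ideal.span (Set.range q)).radical := by
    intro i
    rw [← vanishingIdeal_zeroLocus_eq_radical (K := ℂ), mem_vanishingIdeal_iff]
    intro x hx
    rw [zeroLocus_span] at hx
    have := hq x (fun i => by simpa using hx (q i) ⟨i, rfl⟩)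
    simp [this]
  choose m hm using hrad
  let N := ∑ i, m i
  have hN : ∀ i, (X i : MvPolynomial (Fin n) ℂ) ^ N ∈ Ideal.span (Set.range q) := fun i =>
    Ideal.pow_mem_of_pow_mem _ (hm i) (Finset.single_le_sum (fun _ _ => Nat.zero_le _)
      (Finset.mem_univ i))
  have hE : KoszulExact (R := MvPolynomial (Fin n) ℂ) q (MvPolynomial (Fin n) ℂ) 0 := by
    refine koszul_list q _ _ 0 (weaklyRegular_X_pow n N) ?_ ?_
    · intro r hr
      rw [List.mem_ofFn] at hr
      obtain ⟨i, rfl⟩ := hr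
      obtain ⟨a, ha⟩ := (Ideal.mem_span_range_iff_exists_fun).1 (hN i)
      exact ⟨Fintype.linearCombination _ a, by
        rw [← ha, Fintype.linearCombination_apply]
        exact Finset.sum_congr rfl fun _ _ => by rw [smul_eq_mul, mul_comm]⟩
    · intro M _ _
      have := koszul_top n q M
      simpa using this
  let L : (Fin n → MvPolynomial (Fin n) ℂ) →ₗ[MvPolynomial (Fin n) ℂ] MvPolynomial (Fin n) ℂ :=
    Fintype.linearCombination _ l
  have hL : L q = 0 := by
    rw [← hl]
    simp only [L, Fintype.linearCombination_apply, smul_eq_mul]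
    exact Finset.sum_congr rfl fun _ _ => mul_comm _ _
  obtain ⟨e, he⟩ := hE (AlternatingMap.ofSubsingleton _ _ _ (0 : Fin 1) L) (by
    ext v
    simp [hL])
  have h1 := DFunLike.congr_fun he (fun _ => Pi.single j 1)
  have h2 : L (Pi.single j 1) = l j := by
    simp [L]
  rw [AlternatingMap.ofSubsingleton_apply_apply, h2] at h1
  rw [← h1]
  have h3 : q = ∑ k, q k • (Pi.single k 1 : Fin n → MvPolynomial (Fin n) ℂ) := by
    ext1 k
    simp [Finset.sum_apply, Pi.single_apply]
  have h4 : e.curryLeft q = ∑ k, q k • e.curryLeft (Pi.single k 1) := by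
    conv_lhs => rw [h3]
    simp [map_sum]
  let ev : ((Fin n → MvPolynomial (Fin n) ℂ) [⋀^Fin (0 + 1)]→ₗ[MvPolynomial (Fin n) ℂ]
      MvPolynomial (Fin n) ℂ) →+ MvPolynomial (Fin n) ℂ :=
    { toFun := fun f => f fun _ => Pi.single j 1
      map_zero' := rfl
      map_add' := fun _ _ => rfl }
  rw [h4]
  change ev (∑ k, q k • e.curryLeft (Pi.single k 1)) ∈ _
  rw [map_sum]
  refine Ideal.sum_mem _ fun k _ => ?_
  change q k * _ ∈ _
  exact Ideal.mul_mem_right _ _ (Ideal.subset_span ⟨k, rfl⟩)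

lemma homogeneousComponent_mul_of_isHomogeneous {n m : ℕ} (k : ℕ) (a f : MvPolynomial (Fin n) ℂ)
    (hf : f.IsHomogeneous m) :
    homogeneousComponent (k + m) (a * f) = homogeneousComponent k a * f := by
  conv_lhs => rw [← sum_homogeneousComponent a, Finset.sum_mul, map_sum]
  have h : ∀ i, homogeneousComponent (k + m) (homogeneousComponent i a * f) =
      if i = k then homogeneousComponent k a * f else 0 := by
    intro i
    rw [homogeneousComponent_of_mem (m := k + m) (n := i + m)
      ((homogeneousComponent_isHomogeneous i a).mul hf)]
    by_cases hik : i = k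
    · simp [hik]
    · simp [hik, Ne.symm hik]
  rw [Finset.sum_congr rfl fun i _ => h i, Finset.sum_ite_eq']
  split_ifs with hk
  · rfl
  · rw [homogeneousComponent_eq_zero _ _ (by simpa using hk), zero_mul]

lemma finrank_homogeneousSubmodule (n k : ℕ) :
    Module.finrank ℂ (homogeneousSubmodule (Fin n) ℂ k) = (n + k - 1).choose k := by
  have hs : {d : Fin n →₀ ℕ | d.degree = k} =
      ((Finset.univ : Finset (Fin n)).finsuppAntidiag k : Set (Fin n →₀ ℕ)) := by
    ext d
    simp [Finset.mem_finsuppAntidiag, Finsupp.degree_eq_sum]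
  rw [homogeneousSubmodule_eq_finsupp_supported, hs,
    (AddMonoidAlgebra.supportedEquivFinsupp _).finrank_eq, Module.finrank_finsupp_self]
  simp [Finset.card_finsuppAntidiag_nat_eq_choose]

instance finite_homogeneousSubmodule (n k : ℕ) :
    Module.Finite ℂ (homogeneousSubmodule (Fin n) ℂ k) := by
  have hs : {d : Fin n →₀ ℕ | d.degree = k} =
      ((Finset.univ : Finset (Fin n)).finsuppAntidiag k : Set (Fin n →₀ ℕ)) := by
    ext d
    simp [Finset.mem_finsuppAntidiag, Finsupp.degree_eq_sum]
  rw [homogeneousSubmodule_eq_finsupp_supported, hs]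
  exact Module.Finite.equiv (AddMonoidAlgebra.supportedEquivFinsupp _).symm

/-- The map `(l_j) ↦ ∑ l_j ∂_j F` from tuples of linear forms to cubic forms. -/
noncomputable def syzMap (F : MvPolynomial (Fin 5) ℂ) (hF : F.IsHomogeneous 3) :
    (Fin 5 → homogeneousSubmodule (Fin 5) ℂ 1) →ₗ[ℂ] homogeneousSubmodule (Fin 5) ℂ 3 where
  toFun l := ⟨∑ j, (l j : MvPolynomial (Fin 5) ℂ) * pderiv j F,
    Submodule.sum_mem _ fun j _ => (IsHomogeneous.mul (l j).2 hF.pderiv :)⟩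
  map_add' l l' := by
    ext1
    simp [add_mul, Finset.sum_add_distrib]
  map_smul' r l := by
    ext1
    simp [Finset.smul_sum]

/-- For a smooth cubic form `F` in five variables, `dim S₃/J_{F,3} = 10`. -/
theorem milnor_three_dim_ten :
    ∀ F ∈ homogeneousSubmodule (Fin 5) ℂ 3, SmoothForm F →
      Module.finrank ℂ (milnorPiece F 3) = 10 := by
  intro F hF hS
  have hF3 : F.IsHomogeneous 3 := hF
  have hd : ∀ j, (pderiv j F).IsHomogeneous 2 := fun j => hF3.pderiv
  have hinj : Function.Injective (syzMap F hF3) := by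
    rw [injective_iff_map_eq_zero]
    intro l hl
    have hl0 : ∑ j, (l j : MvPolynomial (Fin 5) ℂ) * pderiv j F = 0 := congrArg Subtype.val hl
    funext j
    have hmem := syzygy_mem 5 (fun i => pderiv i F) (fun j => (l j).1) hS hl0 j
    have hle : Ideal.span (Set.range fun i => pderiv i F) ≤ idealOfVars (Fin 5) ℂ ^ 2 := by
      rw [Ideal.span_le]
      rintro _ ⟨i, rfl⟩
      refine (mem_pow_idealOfVars_iff' _ _).2 fun x hx => ?_
      exact (hd i).coeff_eq_zero hx.ne
    have h2 := (mem_pow_idealOfVars_iff' _ _).1 (hle hmem)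
    ext1
    ext x
    by_cases hx : x.degree = 1
    · exact h2 x (by omega)
    · exact IsHomogeneous.coeff_eq_zero (l j).2 hx
  set π := (Submodule.mkQ (Submodule.restrictScalars ℂ (jacobianIdeal F))).domRestrict
    (homogeneousSubmodule (Fin 5) ℂ 3) with hπ
  have hker : LinearMap.ker π = LinearMap.range (syzMap F hF3) := by
    ext p
    rw [LinearMap.mem_ker, hπ, LinearMap.domRestrict_apply, Submodule.mkQ_apply,
      Submodule.Quotient.mk_eq_zero, Submodule.restrictScalars_mem, jacobianIdeal,
      Ideal.mem_span_range_iff_exists_fun, LinearMap.mem_range]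
    constructor
    · rintro ⟨a, ha⟩
      refine ⟨fun j => ⟨homogeneousComponent 1 (a j), homogeneousComponent_mem _ _⟩, ?_⟩
      ext1
      change ∑ j, homogeneousComponent 1 (a j) * pderiv j F = p.1
      rw [← homogeneousComponent_eq_self (n := 3) p.2, ← ha, map_sum]
      exact Finset.sum_congr rfl fun j _ =>
        (homogeneousComponent_mul_of_isHomogeneous 1 _ _ (hd j)).symm
    · rintro ⟨l, rfl⟩
      exact ⟨fun j => (l j).1, rfl⟩
  have hrange : milnorPiece F 3 = LinearMap.range π := by
    rw [hπ, LinearMap.range_domRestrict, milnorPiece]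
  have h1 := LinearMap.finrank_range_add_finrank_ker π
  rw [hker, LinearMap.finrank_range_of_inj hinj, Module.finrank_pi_fintype] at h1
  simp only [finrank_homogeneousSubmodule] at h1
  rw [hrange]
  norm_num [Nat.choose] at h1
  omega
end

section
/- Let n ≥ 2 and Q = Σ_{0 ≤ i < j < k ≤ n} x_i x_j x_k ∈ ℂ[x₀,…,x_n]. Then the set of nonzero common zeros in ℂ^{n+1} of the partial derivatives ∂Q/∂x₀,…,∂Q/∂x_n is exactly the union of the coordinate lines ℂ*·e₀, …, ℂ*·e_n; that is, the singular locus of the hypersurface {Q=0} ⊂ ℙⁿ consists precisely of the n+1 coordinate points [e₀],…,[e_n]. -/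
open MvPolynomial

/-- The cubic `Q = Σ_{0 ≤ i < j < k ≤ n} x_i x_j x_k` in `n+1` variables. -/
noncomputable def elemCubic (n : ℕ) : MvPolynomial (Fin (n + 1)) ℂ :=
  ∑ s ∈ Finset.powersetCard 3 Finset.univ, ∏ i ∈ s, X i

lemma elemCubic_newton (n : ℕ) :
    6 * elemCubic n = (∑ i, X i) ^ 3 - 3 * (∑ i, X i) * (∑ i, X i ^ 2) + 2 * ∑ i, X i ^ 3 := by
  have h3 := mul_esymm_eq_sum (Fin (n + 1)) ℂ 3
  have h2 := mul_esymm_eq_sum (Fin (n + 1)) ℂ 2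
  have f3 : (Finset.HasAntidiagonal.antidiagonal 3).filter (fun a : ℕ × ℕ => a.1 < 3) = {(0,3),(1,2),(2,1)} := by
    decide
  have f2 : (Finset.HasAntidiagonal.antidiagonal 2).filter (fun a : ℕ × ℕ => a.1 < 2) = {(0,2),(1,1)} := by
    decide
  rw [f3] at h3
  rw [f2] at h2
  have h1 : esymm (Fin (n + 1)) ℂ 1 = ∑ i, X i := by simp
  have e : elemCubic n = esymm (Fin (n + 1)) ℂ 3 := rfl
  simp [psum, -esymm_one] at h3 h2
  rw [h1] at h3 h2
  rw [e]
  linear_combination 2 * h3 + (∑ i, X i) * h2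

lemma elemCubic_pderiv (n : ℕ) (p : Fin (n + 1) → ℂ) (i : Fin (n + 1)) :
    2 * eval p (pderiv i (elemCubic n)) =
      (∑ j, p j) ^ 2 - (∑ j, p j ^ 2) - 2 * (∑ j, p j) * p i + 2 * p i ^ 2 := by
  have h := congrArg (fun q => eval p (pderiv i q)) (elemCubic_newton n)
  have c6 : (6 : MvPolynomial (Fin (n + 1)) ℂ) = C 6 := (map_ofNat C 6).symm
  have c3 : (3 : MvPolynomial (Fin (n + 1)) ℂ) = C 3 := (map_ofNat C 3).symm
  have c2 : (2 : MvPolynomial (Fin (n + 1)) ℂ) = C 2 := (map_ofNat C 2).symm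
  rw [c6, c3, c2] at h
  simp only [Derivation.leibniz, Derivation.leibniz_pow, map_add, map_sub, map_sum, pderiv_X,
    pderiv_C, smul_eq_mul, map_mul, map_pow, eval_X, eval_C, nsmul_eq_mul, map_natCast,
    Pi.single_apply, mul_zero, map_zero, add_zero, apply_ite, map_one, mul_ite, mul_one,
    Finset.sum_ite_eq, Finset.sum_ite_eq', Finset.mem_univ, if_true] at h
  norm_num at h
  linear_combination h / 3

/-- The nonzero common zeros of the partial derivatives of `Q` are exactly the points on
the coordinate lines, i.e. the singular points of `{Q=0} ⊂ ℙⁿ` are precisely the `n+1`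
coordinate points `[e₀], …, [e_n]`. -/
theorem elemCubic_singular_locus (n : ℕ) (hn : 2 ≤ n) :
    {p : Fin (n + 1) → ℂ | p ≠ 0 ∧ ∀ i, eval p (pderiv i (elemCubic n)) = 0} =
      {p : Fin (n + 1) → ℂ | ∃ (l : Fin (n + 1)) (c : ℂ), c ≠ 0 ∧ p = Pi.single l c} := by
  ext p
  simp only [Set.mem_ofPred_eq]
  constructor
  · rintro ⟨hp, hd⟩
    obtain ⟨i0, hi0⟩ : ∃ i, p i ≠ 0 := by
      by_contra! h
      exact hp (funext h)
    have H : ∀ i, (∑ j, p j) ^ 2 - (∑ j, p j ^ 2) - 2 * (∑ j, p j) * p i + 2 * p i ^ 2 = 0 := by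
      intro i
      rw [← elemCubic_pderiv, hd i, mul_zero]
    obtain ⟨a, ha⟩ : ∃ a, a = p i0 := ⟨_, rfl⟩
    obtain ⟨b, hb⟩ : ∃ b, b = (∑ j, p j) - a := ⟨_, rfl⟩
    rw [← ha] at hi0
    have hab : ∀ j, p j ≠ a → p j = b := by
      intro j hj
      have h1 := H j
      have h2 := H i0
      rw [← ha] at h2
      have : (p j - a) * (p j - b) = 0 := by
        rw [hb]; linear_combination (h1 - h2) / 2
      rcases mul_eq_zero.1 this with h | h
      · exact absurd (sub_eq_zero.1 h) hj
      · exact sub_eq_zero.1 h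
    obtain ⟨A, hA⟩ : ∃ A, A = Finset.univ.filter (fun j => p j = a) := ⟨_, rfl⟩
    obtain ⟨B, hB⟩ : ∃ B, B = Finset.univ.filter (fun j => ¬ p j = a) := ⟨_, rfl⟩
    have hS : ∀ f : ℂ → ℂ, ∑ j, f (p j) = A.card * f a + B.card * f b := by
      intro f
      rw [← Finset.sum_filter_add_sum_filter_not Finset.univ (fun j => p j = a), ← hA, ← hB]
      congr 1
      · rw [Finset.sum_congr rfl (g := fun _ => f a)]
        · simp
        · intro x hx; rw [hA] at hx; rw [(Finset.mem_filter.1 hx).2]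
      · rw [Finset.sum_congr rfl (g := fun _ => f b)]
        · simp
        · intro x hx; rw [hB] at hx; rw [hab _ (Finset.mem_filter.1 hx).2]
    have hs := hS id
    have hq := hS (fun x => x ^ 2)
    simp only [id] at hs
    have hcard : A.card + B.card = n + 1 := by
      rw [hA, hB, Finset.card_filter_add_card_filter_not]; simp
    have hcardC : (A.card : ℂ) + B.card = n + 1 := by exact_mod_cast hcard
    have h0 := H i0
    rw [← ha] at h0
    have hsab : (∑ j, p j) = a + b := by rw [hb]; ring
    have hAm : i0 ∈ A := by simp [hA, ha]
    rcases Finset.eq_empty_or_nonempty B with hBe | ⟨j0, hj0⟩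
    · exfalso
      rw [hBe] at hs hq hcardC
      simp only [Finset.card_empty, Nat.cast_zero, zero_mul, add_zero] at hs hq hcardC
      rw [hs, hq, hcardC] at h0
      have h1 : (n : ℂ) * ((n - 1 : ℂ) * a ^ 2) = 0 := by linear_combination h0
      have hn0 : (n : ℂ) ≠ 0 := by exact_mod_cast (by omega : n ≠ 0)
      have hn1 : (n : ℂ) - 1 ≠ 0 := by
        rw [sub_ne_zero]; exact_mod_cast (by omega : n ≠ 1)
      exact hi0 (by simpa [hn0, hn1] using h1)
    · have hne : a - b ≠ 0 := by
        rw [hB] at hj0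
        have h1 := (Finset.mem_filter.1 hj0).2
        rw [hab _ h1] at h1
        exact sub_ne_zero.2 (Ne.symm h1)
      rw [hsab] at hs h0
      rw [hq] at h0
      have e1 : ((A.card : ℂ) - 1) * a * (a - b) = 0 := by
        linear_combination b * hs - h0
      have e2 : ((B.card : ℂ) - 1) * b * (a - b) = 0 := by
        linear_combination -a * hs + h0
      have hk : A.card = 1 := by
        have : (A.card : ℂ) = 1 := by
          simpa [hne, hi0, sub_eq_zero] using e1
        exact_mod_cast this
      have hb0 : b = 0 := by
        have : (B.card : ℂ) - 1 ≠ 0 := by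
          rw [sub_ne_zero]; exact_mod_cast (by omega : B.card ≠ 1)
        simpa [hne, this] using e2
      refine ⟨i0, a, hi0, ?_⟩
      obtain ⟨l, hl⟩ := Finset.card_eq_one.1 hk
      funext j
      by_cases hj : j = i0
      · subst hj; simp [ha]
      · rw [Pi.single_eq_of_ne hj, ← hb0]
        apply hab
        intro hja
        apply hj
        have : j ∈ A := by simp [hA, hja]
        rw [hl, Finset.mem_singleton] at this hAm
        rw [this, hAm]
  · rintro ⟨l, c, hc, rfl⟩
    refine ⟨by simpa using hc, fun i => ?_⟩
    have h := elemCubic_pderiv n (Pi.single l c) i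
    have hs : ∑ j, (Pi.single l c : Fin (n + 1) → ℂ) j = c := by simp
    have hq : ∑ j, (Pi.single l c : Fin (n + 1) → ℂ) j ^ 2 = c ^ 2 := by
      simp [Pi.single_apply, ite_pow]
    rw [hs, hq] at h
    by_cases hi : i = l
    · subst hi
      rw [Pi.single_eq_same] at h
      linear_combination h / 2
    · rw [Pi.single_eq_of_ne hi] at h
      linear_combination h / 2
end

section
/- Let n ≥ 2 and Q = Σ_{0 ≤ i < j < k ≤ n} x_i x_j x_k ∈ ℂ[x₀,…,x_n]. Then for every 0 ≤ k ≤ n, the degree-k graded piece of the Milnor algebra satisfies dim S_k/J_{Q,k} = C(n+1, k) (binomial coefficient), i.e., the Hilbert function of M(Q) agrees in degrees ≤ n = T − 1 with that of the Milnor algebra of a smooth cubic, whose Hilbert series is (1+t)^{n+1}. -/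
open MvPolynomial

namespace ElemCubic

variable {N : ℕ}

/-- Indicator of supersets of `S`, a function on the hypercube. -/
noncomputable def chi (S : Finset (Fin N)) : Finset (Fin N) → ℂ := fun T => if S ⊆ T then 1 else 0

/-- Moebius functional. -/
noncomputable def mu (S : Finset (Fin N)) : (Finset (Fin N) → ℂ) →ₗ[ℂ] ℂ :=
  ∑ T ∈ S.powerset, (-1 : ℂ) ^ T.card • LinearMap.proj T

lemma mu_apply (S : Finset (Fin N)) (f : Finset (Fin N) → ℂ) :
    mu S f = ∑ T ∈ S.powerset, (-1 : ℂ) ^ T.card * f T := by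
  simp [mu]

lemma mu_chi (S S' : Finset (Fin N)) :
    mu S (chi S') = if S' = S then (-1 : ℂ) ^ S.card else 0 := by
  rw [mu_apply]
  split_ifs with h
  · subst h
    rw [Finset.sum_eq_single S']
    · simp [chi]
    · intro T hT hne
      rw [Finset.mem_powerset] at hT
      have : ¬ S' ⊆ T := fun h => hne (Finset.Subset.antisymm hT h)
      simp [chi, this]
    · simp
  · by_cases hs : S' ⊆ S
    · obtain ⟨j, hj, hj'⟩ := Finset.exists_of_ssubset (hs.ssubset_of_ne h)
      have hS : S = insert j (S.erase j) := (Finset.insert_erase hj).symm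
      rw [hS, Finset.sum_powerset_insert (Finset.notMem_erase j S), ← Finset.sum_add_distrib]
      apply Finset.sum_eq_zero
      intro T hT
      rw [Finset.mem_powerset] at hT
      have hjT : j ∉ T := fun h => Finset.notMem_erase j S (hT h)
      have : S' ⊆ insert j T ↔ S' ⊆ T := Finset.subset_insert_iff_of_notMem hj'
      rw [Finset.card_insert_of_notMem hjT]
      simp only [chi, this]
      ring
    · apply Finset.sum_eq_zero
      intro T hT
      rw [Finset.mem_powerset] at hT
      have : ¬ S' ⊆ T := fun h => hs (h.trans hT)
      simp [chi, this]

lemma chi_mul (S S' : Finset (Fin N)) : chi S * chi S' = chi (S ∪ S') := by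
  ext T
  simp only [chi, Pi.mul_apply, Finset.union_subset_iff]
  split_ifs <;> simp_all

lemma chi_empty : chi (∅ : Finset (Fin N)) = 1 := by
  ext T; simp [chi]

lemma chi_linInd : LinearIndependent ℂ (chi (N := N)) := by
  rw [Fintype.linearIndependent_iff]
  intro g hg S
  have := congrArg (mu S) hg
  simpa [map_sum, mu_chi] using this

/-- Functions of degree `< k`. -/
noncomputable def U (N k : ℕ) : Submodule ℂ (Finset (Fin N) → ℂ) :=
  Submodule.span ℂ (chi '' {S | S.card < k})

lemma chi_mem {k : ℕ} {S : Finset (Fin N)} (h : S.card < k) : chi S ∈ U N k :=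
  Submodule.subset_span ⟨S, h, rfl⟩

lemma U_finrank (k : ℕ) : Module.finrank ℂ (U N k) = ∑ j ∈ Finset.range k, N.choose j := by
  classical
  have h := finrank_span_eq_card (R := ℂ)
    (b := fun S : {S : Finset (Fin N) // S.card < k} => chi S.1)
    (chi_linInd.comp _ Subtype.val_injective)
  have hr : Set.range (fun S : {S : Finset (Fin N) // S.card < k} => chi S.1)
      = chi '' {S | S.card < k} := by
    ext f; simp
  rw [hr] at h
  rw [U, h, Fintype.card_subtype]
  rw [Finset.card_eq_sum_card_fiberwise (f := Finset.card) (t := Finset.range k)]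
  · apply Finset.sum_congr rfl
    intro j hj
    rw [Finset.mem_range] at hj
    rw [Finset.filter_filter]
    have : (Finset.univ.filter fun S : Finset (Fin N) => S.card < k ∧ S.card = j)
        = Finset.powersetCard j Finset.univ := by
      ext S
      simp [Finset.mem_powersetCard]
      omega
    rw [this]; simp
  · intro S hS
    simpa using hS

/-- The cardinality function. -/
noncomputable def cc (N : ℕ) : Finset (Fin N) → ℂ := ∑ i, chi {i}

lemma cc_apply (T : Finset (Fin N)) : cc N T = T.card := by
  simp [cc, chi]

lemma cc_mul_chi (S : Finset (Fin N)) : cc N * chi S = ∑ i, chi (insert i S) := by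
  simp [cc, Finset.sum_mul, chi_mul]

/-- Multiplication by `1 - |T|`. -/
noncomputable def ell (N : ℕ) : (Finset (Fin N) → ℂ) →ₗ[ℂ] (Finset (Fin N) → ℂ) :=
  LinearMap.mulLeft ℂ (1 - cc N)

lemma ell_chi (S : Finset (Fin N)) : ell N (chi S) = chi S - ∑ i, chi (insert i S) := by
  simp [ell, sub_mul, cc_mul_chi]

lemma U_mono {k l : ℕ} (h : k ≤ l) : U N k ≤ U N l :=
  Submodule.span_mono (Set.image_mono fun _ hS => lt_of_lt_of_le hS h)

lemma cc_mul_mem {k : ℕ} {f : Finset (Fin N) → ℂ} (hf : f ∈ U N k) : cc N * f ∈ U N (k + 1) := by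
  have : U N k ≤ (U N (k + 1)).comap (LinearMap.mulLeft ℂ (cc N)) := by
    rw [U, Submodule.span_le]
    rintro _ ⟨S, hS, rfl⟩
    simp only [SetLike.mem_coe, Submodule.mem_comap, LinearMap.mulLeft_apply, cc_mul_chi]
    refine Submodule.sum_mem _ fun i _ => chi_mem ?_
    have := Finset.card_insert_le i S
    simp only [Set.mem_ofPred_eq] at hS
    omega
  exact this hf

lemma ell_mem {k : ℕ} {f : Finset (Fin N) → ℂ} (hf : f ∈ U N k) : ell N f ∈ U N (k + 1) := by
  have : ell N f = f - cc N * f := by simp [ell, sub_mul]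
  rw [this]
  exact Submodule.sub_mem _ (U_mono (Nat.le_succ k) hf) (cc_mul_mem hf)

lemma mu_U {k : ℕ} {f : Finset (Fin N) → ℂ} (hf : f ∈ U N k) {S : Finset (Fin N)}
    (hS : k ≤ S.card) : mu S f = 0 := by
  have : U N k ≤ LinearMap.ker (mu S) := by
    rw [U, Submodule.span_le]
    rintro _ ⟨S', hS', rfl⟩
    simp only [SetLike.mem_coe, LinearMap.mem_ker, mu_chi]
    rw [if_neg]
    rintro rfl
    simp only [Set.mem_ofPred_eq] at hS'
    omega
  exact this hf

lemma ell_inj {k : ℕ} (hk : k + 1 ≤ N) {f : Finset (Fin N) → ℂ} (hf : f ∈ U N k)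
    (h : ell N f = 0) : f = 0 := by
  have h1 : ∀ T : Finset (Fin N), T.card ≠ 1 → f T = 0 := by
    intro T hT
    have := congrFun h T
    simp only [ell, LinearMap.mulLeft_apply, Pi.mul_apply, Pi.sub_apply, Pi.one_apply, cc_apply,
      Pi.zero_apply, mul_eq_zero] at this
    rcases this with h | h
    · exfalso; apply hT
      have : (T.card : ℂ) = 1 := by linear_combination -h
      exact_mod_cast this
    · exact h
  have h2 : ∀ S : Finset (Fin N), mu S f = - ∑ i ∈ S, f {i} := by
    intro S
    rw [mu_apply, ← Finset.sum_neg_distrib, ← Finset.sum_subset (s₁ := Finset.powersetCard 1 S)]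
    · rw [Finset.powersetCard_one, Finset.sum_map]
      simp
    · intro T hT
      rw [Finset.mem_powersetCard] at hT
      simpa using hT.1
    · intro T hT hT'
      rw [h1, mul_zero]
      intro h
      exact hT' (Finset.mem_powersetCard.2 ⟨by simpa using hT, h⟩)
  have h3 : ∀ i, f {i} = 0 := by
    intro i
    have e1 := h2 Finset.univ
    have e2 := h2 (Finset.univ.erase i)
    rw [mu_U hf (by simp; omega)] at e1
    rw [mu_U hf (by simp; omega)] at e2
    rw [← Finset.add_sum_erase _ _ (Finset.mem_univ i)] at e1
    linear_combination e1 - e2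
  ext T
  by_cases hT : T.card = 1
  · obtain ⟨i, rfl⟩ := Finset.card_eq_one.1 hT
    exact h3 i
  · exact h1 T hT


/-- Evaluation at vertices of the hypercube. -/
noncomputable def ev (N : ℕ) : MvPolynomial (Fin N) ℂ →ₐ[ℂ] (Finset (Fin N) → ℂ) :=
  aeval fun i => chi {i}

lemma chi_pow (S : Finset (Fin N)) {m : ℕ} (hm : m ≠ 0) : chi S ^ m = chi S := by
  obtain ⟨m, rfl⟩ := Nat.exists_eq_succ_of_ne_zero hm
  induction m with
  | zero => simp
  | succ m ih => rw [pow_succ, ih (by omega), chi_mul, Finset.union_self]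

lemma chi_prod (S : Finset (Fin N)) : ∏ i ∈ S, chi {i} = chi S := by
  induction S using Finset.induction_on with
  | empty => simp [chi_empty]
  | insert a S h ih => rw [Finset.prod_insert h, ih, chi_mul, Finset.insert_eq]

lemma ev_monomial (d : Fin N →₀ ℕ) : ev N (monomial d 1) = chi d.support := by
  rw [ev, aeval_monomial, map_one, one_mul, Finsupp.prod, ← chi_prod]
  apply Finset.prod_congr rfl
  intro i hi
  exact chi_pow _ (Finsupp.mem_support_iff.1 hi)

lemma card_support_le (d : Fin N →₀ ℕ) : d.support.card ≤ d.degree := by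
  rw [Finsupp.degree_apply, Finset.card_eq_sum_ones]
  apply Finset.sum_le_sum
  intro i hi
  have := Finsupp.mem_support_iff.1 hi
  omega

lemma hom_le {k : ℕ} {P : Submodule ℂ (MvPolynomial (Fin N) ℂ)}
    (h : ∀ d : Fin N →₀ ℕ, d.degree = k → monomial d 1 ∈ P) :
    homogeneousSubmodule (Fin N) ℂ k ≤ P := by
  intro p hp
  rw [p.as_sum]
  refine Submodule.sum_mem _ fun d hd => ?_
  have : monomial d (p.coeff d) = p.coeff d • monomial d (1 : ℂ) := by
    simp [smul_monomial]
  rw [this]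
  apply P.smul_mem
  apply h
  rw [mem_homogeneousSubmodule] at hp
  have := hp (mem_support_iff.1 hd)
  rw [← this, Finsupp.degree_eq_weight_one]; rfl

/-- The linear form `Σ x_i`. -/
noncomputable def ss (N : ℕ) : MvPolynomial (Fin N) ℂ := ∑ i, X i

lemma ev_ss : ev N (ss N) = cc N := by simp [ev, ss, cc]

/-- The simplified generators. -/
noncomputable def gen (i : Fin N) : MvPolynomial (Fin N) ℂ := X i * X i - ss N * X i

lemma ev_gen (i : Fin N) : ev N (gen i) = ell N (chi {i}) := by
  rw [gen, map_sub, map_mul, map_mul, ev_ss]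
  simp [ev, ell, sub_mul, chi_mul]

lemma ss_hom : (ss N).IsHomogeneous 1 := by
  apply IsHomogeneous.sum
  intro i _
  exact isHomogeneous_X _ _

lemma gen_hom (i : Fin N) : (gen i).IsHomogeneous 2 :=
  ((isHomogeneous_X _ i).mul (isHomogeneous_X _ i)).sub (ss_hom.mul (isHomogeneous_X _ i))

/-- The ideal of the simplified generators. -/
noncomputable def JJ (N : ℕ) : Ideal (MvPolynomial (Fin N) ℂ) := Ideal.span (Set.range gen)

/-- `ℓ U_k`. -/
noncomputable def L (N k : ℕ) : Submodule ℂ (Finset (Fin N) → ℂ) := (U N k).map (ell N)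

lemma ell_mul (f g : Finset (Fin N) → ℂ) : f * ell N g = ell N (f * g) := by
  simp [ell]; ring

lemma sup_eq (k : ℕ) :
    (homogeneousSubmodule (Fin N) ℂ k).map (ev N).toLinearMap ⊔ L N k = U N (k + 1) := by
  apply le_antisymm
  · apply sup_le
    · rw [Submodule.map_le_iff_le_comap]
      apply hom_le
      intro d hd
      simp only [Submodule.mem_comap, AlgHom.toLinearMap_apply, ev_monomial]
      apply chi_mem
      have := card_support_le d
      omega
    · rw [L, Submodule.map_le_iff_le_comap]
      intro f hf
      exact ell_mem hf
  · rw [U, Submodule.span_le]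
    rintro _ ⟨S, hS, rfl⟩
    simp only [Set.mem_ofPred_eq] at hS
    obtain ⟨m, rfl⟩ : ∃ m, k = S.card + m := ⟨k - S.card, by omega⟩
    have hU : ∀ j, cc N ^ j * chi S ∈ U N (S.card + j + 1) := by
      intro j
      induction j with
      | zero => simpa using chi_mem (Nat.lt_succ_self _)
      | succ j ih =>
        rw [pow_succ', mul_assoc]
        exact cc_mul_mem ih
    have hL : ∀ j ≤ m, chi S - cc N ^ j * chi S ∈ L N (S.card + m) := by
      intro j hj
      induction j with
      | zero => simp
      | succ j ih =>
        have e : chi S - cc N ^ (j + 1) * chi S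
            = (chi S - cc N ^ j * chi S) + ell N (cc N ^ j * chi S) := by
          simp [ell]; ring
        rw [e]
        exact Submodule.add_mem _ (ih (by omega))
          (Submodule.mem_map_of_mem (U_mono (by omega) (hU j)))
    have e : chi S = cc N ^ m * chi S + (chi S - cc N ^ m * chi S) := by ring
    rw [SetLike.mem_coe, e]
    apply Submodule.add_mem_sup _ (hL m le_rfl)
    refine ⟨ss N ^ m * ∏ i ∈ S, X i, ?_, ?_⟩
    · have h1 : (ss N ^ m).IsHomogeneous (1 * m) := ss_hom.pow m
      have h2 : (∏ i ∈ S, X i : MvPolynomial (Fin N) ℂ).IsHomogeneous (∑ i ∈ S, 1) :=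
        IsHomogeneous.prod _ _ _ fun i _ => isHomogeneous_X _ _
      have h3 := h1.mul h2
      rw [SetLike.mem_coe, mem_homogeneousSubmodule]
      convert h3 using 1
      simp; ring
    · simp only [AlgHom.toLinearMap_apply, map_mul, map_pow, ev_ss, map_prod]
      simp [ev, chi_prod]

lemma ev_mem_of_mem {k : ℕ} {p : MvPolynomial (Fin N) ℂ} (hp : p ∈ JJ N) :
    ev N (homogeneousComponent k p) ∈ L N k := by
  rw [JJ, Ideal.span, Submodule.mem_span_range_iff_exists_fun] at hp
  obtain ⟨c, rfl⟩ := hp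
  rw [map_sum, map_sum]
  refine Submodule.sum_mem _ fun i _ => ?_
  generalize c i = a
  rw [smul_eq_mul]
  rw [a.as_sum, Finset.sum_mul, map_sum, map_sum]
  refine Submodule.sum_mem _ fun d _ => ?_
  have : monomial d (a.coeff d) = a.coeff d • monomial d (1 : ℂ) := by
    simp [smul_monomial]
  rw [this, smul_mul_assoc, map_smul, map_smul]
  apply Submodule.smul_mem
  rw [homogeneousComponent_of_mem
    ((isHomogeneous_monomial (1 : ℂ) (rfl : d.degree = d.degree)).mul (gen_hom i))]
  split_ifs with h
  · rw [map_mul, ev_gen, ev_monomial, ell_mul, chi_mul]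
    refine Submodule.mem_map_of_mem (chi_mem ?_)
    have h1 := card_support_le d
    have h2 := Finset.card_union_le d.support {i}
    rw [Finset.card_singleton] at h2
    omega
  · simp

section quot

variable {A : Type*} [CommRing A] [Algebra ℂ A] (z : Fin N → A)

/-- The elements `σ^(k-|S|) z_S`. -/
noncomputable def zeta (k : ℕ) (S : Finset (Fin N)) : A := (∑ i, z i) ^ (k - S.card) * ∏ i ∈ S, z i

/-- The inverse map. -/
noncomputable def psi (k : ℕ) : (Finset (Fin N) → ℂ) →ₗ[ℂ] A :=
  ∑ S, (-1 : ℂ) ^ S.card • (mu S).smulRight (zeta z k S)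

lemma psi_chi (k : ℕ) (S : Finset (Fin N)) : psi z k (chi S) = zeta z k S := by
  simp only [psi, LinearMap.sum_apply, LinearMap.smul_apply, LinearMap.smulRight_apply, mu_chi]
  rw [Finset.sum_eq_single S]
  · rw [if_pos rfl, smul_smul, ← mul_pow]; simp
  · intro T _ hT
    rw [if_neg (Ne.symm hT)]; simp
  · simp

variable {z}

lemma zeta_insert (hz : ∀ i, z i * z i = (∑ j, z j) * z i)
    {k : ℕ} {S : Finset (Fin N)} (hS : S.card ≤ k) (i : Fin N) :
    zeta z (k + 1) (insert i S) = z i * zeta z k S := by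
  by_cases hi : i ∈ S
  · rw [Finset.insert_eq_of_mem hi]
    simp only [zeta]
    rw [show k + 1 - S.card = (k - S.card) + 1 by omega, ← Finset.mul_prod_erase _ _ hi, pow_succ]
    linear_combination (-(∑ i, z i) ^ (k - S.card) * ∏ i ∈ S.erase i, z i) * hz i
  · simp only [zeta]
    rw [Finset.prod_insert hi, Finset.card_insert_of_notMem hi, Nat.add_sub_add_right]
    ring

lemma psi_L (hz : ∀ i, z i * z i = (∑ j, z j) * z i)
    {k : ℕ} {f : Finset (Fin N) → ℂ} (hf : f ∈ L N k) : psi z k f = 0 := by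
  have : L N k ≤ LinearMap.ker (psi z k) := by
    rw [L, U, Submodule.map_span_le]
    rintro _ ⟨S, hS, rfl⟩
    simp only [Set.mem_ofPred_eq] at hS
    obtain ⟨k, rfl⟩ : ∃ j, k = j + 1 := ⟨k - 1, by omega⟩
    rw [LinearMap.mem_ker, ell_chi, map_sub, map_sum, psi_chi]
    simp only [psi_chi]
    rw [Finset.sum_congr rfl fun i _ => zeta_insert hz (by omega) i, ← Finset.sum_mul]
    simp only [zeta]
    rw [show k + 1 - S.card = (k - S.card) + 1 by omega]
    ring
  exact this hf

lemma prod_pow (hz : ∀ i, z i * z i = (∑ j, z j) * z i)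
    (d : Fin N →₀ ℕ) (S : Finset (Fin N)) (hS : ∀ i ∈ S, d i ≠ 0) :
    ∏ i ∈ S, z i ^ d i = (∑ i, z i) ^ (∑ i ∈ S, d i - S.card) * ∏ i ∈ S, z i := by
  have h1 : ∀ (i : Fin N) (m : ℕ), z i ^ (m + 1) = (∑ i, z i) ^ m * z i := by
    intro i m
    induction m with
    | zero => simp
    | succ m ih => rw [pow_succ, ih, mul_assoc, hz, pow_succ, mul_assoc]
  have h2 : ∑ i ∈ S, d i - S.card = ∑ i ∈ S, (d i - 1) := by
    rw [Finset.card_eq_sum_ones, ← Finset.sum_tsub_distrib]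
    intro i hi
    have := hS i hi
    omega
  rw [h2, ← Finset.prod_pow_eq_pow_sum, ← Finset.prod_mul_distrib]
  apply Finset.prod_congr rfl
  intro i hi
  have := hS i hi
  rw [← h1, Nat.sub_add_cancel (by omega)]

lemma psi_ev (hz : ∀ i, z i * z i = (∑ j, z j) * z i)
    {k : ℕ} {p : MvPolynomial (Fin N) ℂ} (hp : p ∈ homogeneousSubmodule (Fin N) ℂ k) :
    psi z k (ev N p) = aeval z p := by
  have : homogeneousSubmodule (Fin N) ℂ k ≤
      LinearMap.eqLocus ((psi z k).comp (ev N).toLinearMap) (aeval z).toLinearMap := by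
    apply hom_le
    intro d hd
    simp only [LinearMap.mem_eqLocus, LinearMap.comp_apply, AlgHom.toLinearMap_apply]
    rw [ev_monomial, psi_chi, aeval_monomial, map_one, one_mul, Finsupp.prod,
      prod_pow hz d _ fun i hi => Finsupp.mem_support_iff.1 hi, zeta, ← hd, Finsupp.degree_apply]
  exact this hp

end quot

lemma mem_iff {k : ℕ} {p : MvPolynomial (Fin N) ℂ} (hp : p ∈ homogeneousSubmodule (Fin N) ℂ k) :
    p ∈ JJ N ↔ ev N p ∈ L N k := by
  constructor
  · intro h
    have := ev_mem_of_mem (k := k) h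
    rwa [homogeneousComponent_of_mem hp, if_pos rfl] at this
  · intro h
    let z : Fin N → MvPolynomial (Fin N) ℂ ⧸ JJ N := fun i => Ideal.Quotient.mk _ (X i)
    have hz : ∀ i, z i * z i = (∑ j, z j) * z i := by
      intro i
      have : Ideal.Quotient.mk (JJ N) (gen i) = 0 :=
        Ideal.Quotient.eq_zero_iff_mem.2 (Ideal.subset_span ⟨i, rfl⟩)
      rw [gen, map_sub, map_mul, map_mul, ss, map_sum, sub_eq_zero] at this
      exact this
    have h1 := psi_ev hz hp
    rw [psi_L hz h] at h1
    have h2 : (aeval z : MvPolynomial (Fin N) ℂ →ₐ[ℂ] _) = Ideal.Quotient.mkₐ ℂ (JJ N) := by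
      ext i; simp [z]
    rw [h2] at h1
    exact Ideal.Quotient.eq_zero_iff_mem.1 h1.symm

lemma finrank_JJ {k : ℕ} (hk : k + 1 ≤ N) :
    Module.finrank ℂ (Submodule.map (Submodule.mkQ (Submodule.restrictScalars ℂ (JJ N)))
      (homogeneousSubmodule (Fin N) ℂ k)) = N.choose k := by
  set P := homogeneousSubmodule (Fin N) ℂ k
  let g1 := (Submodule.mkQ (Submodule.restrictScalars ℂ (JJ N))).comp P.subtype
  let g2 := ((L N k).mkQ.comp (ev N).toLinearMap).comp P.subtype
  have hker : LinearMap.ker g1 = LinearMap.ker g2 := by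
    ext ⟨p, hp⟩
    simp only [g1, g2, LinearMap.mem_ker, LinearMap.comp_apply, Submodule.mkQ_apply,
      Submodule.Quotient.mk_eq_zero, Submodule.subtype_apply, AlgHom.toLinearMap_apply]
    exact mem_iff hp
  have r1 : LinearMap.range g1 = P.map (Submodule.mkQ (Submodule.restrictScalars ℂ (JJ N))) := by
    simp [g1, LinearMap.range_comp]
  have r2 : LinearMap.range g2 = (U N (k + 1)).map (L N k).mkQ := by
    rw [← sup_eq, Submodule.map_sup, Submodule.mkQ_map_self, sup_bot_eq, ← Submodule.map_comp]
    simp [g2, LinearMap.range_comp, P]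
  rw [← r1]
  have e : LinearMap.range g1 ≃ₗ[ℂ] LinearMap.range g2 :=
    g1.quotKerEquivRange.symm ≪≫ₗ Submodule.quotEquivOfEq _ _ hker ≪≫ₗ g2.quotKerEquivRange
  rw [e.finrank_eq, r2]
  have hL : L N k ≤ U N (k + 1) := by rw [← sup_eq]; exact le_sup_right
  have hfL : Module.finrank ℂ (L N k) = Module.finrank ℂ (U N k) := by
    have hinj : Function.Injective ((ell N).domRestrict (U N k)) := by
      rw [injective_iff_map_eq_zero]
      rintro ⟨f, hf⟩ h
      exact Subtype.ext (ell_inj hk hf h)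
    have := LinearMap.finrank_range_of_inj hinj
    rwa [LinearMap.range_domRestrict] at this
  have hd := LinearMap.finrank_range_add_finrank_ker ((L N k).mkQ.domRestrict (U N (k + 1)))
  rw [LinearMap.range_domRestrict, LinearMap.ker_domRestrict, Submodule.ker_mkQ,
    (Submodule.comapSubtypeEquivOfLe hL).finrank_eq, hfL, U_finrank, U_finrank,
    Finset.sum_range_succ] at hd
  omega

lemma pderiv_elemCubic (n : ℕ) (i : Fin (n + 1)) :
    2 * pderiv i (elemCubic n) = 2 * gen i - ∑ j, gen j := by
  have h2 := MvPolynomial.mul_esymm_eq_sum (Fin (n + 1)) ℂ 2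
  have h3 := MvPolynomial.mul_esymm_eq_sum (Fin (n + 1)) ℂ 3
  have a2 : (Finset.HasAntidiagonal.antidiagonal 2).filter (fun a : ℕ × ℕ => a.1 < 2) = {(0, 2), (1, 1)} := by
    decide
  have a3 : (Finset.HasAntidiagonal.antidiagonal 3).filter (fun a : ℕ × ℕ => a.1 < 3)
      = {(0, 3), (1, 2), (2, 1)} := by decide
  rw [a2] at h2
  rw [a3] at h3
  simp at h2 h3
  have hQ : esymm (Fin (n + 1)) ℂ 3 = elemCubic n := rfl
  rw [hQ] at h3
  set p1 := psum (Fin (n + 1)) ℂ 1 with hp1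
  set p2 := psum (Fin (n + 1)) ℂ 2 with hp2
  set p3 := psum (Fin (n + 1)) ℂ 3 with hp3
  have h6 : 6 * elemCubic n = p1 ^ 3 - 3 * p1 * p2 + 2 * p3 := by
    have e1 : ∑ i, X i = p1 := by simp [hp1, psum]
    rw [e1] at h2 h3
    linear_combination 2 * h3 + p1 * h2
  have d1 : pderiv i p1 = 1 := by
    simp [hp1, psum, pderiv_X, Pi.single_apply]
  have d2 : pderiv i p2 = 2 * X i := by
    simp [hp2, psum, pderiv_X, Pi.single_apply]
  have d3 : pderiv i p3 = 3 * X i ^ 2 := by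
    simp [hp3, psum, pderiv_X, Pi.single_apply]
  have h7 := congrArg (pderiv i) h6
  have hs : ∑ j, gen j = p2 - p1 * p1 := by
    simp [gen, ss, hp1, hp2, psum, ← Finset.mul_sum, pow_two]
  have hg : gen i = X i * X i - p1 * X i := by
    simp [gen, ss, hp1, psum]
  have hc : ∀ m : ℕ, pderiv i (m : MvPolynomial (Fin (n + 1)) ℂ) = 0 := fun m => by simp
  have c6 := hc 6
  have c3 := hc 3
  have c2 := hc 2
  push_cast at c6 c3 c2
  simp [Derivation.leibniz, Derivation.leibniz_pow, d1, d2, d3, c6, c3, c2] at h7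
  have h3' : (3 : MvPolynomial (Fin (n + 1)) ℂ) ≠ 0 := by norm_num
  apply mul_left_cancel₀ h3'
  rw [hs, hg]
  linear_combination h7

lemma jac_eq (n : ℕ) (hn : 2 ≤ n) : jacobianIdeal (elemCubic n) = JJ (n + 1) := by
  have hC : (C (1 / 2 : ℂ) : MvPolynomial (Fin (n + 1)) ℂ) * 2 = 1 := by
    rw [show (2 : MvPolynomial (Fin (n + 1)) ℂ) = C 2 from rfl, ← C_mul]; norm_num
  have hp : ∀ i, pderiv i (elemCubic n) = gen i - C (1 / 2 : ℂ) * ∑ j, gen j := by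
    intro i
    linear_combination C (1 / 2 : ℂ) * pderiv_elemCubic n i
      + (gen i - pderiv i (elemCubic n)) * hC
  have hgen : ∀ i, (gen i : MvPolynomial (Fin (n + 1)) ℂ) ∈ JJ (n + 1) :=
    fun i => Ideal.subset_span ⟨i, rfl⟩
  have hder : ∀ i, pderiv i (elemCubic n) ∈ jacobianIdeal (elemCubic n) :=
    fun i => Ideal.subset_span ⟨i, rfl⟩
  apply le_antisymm
  · rw [jacobianIdeal, Ideal.span_le]
    rintro _ ⟨i, rfl⟩
    simp only [SetLike.mem_coe, hp]
    exact Ideal.sub_mem _ (hgen i) (Ideal.mul_mem_left _ _ (Ideal.sum_mem _ fun j _ => hgen j))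
  · have hsum : ∑ j, (gen j : MvPolynomial (Fin (n + 1)) ℂ) ∈ jacobianIdeal (elemCubic n) := by
      have e : ∑ i, pderiv i (elemCubic n)
          = C (1 - (n + 1) / 2 : ℂ) * ∑ j, (gen j : MvPolynomial (Fin (n + 1)) ℂ) := by
        simp only [hp, Finset.sum_sub_distrib, Finset.sum_const, Finset.card_univ,
          Fintype.card_fin, nsmul_eq_mul, C_sub, C_1, sub_mul, one_mul]
        rw [← mul_assoc]
        congr 2
        rw [show (((n + 1 : ℕ)) : MvPolynomial (Fin (n + 1)) ℂ) = C ((n + 1 : ℕ) : ℂ) from (map_natCast C _).symm,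
          ← C_mul]
        congr 1
        push_cast; ring
      have hne : (1 - (n + 1) / 2 : ℂ) ≠ 0 := by
        intro h
        have : (n : ℂ) = 1 := by linear_combination -2 * h
        have : n = 1 := by exact_mod_cast this
        omega
      have h2 : ∑ j, (gen j : MvPolynomial (Fin (n + 1)) ℂ)
          = C (1 - (n + 1) / 2 : ℂ)⁻¹ * ∑ i, pderiv i (elemCubic n) := by
        rw [e, ← mul_assoc, ← C_mul, inv_mul_cancel₀ hne, C_1, one_mul]
      rw [h2]
      exact Ideal.mul_mem_left _ _ (Ideal.sum_mem _ fun j _ => hder j)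
    rw [JJ, Ideal.span_le]
    rintro _ ⟨i, rfl⟩
    have : gen i = pderiv i (elemCubic n) + C (1 / 2 : ℂ) * ∑ j, gen j := by rw [hp]; ring
    rw [SetLike.mem_coe, this]
    exact Ideal.add_mem _ (hder i) (Ideal.mul_mem_left _ _ hsum)

end ElemCubic

/-- For `k ≤ n = T - 1`, `dim M(Q)_k = C(n+1,k)`, the Hilbert function of the Milnor
algebra of a smooth cubic, whose Hilbert series is `(1+t)^{n+1}`. -/
theorem elemCubic_milnor_dims (n : ℕ) (hn : 2 ≤ n) :
    ∀ k ≤ n, Module.finrank ℂ (milnorPiece (elemCubic n) k) = Nat.choose (n + 1) k := by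
  intro k hk
  rw [milnorPiece, ElemCubic.jac_eq n hn]
  exact ElemCubic.finrank_JJ (by omega)
end

section
/- Let Q = Σ_{0 ≤ i < j < k ≤ 4} x_i x_j x_k ∈ ℂ[x₀,…,x₄]. Then for every element b ∈ J_{Q,3} (the degree-3 part of the Jacobian ideal of Q), one has Σ_{i=0}^{4} ∂³b/∂x_i³ = 0; equivalently, the Fermat cubic lies in (J_{Q,3})^⊥ with respect to the polar pairing. -/
open MvPolynomial

/-- The cubic `Q = Σ_{0 ≤ i < j < k ≤ 4} x_i x_j x_k` in five variables. -/
noncomputable def elemCubic5 : MvPolynomial (Fin 5) ℂ :=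
  ∑ s ∈ Finset.powersetCard 3 Finset.univ, ∏ i ∈ s, X i

lemma fp_coeff_pderiv (i : Fin 5) (p : MvPolynomial (Fin 5) ℂ) (m : Fin 5 →₀ ℕ) :
    coeff m (pderiv i p) = coeff (m + Finsupp.single i 1) p * ((m i : ℂ) + 1) := by
  classical
  induction p using MvPolynomial.induction_on' with
  | add p q hp hq => simp [hp, hq, add_mul]
  | monomial u a =>
    rw [pderiv_monomial, coeff_monomial, coeff_monomial]
    by_cases h : u = m + Finsupp.single i 1
    · subst h
      simp
    · rw [if_neg h, zero_mul]
      split_ifs with h2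
      · by_cases hu : u i = 0
        · simp [hu]
        · exfalso
          apply h
          rw [← h2, tsub_add_cancel_of_le]
          simpa [Finsupp.single_le_iff] using Nat.one_le_iff_ne_zero.mpr hu
      · rfl

lemma fp_coeff_Q (i k : Fin 5) (n : ℕ) :
    coeff (Finsupp.single i n + Finsupp.single k 1) elemCubic5 = 0 := by
  classical
  unfold elemCubic5
  rw [coeff_sum]
  apply Finset.sum_eq_zero
  intro s hs
  have hs3 := (Finset.mem_powersetCard.mp hs).2
  have : (∏ j ∈ s, (X j : MvPolynomial (Fin 5) ℂ))
      = monomial (∑ j ∈ s, Finsupp.single j 1) 1 := by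
    rw [monomial_sum_one]; rfl
  rw [this, coeff_monomial, if_neg]
  intro h
  have hsub : s ⊆ {i, k} := by
    intro j hj
    by_contra hjn
    simp only [Finset.mem_insert, Finset.mem_singleton, not_or] at hjn
    have := DFunLike.congr_fun h j
    simp [Finsupp.single_apply, hj, Ne.symm hjn.1, Ne.symm hjn.2] at this
  have h1 := Finset.card_le_card hsub
  have h2 := Finset.card_le_two (a := i) (b := k)
  omega

lemma fp_coeff_J (i : Fin 5) (b : MvPolynomial (Fin 5) ℂ) (hb : b ∈ jacobianIdeal elemCubic5) :
    ∀ n : ℕ, coeff (Finsupp.single i n) b = 0 := by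
  classical
  unfold jacobianIdeal at hb
  induction hb using Submodule.span_induction with
  | mem x hx =>
    obtain ⟨k, rfl⟩ := hx
    intro n
    simp only [fp_coeff_pderiv, fp_coeff_Q, zero_mul]
  | zero => simp
  | add x y _ _ hx hy => intro n; simp [hx n, hy n]
  | smul a x _ hx =>
    intro n
    rw [smul_eq_mul, coeff_mul]
    apply Finset.sum_eq_zero
    intro p hp
    have hp' := Finset.HasAntidiagonal.mem_antidiagonal.mp hp
    have : p.2 = Finsupp.single i (p.2 i) := by
      ext j
      by_cases hj : i = j
      · subst hj; simp
      · have := DFunLike.congr_fun hp' j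
        simp [Finsupp.single_apply, hj] at this
        simp [Finsupp.single_apply, hj, this]
    rw [this, hx, mul_zero]

lemma fp_pderiv3 (i : Fin 5) (b : MvPolynomial (Fin 5) ℂ) (hb : b ∈ Jpart elemCubic5 3) :
    pderiv i (pderiv i (pderiv i b)) = 0 := by
  obtain ⟨hJ, hh⟩ := hb
  ext m
  simp only [fp_coeff_pderiv, coeff_zero]
  have : coeff (m + Finsupp.single i 1 + Finsupp.single i 1 + Finsupp.single i 1) b = 0 := by
    by_cases hm : m = 0
    · subst hm
      rw [zero_add, ← Finsupp.single_add, ← Finsupp.single_add]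
      exact fp_coeff_J i b hJ _
    · apply ((mem_homogeneousSubmodule 3 b).mp hh).coeff_eq_zero
      have : m.degree ≠ 0 := by simpa [Finsupp.degree_eq_zero_iff] using hm
      simp only [map_add, Finsupp.degree_single]
      omega
  rw [this]; ring

/-- For every `b ∈ J_{Q,3}` one has `Σ_i ∂³b/∂x_i³ = 0`; equivalently, the Fermat cubic
lies in `(J_{Q,3})^⊥` for the polar pairing. -/
theorem fermat_in_perp_of_elemCubic :
    (∀ b ∈ Jpart elemCubic5 3,
      (∑ i : Fin 5, pderiv i (pderiv i (pderiv i b))) = 0) ∧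
    (∑ i : Fin 5, (X i : MvPolynomial (Fin 5) ℂ) ^ 3) ∈ perp (Jpart elemCubic5 3) := by
  classical
  refine ⟨fun b hb => Finset.sum_eq_zero fun i _ => fp_pderiv3 i b hb, ?_, ?_⟩
  · exact Submodule.sum_mem _ fun i _ => (mem_homogeneousSubmodule 3 _).mpr (isHomogeneous_X_pow i 3)
  · intro b hb
    unfold polarPair
    rw [Finset.sum_eq_zero, map_zero]
    intro m hm
    have : ∃ i : Fin 5, Finsupp.single i 3 = m := by
      by_contra hcon
      push Not at hcon
      rw [mem_support_iff, coeff_sum] at hm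
      apply hm
      apply Finset.sum_eq_zero
      intro i _
      rw [coeff_X_pow, if_neg (hcon i)]
    obtain ⟨i, rfl⟩ := this
    have h3 := fp_pderiv3 i b hb
    convert smul_zero _
    fin_cases i <;> simpa [List.ofFn_succ, Finsupp.single_apply, pow_succ] using h3
end
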